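/- There is an absolute constant C > 0 with the following property. Let p be a large enough prime, let k < j be odd primes with j < p − 2, and let I ⊆ F_p be the image of a finite arithmetic progression. Then |P_j(I) ∩ P_k(I)| ≤ |I|²/p + C·j²·√p·(log p)², where P_j(x) = ∏_{i=1}^{j} (x+i), P_k(x) = ∏_{i=1}^{k} (x+i), P_j(I) = {P_j(a) : a ∈ I}, and P_k(I) = {P_k(a) : a ∈ I}. -/

import Mathlib

/-- `P_j(x) = ∏_{i=1}^{j} (x + i)` over `ZMod p`. -/
noncomputable def Pfact (p j : ℕ) : Polynomial (ZMod p) :=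
  ∏ i ∈ Finset.Icc 1 j, (Polynomial.X + Polynomial.C (i : ZMod p))

/-- The image in `ZMod p` of the arithmetic progression `{s, s+r, …, s+(m-1)r}`. -/
def apImage (p : ℕ) (s r : ZMod p) (m : ℕ) : Finset (ZMod p) :=
  (Finset.range m).image (fun i : ℕ => s + (i : ZMod p) * r)

section

open Module

/-- A filtered algebra that behaves like the functions on an affine curve with a single rational
place at infinity: `V n` is the space of functions of pole order `< n`. -/
structure PoleFiltration (F A : Type*) [Field F] [CommRing A] [Algebra F A] where
  V : ℕ → Submodule F A
  V_zero : V 0 = ⊥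
  mono : Monotone V
  exhaust : ∀ u, ∃ n, u ∈ V n
  one_mem : (1 : A) ∈ V 1
  mul_mem : ∀ {u v : A} {m n : ℕ}, u ∈ V (m + 1) → v ∈ V n → u * v ∈ V (m + n)
  mul_notMem : ∀ {u v : A} {m n : ℕ}, u ∉ V m → v ∉ V n → u * v ∉ V (m + n)
  one_dim : ∀ {u v : A} {n : ℕ}, u ∈ V (n + 1) → v ∈ V (n + 1) → v ∉ V n →
    ∃ t : F, u - t • v ∈ V n
  gap : ℕ
  le_finrank : ∀ n, n ≤ finrank F (V n) + gap

namespace PoleFiltration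

variable {F A : Type*} [Field F] [CommRing A] [Algebra F A] (O : PoleFiltration F A)

/-- `u` has pole order exactly `n`. -/
def HasDeg (u : A) (n : ℕ) : Prop := u ∈ O.V (n + 1) ∧ u ∉ O.V n

variable {O}

lemma ne_zero_of_notMem {u : A} {n : ℕ} (h : u ∉ O.V n) : u ≠ 0 := by
  rintro rfl; exact h (zero_mem _)

lemma notMem_zero {u : A} (h : u ≠ 0) : u ∉ O.V 0 := by
  rw [O.V_zero, Submodule.mem_bot]; exact h

lemma exists_hasDeg {u : A} (h : u ≠ 0) : ∃ n, O.HasDeg u n := by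
  classical
  have hex := O.exhaust u
  have h0 : Nat.find hex ≠ 0 := by
    intro h0
    have := Nat.find_spec hex
    rw [h0] at this
    exact notMem_zero h this
  obtain ⟨n, hn⟩ := Nat.exists_eq_succ_of_ne_zero h0
  refine ⟨n, ?_, ?_⟩
  · have := Nat.find_spec hex
    rwa [hn] at this
  · exact Nat.find_min hex (by omega)

lemma HasDeg.mul {u v : A} {m n : ℕ} (hu : O.HasDeg u m) (hv : O.HasDeg v n) :
    O.HasDeg (u * v) (m + n) :=
  ⟨by simpa only [add_assoc] using O.mul_mem hu.1 hv.1, O.mul_notMem hu.2 hv.2⟩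

lemma HasDeg.ne_zero {u : A} {m : ℕ} (hu : O.HasDeg u m) : u ≠ 0 := ne_zero_of_notMem hu.2

lemma HasDeg.le_of_mem {u : A} {m n : ℕ} (hu : O.HasDeg u m) (h : u ∈ O.V n) : m < n := by
  by_contra hc
  exact hu.2 (O.mono (not_lt.mp hc) h)

lemma HasDeg.unique {u : A} {m n : ℕ} (hu : O.HasDeg u m) (hv : O.HasDeg u n) : m = n := by
  have h1 := hu.le_of_mem hv.1
  have h2 := hv.le_of_mem hu.1
  omega

lemma HasDeg.add {u v : A} {m : ℕ} (hu : O.HasDeg u m) (hv : v ∈ O.V m) : O.HasDeg (u + v) m := by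
  refine ⟨add_mem hu.1 (O.mono (Nat.le_succ _) hv), fun h => hu.2 ?_⟩
  simpa using sub_mem h hv

lemma HasDeg.smul {u : A} {m : ℕ} (hu : O.HasDeg u m) {t : F} (ht : t ≠ 0) :
    O.HasDeg (t • u) m :=
  ⟨Submodule.smul_mem _ _ hu.1, fun h => hu.2 ((Submodule.smul_mem_iff _ ht).mp h)⟩

lemma isDomain (O : PoleFiltration F A) [Nontrivial A] : IsDomain A := by
  have : NoZeroDivisors A := ⟨by
    intro a b hab
    by_contra! h
    exact O.mul_notMem (notMem_zero (O := O) h.1) (notMem_zero h.2) (by simp [hab])⟩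
  exact NoZeroDivisors.to_isDomain A

variable (O) in
/-- The set of pole orders. -/
def degs : Set ℕ := {n | ∃ u, O.HasDeg u n}

/-- The element of `O.V n` is divisible by `u` only with quotient of the expected order. -/
lemma mem_of_mul_mem {u v : A} {m n : ℕ} (hu : u ∉ O.V m) (h : u * v ∈ O.V (m + n)) :
    v ∈ O.V n := by
  by_contra hv
  exact O.mul_notMem hu hv h

lemma finrank_quot_le (n : ℕ) [FiniteDimensional F (O.V n)] :
    FiniteDimensional F (O.V (n + 1)) ∧ finrank F (O.V (n + 1)) ≤ finrank F (O.V n) + 1 := by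
  by_cases h : ∃ u, O.HasDeg u n
  · obtain ⟨u, hu⟩ := h
    have key : O.V (n + 1) = O.V n ⊔ Submodule.span F {u} := by
      apply le_antisymm
      · intro a ha
        obtain ⟨t, ht⟩ := O.one_dim ha hu.1 hu.2
        rw [Submodule.mem_sup]
        exact ⟨_, ht, t • u, Submodule.smul_mem _ _ (Submodule.mem_span_singleton_self u),
          by simp⟩
      · refine sup_le (O.mono (Nat.le_succ n)) ?_
        rw [Submodule.span_singleton_le_iff_mem]
        exact hu.1
    rw [key]
    refine ⟨inferInstance, ?_⟩
    have h1 := Submodule.finrank_add_le_finrank_add_finrank (O.V n) (Submodule.span F {u})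
    have h2 := finrank_span_singleton (K := F) hu.ne_zero
    omega
  · have key : O.V (n + 1) = O.V n := by
      refine le_antisymm (fun a ha => ?_) (O.mono (Nat.le_succ n))
      by_contra hc
      exact h ⟨a, ha, hc⟩
    rw [key]
    exact ⟨inferInstance, by omega⟩

instance finiteDimensional_V (n : ℕ) : FiniteDimensional F (O.V n) := by
  induction n with
  | zero => rw [O.V_zero]; infer_instance
  | succ n ih => exact (finrank_quot_le n).1

lemma finrank_succ_le (n : ℕ) : finrank F (O.V (n + 1)) ≤ finrank F (O.V n) + 1 :=
  (finrank_quot_le n).2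

lemma finrank_le (n : ℕ) : finrank F (O.V n) ≤ n := by
  induction n with
  | zero => simp [O.V_zero]
  | succ n ih => have := finrank_succ_le (O := O) n; omega

lemma finrank_inf_lt (J : Submodule F A) {n : ℕ} {u : A} (hu : O.HasDeg u n) (hJ : u ∈ J) :
    finrank F (O.V n ⊓ J : Submodule F A) < finrank F (O.V (n + 1) ⊓ J : Submodule F A) := by
  apply Submodule.finrank_lt_finrank_of_lt
  refine lt_of_le_of_ne (inf_le_inf_right J (O.mono (Nat.le_succ n))) fun h => hu.2 ?_
  have : u ∈ O.V (n + 1) ⊓ J := ⟨hu.1, hJ⟩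
  rw [← h] at this
  exact this.1

lemma finrank_inf_succ_le (J : Submodule F A) (n : ℕ) :
    finrank F (O.V (n + 1) ⊓ J : Submodule F A) ≤ finrank F (O.V n ⊓ J : Submodule F A) + 1 := by
  have h1 := Submodule.finrank_sup_add_finrank_inf_eq (O.V (n + 1) ⊓ J) (O.V n)
  have h2 : (O.V (n + 1) ⊓ J) ⊓ O.V n = O.V n ⊓ J := by
    ext a
    simp only [Submodule.mem_inf]
    exact ⟨fun h => ⟨h.2, h.1.2⟩, fun h => ⟨⟨O.mono (Nat.le_succ n) h.1, h.2⟩, h.1⟩⟩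
  have h3 : (O.V (n + 1) ⊓ J) ⊔ O.V n ≤ O.V (n + 1) :=
    sup_le inf_le_left (O.mono (Nat.le_succ n))
  have h4 := Submodule.finrank_mono h3
  have h5 := finrank_succ_le (O := O) n
  rw [h2] at h1
  omega

lemma finrank_inf_succ_eq (J : Submodule F A) (n : ℕ) (h : ∃ u ∈ J, O.HasDeg u n) :
    finrank F (O.V (n + 1) ⊓ J : Submodule F A) = finrank F (O.V n ⊓ J : Submodule F A) + 1 := by
  obtain ⟨u, hJ, hu⟩ := h
  have := finrank_inf_lt J hu hJ
  have := finrank_inf_succ_le (O := O) J n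
  omega

lemma finrank_inf_succ_of_not (J : Submodule F A) (n : ℕ) (h : ¬ ∃ u ∈ J, O.HasDeg u n) :
    finrank F (O.V (n + 1) ⊓ J : Submodule F A) = finrank F (O.V n ⊓ J : Submodule F A) := by
  have : O.V (n + 1) ⊓ J = O.V n ⊓ J := by
    refine le_antisymm (fun a ha => ⟨?_, ha.2⟩) (inf_le_inf_right J (O.mono (Nat.le_succ n)))
    by_contra hc
    exact h ⟨a, ha.2, ha.1, hc⟩
  rw [this]

open Classical in
/-- The dimension of `V n ∩ J` counts the pole orders `< n` occurring in `J`. -/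
lemma finrank_inf_eq_card (J : Submodule F A) (n : ℕ) :
    finrank F (O.V n ⊓ J : Submodule F A) =
      ((Finset.range n).filter fun m => ∃ u ∈ J, O.HasDeg u m).card := by
  induction n with
  | zero => simp [O.V_zero]
  | succ n ih =>
    rw [Finset.range_add_one, Finset.filter_insert]
    split_ifs with h
    · rw [Finset.card_insert_of_notMem (by simp), finrank_inf_succ_eq J n h, ih]
    · rw [finrank_inf_succ_of_not J n h, ih]

/-- The reduction map `V n → A ⧸ J`. -/
def redV (J : Ideal A) (n : ℕ) : O.V n →ₗ[F] A ⧸ J :=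
  (Ideal.Quotient.mkₐ F J).toLinearMap.domRestrict (O.V n)

@[simp] lemma redV_apply (J : Ideal A) (n : ℕ) (a : O.V n) :
    redV J n a = Ideal.Quotient.mk J (a : A) := rfl

lemma finrank_range_redV_add (J : Ideal A) (n : ℕ) :
    finrank F (LinearMap.range (redV (O := O) J n)) +
      finrank F (O.V n ⊓ J.restrictScalars F : Submodule F A) = finrank F (O.V n) := by
  have h : Submodule.comap (O.V n).subtype (J.restrictScalars F) =
      LinearMap.ker (redV (O := O) J n) := by
    ext a
    simp [Ideal.Quotient.eq_zero_iff_mem]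
  rw [← LinearMap.finrank_range_add_finrank_ker (redV (O := O) J n), ← Submodule.map_comap_subtype,
    Submodule.finrank_map_subtype_eq, h]

/-- An ideal of codimension `δ` contains an element of every pole order `n ≥ 2 gap + δ`. -/
lemma exists_hasDeg_mem (J : Ideal A) [FiniteDimensional F (A ⧸ J)] {n : ℕ}
    (hn : 2 * O.gap + finrank F (A ⧸ J) ≤ n) : ∃ u ∈ J, O.HasDeg u n := by
  classical
  by_contra hc
  have h1 := finrank_range_redV_add (O := O) J (n + 1)
  have h2 := Submodule.finrank_le (LinearMap.range (redV (O := O) J (n + 1)))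
  have h3 := O.le_finrank (n + 1)
  have e1 := finrank_inf_eq_card (O := O) (J.restrictScalars F) (n + 1)
  have e2 := finrank_inf_eq_card (O := O) ⊤ (n + 1)
  rw [inf_top_eq] at e2
  set X := (Finset.range (n + 1)).filter fun m => ∃ u ∈ J.restrictScalars F, O.HasDeg u m
  set Y := (Finset.range (n + 1)).filter fun m => ∃ u ∈ (⊤ : Submodule F A), O.HasDeg u m
  have hdisj : Disjoint X (Y.image fun s => n - s) := by
    rw [Finset.disjoint_left]
    intro m hm hm'
    obtain ⟨s, hs, rfl⟩ := Finset.mem_image.mp hm'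
    obtain ⟨-, v, hvJ, hv⟩ := Finset.mem_filter.mp hm
    obtain ⟨hsn, w, -, hw⟩ := Finset.mem_filter.mp hs
    have hsn' := Finset.mem_range.mp hsn
    refine hc ⟨w * v, J.mul_mem_left _ hvJ, ?_⟩
    have := hw.mul hv
    rwa [show s + (n - s) = n by omega] at this
  have hcard : (Y.image fun s => n - s).card = Y.card := by
    refine Finset.card_image_of_injOn fun a ha b hb hab => ?_
    have ha' := Finset.mem_range.mp (Finset.mem_filter.mp ha).1
    have hb' := Finset.mem_range.mp (Finset.mem_filter.mp hb).1
    omega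
  have hsub : X ∪ (Y.image fun s => n - s) ⊆ Finset.range (n + 1) := by
    refine Finset.union_subset (Finset.filter_subset _ _) fun m hm => ?_
    obtain ⟨s, -, rfl⟩ := Finset.mem_image.mp hm
    exact Finset.mem_range.mpr (by omega)
  have := Finset.card_le_card hsub
  rw [Finset.card_union_of_disjoint hdisj, hcard, Finset.card_range] at this
  omega

lemma exists_hasDeg_of_le {n : ℕ} (hn : 2 * O.gap ≤ n) : ∃ u, O.HasDeg u n := by
  have : Subsingleton (A ⧸ (⊤ : Ideal A)) := Ideal.Quotient.subsingleton_iff.mpr rfl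
  obtain ⟨u, -, hu⟩ := exists_hasDeg_mem (O := O) ⊤ (n := n) (by
    rw [finrank_zero_of_subsingleton]; exact hn)
  exact ⟨u, hu⟩

lemma finrank_V_add {n : ℕ} (hn : 2 * O.gap ≤ n) (m : ℕ) :
    finrank F (O.V (n + m)) = finrank F (O.V n) + m := by
  induction m with
  | zero => rfl
  | succ m ih =>
    obtain ⟨u, hu⟩ := exists_hasDeg_of_le (O := O) (n := n + m) (by omega)
    have := finrank_inf_succ_eq (O := O) ⊤ (n + m) ⟨u, trivial, hu⟩
    rw [inf_top_eq, inf_top_eq] at this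
    rw [← add_assoc, this, ih]
    ring

/-- Every residue class modulo `J` has a representative in `V n` once `n ≥ 2 gap + codim J`. -/
lemma exists_sub_mem (J : Ideal A) [FiniteDimensional F (A ⧸ J)] {n : ℕ}
    (hn : 2 * O.gap + finrank F (A ⧸ J) ≤ n) (a : A) : ∃ v ∈ O.V n, a - v ∈ J := by
  obtain ⟨m, hm⟩ := O.exhaust a
  induction m generalizing a with
  | zero => exact ⟨a, O.mono (Nat.zero_le _) hm, by simp⟩
  | succ m ih =>
    by_cases hmn : m + 1 ≤ n
    · exact ⟨a, O.mono hmn hm, by simp⟩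
    · obtain ⟨u, huJ, hu⟩ := exists_hasDeg_mem (O := O) J (n := m) (by omega)
      obtain ⟨t, ht⟩ := O.one_dim hm hu.1 hu.2
      obtain ⟨v, hv, hv'⟩ := ih _ ht
      refine ⟨v, hv, ?_⟩
      have := add_mem hv' (Submodule.smul_of_tower_mem J t huJ)
      convert this using 1
      ring

lemma redV_surjective (J : Ideal A) [FiniteDimensional F (A ⧸ J)] {n : ℕ}
    (hn : 2 * O.gap + finrank F (A ⧸ J) ≤ n) : Function.Surjective (redV (O := O) J n) := by
  intro q
  obtain ⟨a, rfl⟩ := Ideal.Quotient.mk_surjective q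
  obtain ⟨v, hv, h⟩ := exists_sub_mem (O := O) J hn a
  exact ⟨⟨v, hv⟩, by
    rw [redV_apply, eq_comm, Ideal.Quotient.eq]
    exact h⟩

lemma finrank_inf_add (J : Ideal A) [FiniteDimensional F (A ⧸ J)] {n : ℕ}
    (hn : 2 * O.gap + finrank F (A ⧸ J) ≤ n) :
    finrank F (O.V n ⊓ J.restrictScalars F : Submodule F A) + finrank F (A ⧸ J) =
      finrank F (O.V n) := by
  rw [← finrank_range_redV_add (O := O) J n, LinearMap.range_eq_top.mpr (redV_surjective J hn),
    finrank_top, add_comm]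

open Classical in
variable (O) in
/-- A chosen element of each pole order. -/
noncomputable def elt (s : ℕ) : A := if h : ∃ u, O.HasDeg u s then h.choose else 0

lemma elt_hasDeg {s : ℕ} (h : s ∈ O.degs) : O.HasDeg (O.elt s) s := by
  have h' : ∃ u, O.HasDeg u s := h
  rw [elt, dif_pos h']
  exact h'.choose_spec

open Classical in
variable (O) in
/-- The pole orders which are not pole orders of multiples of an element of pole order `N`. -/
noncomputable def stdDegs (N : ℕ) : Finset ℕ :=
  (Finset.range (N + 2 * O.gap)).filter fun s => s ∈ O.degs ∧ ¬ ∃ m ∈ O.degs, s = N + m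

lemma mem_stdDegs {N s : ℕ} :
    s ∈ O.stdDegs N ↔ s ∈ O.degs ∧ ¬ ∃ m ∈ O.degs, s = N + m := by
  classical
  rw [stdDegs, Finset.mem_filter, and_iff_right_iff_imp]
  rintro ⟨-, h⟩
  rw [Finset.mem_range]
  by_contra hc
  exact h ⟨s - N, exists_hasDeg_of_le (by omega), by omega⟩

/-- Division with remainder by an element of pole order `N`. -/
lemma exists_division {u : A} {N : ℕ} (hu : O.HasDeg u N) {n : ℕ} {a : A} (ha : a ∈ O.V n) :
    ∃ v ∈ O.V (n - N), ∃ r ∈ Submodule.span F (O.elt '' {s | s ∈ O.stdDegs N ∧ s < n}),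
      a = r + u * v := by
  induction n generalizing a with
  | zero =>
    refine ⟨0, zero_mem _, 0, zero_mem _, ?_⟩
    rw [O.V_zero, Submodule.mem_bot] at ha
    simp [ha]
  | succ n ih =>
    have hsub : Submodule.span F (O.elt '' {s | s ∈ O.stdDegs N ∧ s < n}) ≤
        Submodule.span F (O.elt '' {s | s ∈ O.stdDegs N ∧ s < n + 1}) :=
      Submodule.span_mono (Set.image_mono fun s hs => ⟨hs.1, hs.2.trans (Nat.lt_succ_self n)⟩)
    have hV : O.V (n - N) ≤ O.V (n + 1 - N) := O.mono (by omega)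
    by_cases haV : a ∈ O.V n
    · obtain ⟨v, hv, r, hr, rfl⟩ := ih haV
      exact ⟨v, hV hv, r, hsub hr, rfl⟩
    have hnd : n ∈ O.degs := ⟨a, ha, haV⟩
    by_cases hn : n ∈ O.stdDegs N
    · have he := elt_hasDeg hnd
      obtain ⟨t, ht⟩ := O.one_dim ha he.1 he.2
      obtain ⟨v, hv, r, hr, h⟩ := ih ht
      refine ⟨v, hV hv, r + t • O.elt n, add_mem (hsub hr) (Submodule.smul_mem _ _
        (Submodule.subset_span ⟨n, ⟨hn, Nat.lt_succ_self n⟩, rfl⟩)), ?_⟩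
      rw [sub_eq_iff_eq_add] at h
      rw [h]
      ring
    · rw [mem_stdDegs, not_and, not_not] at hn
      obtain ⟨m, hm, hnm⟩ := hn hnd
      have he := hu.mul (elt_hasDeg hm)
      rw [← hnm] at he
      obtain ⟨t, ht⟩ := O.one_dim ha he.1 he.2
      obtain ⟨v, hv, r, hr, h⟩ := ih ht
      refine ⟨v + t • O.elt m, add_mem (hV hv) (Submodule.smul_mem _ _ ?_), r, hsub hr, ?_⟩
      · rw [show n + 1 - N = m + 1 by omega]
        exact (elt_hasDeg hm).1
      · rw [sub_eq_iff_eq_add] at h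
        rw [h, mul_add, mul_smul_comm]
        ring

lemma sum_elt_hasDeg {X : Finset ℕ} (hX : ∀ s ∈ X, s ∈ O.degs) (c : ℕ → F)
    (h : ∃ s ∈ X, c s ≠ 0) : ∃ s ∈ X, O.HasDeg (∑ s ∈ X, c s • O.elt s) s := by
  classical
  have hne : (X.filter fun s => c s ≠ 0).Nonempty := by
    obtain ⟨s, hs, hc⟩ := h
    exact ⟨s, Finset.mem_filter.mpr ⟨hs, hc⟩⟩
  set m := (X.filter fun s => c s ≠ 0).max' hne with hm
  obtain ⟨hmX, hmc⟩ := Finset.mem_filter.mp (Finset.max'_mem _ hne)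
  refine ⟨m, hmX, ?_⟩
  rw [← Finset.add_sum_erase _ _ hmX]
  refine ((elt_hasDeg (hX _ hmX)).smul hmc).add (Submodule.sum_mem _ fun s hs => ?_)
  obtain ⟨hsm, hsX⟩ := Finset.mem_erase.mp hs
  by_cases hcs : c s = 0
  · simp [hcs]
  · have hle : s ≤ m := Finset.le_max' _ _ (Finset.mem_filter.mpr ⟨hsX, hcs⟩)
    exact Submodule.smul_mem _ _ (O.mono (by omega) (elt_hasDeg (hX _ hsX)).1)

lemma linearIndependent_quot {u : A} {N : ℕ} (hu : O.HasDeg u N) :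
    LinearIndependent F fun s : O.stdDegs N =>
      (Ideal.Quotient.mk (Ideal.span {u}) (O.elt s) : A ⧸ Ideal.span {u}) := by
  classical
  rw [Fintype.linearIndependent_iff]
  intro g hg s
  by_contra hs
  let c : ℕ → F := fun s => if h : s ∈ O.stdDegs N then g ⟨s, h⟩ else 0
  have hc : ∀ s : O.stdDegs N, c s = g s := fun s => by simp [c]
  obtain ⟨m, hm, hdeg⟩ := sum_elt_hasDeg (O := O) (X := O.stdDegs N)
    (fun s hs => (mem_stdDegs.mp hs).1) c ⟨s, s.2, by rw [hc]; exact hs⟩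
  have hsum : (∑ s ∈ O.stdDegs N, c s • O.elt s) ∈ Ideal.span {u} := by
    rw [← Ideal.Quotient.eq_zero_iff_mem, ← hg, ← Finset.sum_coe_sort, map_sum]
    refine Finset.sum_congr rfl fun s _ => ?_
    rw [hc]
    rfl
  obtain ⟨v, hv⟩ := Ideal.mem_span_singleton.mp hsum
  rw [hv] at hdeg
  have hv0 : v ≠ 0 := by
    rintro rfl
    exact hdeg.ne_zero (mul_zero u)
  obtain ⟨k, hk⟩ := exists_hasDeg (O := O) hv0
  exact (mem_stdDegs.mp hm).2 ⟨k, ⟨v, hk⟩, hdeg.unique (hu.mul hk)⟩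

lemma top_le_span_quot {u : A} {N : ℕ} (hu : O.HasDeg u N) :
    ⊤ ≤ Submodule.span F (Set.range fun s : O.stdDegs N =>
      (Ideal.Quotient.mk (Ideal.span {u}) (O.elt s) : A ⧸ Ideal.span {u})) := by
  rintro q -
  obtain ⟨a, rfl⟩ := Ideal.Quotient.mk_surjective q
  obtain ⟨n, hn⟩ := O.exhaust a
  obtain ⟨v, -, r, hr, rfl⟩ := exists_division hu hn
  have h1 : (Ideal.Quotient.mk (Ideal.span {u})) (r + u * v) =
      (Ideal.Quotient.mkₐ F (Ideal.span {u})).toLinearMap r := by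
    rw [map_add, Ideal.Quotient.eq_zero_iff_mem.mpr
      (Ideal.mul_mem_right _ _ (Ideal.mem_span_singleton_self u)), add_zero]
    rfl
  rw [h1]
  have h2 := Submodule.mem_map_of_mem (f := (Ideal.Quotient.mkₐ F (Ideal.span {u})).toLinearMap) hr
  rw [Submodule.map_span] at h2
  refine Submodule.span_mono ?_ h2
  rintro _ ⟨_, ⟨s, hs, rfl⟩, rfl⟩
  exact ⟨⟨s, hs.1⟩, rfl⟩

/-- The basis of `A ⧸ (u)` given by the standard pole orders. -/
noncomputable def quotBasis {u : A} {N : ℕ} (hu : O.HasDeg u N) :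
    Basis (O.stdDegs N) F (A ⧸ Ideal.span {u}) :=
  Basis.mk (linearIndependent_quot hu) (top_le_span_quot hu)

lemma quotBasis_apply {u : A} {N : ℕ} (hu : O.HasDeg u N) (s : O.stdDegs N) :
    quotBasis hu s = Ideal.Quotient.mk (Ideal.span {u}) (O.elt s) := by
  rw [quotBasis, Basis.mk_apply]

lemma finiteDimensional_quot {u : A} {N : ℕ} (hu : O.HasDeg u N) :
    FiniteDimensional F (A ⧸ Ideal.span {u}) :=
  (quotBasis hu).finiteDimensional_of_finite

lemma repr_of_mem {u : A} {N : ℕ} (hu : O.HasDeg u N) (s : O.stdDegs N) {a : A}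
    (ha : a ∈ O.V s) : (quotBasis hu).repr (Ideal.Quotient.mk _ a) s = 0 := by
  obtain ⟨v, -, r, hr, rfl⟩ := exists_division hu ha
  rw [map_add, Ideal.Quotient.eq_zero_iff_mem.mpr
      (Ideal.mul_mem_right _ _ (Ideal.mem_span_singleton_self u)), add_zero]
  have key : Submodule.span F (O.elt '' {m | m ∈ O.stdDegs N ∧ m < s}) ≤
      LinearMap.ker ((quotBasis hu).coord s ∘ₗ
        (Ideal.Quotient.mkₐ F (Ideal.span {u})).toLinearMap) := by
    rw [Submodule.span_le]
    rintro _ ⟨m, ⟨hm, hms⟩, rfl⟩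
    have h := quotBasis_apply hu ⟨m, hm⟩
    have : (Ideal.Quotient.mkₐ F (Ideal.span {u})).toLinearMap (O.elt m) = quotBasis hu ⟨m, hm⟩ :=
      h.symm
    rw [SetLike.mem_coe, LinearMap.mem_ker, LinearMap.comp_apply, this, Basis.coord_apply,
      Basis.repr_self, Finsupp.single_apply, if_neg]
    intro h
    rw [← h] at hms
    exact lt_irrefl _ hms
  exact key hr

lemma repr_of_sub_mem {u : A} {N : ℕ} (hu : O.HasDeg u N) (s : O.stdDegs N) {a : A} {t : F}
    (ha : a - t • O.elt s ∈ O.V s) : (quotBasis hu).repr (Ideal.Quotient.mk _ a) s = t := by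
  have h := repr_of_mem hu s ha
  have h1 : Ideal.Quotient.mk (Ideal.span {u}) (a - t • O.elt s) =
      Ideal.Quotient.mk (Ideal.span {u}) a - t • quotBasis hu s := by
    rw [map_sub, quotBasis_apply]
    rfl
  rw [h1, map_sub, map_smul, Basis.repr_self, Finsupp.sub_apply, Finsupp.smul_apply,
    Finsupp.single_eq_same, smul_eq_mul, mul_one, sub_eq_zero] at h
  exact h

/-- The codimension of a principal ideal is the pole order of its generator. -/
lemma finrank_quot {u : A} {N : ℕ} (hu : O.HasDeg u N) :
    finrank F (A ⧸ Ideal.span {u}) = N := by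
  have := finiteDimensional_quot hu
  set J := Ideal.span {u} with hJ
  set n := 2 * O.gap + finrank F (A ⧸ J) with hn
  have h1 := finrank_inf_add (O := O) J (n := n + N) (by omega)
  have h2 : O.V (n + N) ⊓ J.restrictScalars F = (O.V n).map (LinearMap.mulLeft F u) := by
    ext a
    simp only [Submodule.mem_inf, Submodule.restrictScalars_mem, Submodule.mem_map,
      LinearMap.mulLeft_apply, hJ, Ideal.mem_span_singleton]
    constructor
    · rintro ⟨ha, v, rfl⟩
      exact ⟨v, mem_of_mul_mem hu.2 (by rwa [add_comm]), rfl⟩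
    · rintro ⟨v, hv, rfl⟩
      exact ⟨by rw [add_comm]; exact O.mul_mem hu.1 hv, v, rfl⟩
  have hinj : Function.Injective (LinearMap.mulLeft F u) := by
    rw [injective_iff_map_eq_zero]
    intro v hv
    by_contra hv0
    exact O.mul_notMem hu.2 (notMem_zero hv0) (by
      rw [LinearMap.mulLeft_apply] at hv
      rw [hv]
      exact zero_mem _)
  rw [h2, ← (Submodule.equivMapOfInjective _ hinj (O.V n)).finrank_eq,
    finrank_V_add (n := n) (by omega) N] at h1
  omega

lemma card_stdDegs {u : A} {N : ℕ} (hu : O.HasDeg u N) : (O.stdDegs N).card = N := by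
  have h := Module.finrank_eq_card_basis (quotBasis hu)
  rw [finrank_quot hu, Fintype.card_coe] at h
  exact h.symm

end PoleFiltration

end

section

open Module

namespace PoleFiltration

variable {F A : Type*} [Field F] [CommRing A] [Algebra F A] {O : PoleFiltration F A}

lemma trace_quot_eq {u : A} {N : ℕ} (hu : O.HasDeg u N) (h : A) :
    Algebra.trace F (A ⧸ Ideal.span {u}) (Ideal.Quotient.mk _ h) =
      ∑ s : O.stdDegs N, (quotBasis hu).repr (Ideal.Quotient.mk _ (h * O.elt s)) s := by
  classical
  rw [Algebra.trace_eq_matrix_trace (quotBasis hu), Matrix.trace]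
  refine Finset.sum_congr rfl fun s _ => ?_
  rw [Matrix.diag_apply, Algebra.leftMulMatrix_eq_repr_mul, quotBasis_apply, ← map_mul]

lemma repr_eq_repr {u u' : A} {N : ℕ} (hu : O.HasDeg u N) (hu' : O.HasDeg u' N)
    (s : O.stdDegs N) {r : A} (hr : r ∈ Submodule.span F (O.elt '' {m | m ∈ O.stdDegs N})) :
    (quotBasis hu).repr (Ideal.Quotient.mk _ r) s =
      (quotBasis hu').repr (Ideal.Quotient.mk _ r) s := by
  have key : Set.EqOn ((quotBasis hu).coord s ∘ₗ (Ideal.Quotient.mkₐ F _).toLinearMap)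
      ((quotBasis hu').coord s ∘ₗ (Ideal.Quotient.mkₐ F _).toLinearMap)
      (Submodule.span F (O.elt '' {m | m ∈ O.stdDegs N})) := by
    refine LinearMap.eqOn_span ?_
    rintro _ ⟨m, hm, rfl⟩
    have h : (Ideal.Quotient.mkₐ F (Ideal.span {u})).toLinearMap (O.elt m) =
      quotBasis hu ⟨m, hm⟩ := (quotBasis_apply hu ⟨m, hm⟩).symm
    have h' : (Ideal.Quotient.mkₐ F (Ideal.span {u'})).toLinearMap (O.elt m) =
      quotBasis hu' ⟨m, hm⟩ := (quotBasis_apply hu' ⟨m, hm⟩).symm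
    rw [LinearMap.comp_apply, LinearMap.comp_apply, h, h', Basis.coord_apply, Basis.coord_apply,
      Basis.repr_self, Basis.repr_self]
  exact key hr

open Classical in
lemma card_stdDegs_filter {d N : ℕ} {h : A} (hh : O.HasDeg h d) (hN : 2 * O.gap + d ≤ N) :
    ((O.stdDegs N).filter fun s => ∃ m ∈ O.degs, d + s = N + m).card = d := by
  conv_rhs => rw [← card_stdDegs hh]
  symm
  refine Finset.card_bij (fun t _ => t + (N - d)) ?_ (fun a _ b _ hab => by omega) ?_
  · intro t ht
    obtain ⟨h1, h2⟩ := mem_stdDegs.mp ht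
    refine Finset.mem_filter.mpr ⟨mem_stdDegs.mpr ⟨exists_hasDeg_of_le (by omega), ?_⟩,
      t, h1, by omega⟩
    rintro ⟨m, hm, h⟩
    exact h2 ⟨m, hm, by omega⟩
  · intro s hs
    obtain ⟨h1, m, hm, h⟩ := Finset.mem_filter.mp hs
    refine ⟨m, mem_stdDegs.mpr ⟨hm, ?_⟩, by omega⟩
    rintro ⟨k, hk, rfl⟩
    exact (mem_stdDegs.mp h1).2 ⟨k, hk, by omega⟩

/-- Perturbing the generator of a principal ideal in pole order `N - d` changes the trace of a
function of pole order `d` by `d` times the ratio of the leading coefficients. -/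
theorem trace_quot_add {u w h : A} {N d : ℕ} (hu : O.HasDeg u N) (hh : O.HasDeg h d)
    (hN : 2 * O.gap + d ≤ N) (hw : w ∈ O.V (N - d + 1)) (hd : 0 < d) {κ : F}
    (hκ : h * w - κ • u ∈ O.V N) :
    Algebra.trace F (A ⧸ Ideal.span {u + w}) (Ideal.Quotient.mk _ h) =
      Algebra.trace F (A ⧸ Ideal.span {u}) (Ideal.Quotient.mk _ h) - d * κ := by
  classical
  have hu' : O.HasDeg (u + w) N := hu.add (O.mono (by omega) hw)
  rw [trace_quot_eq hu, trace_quot_eq hu', eq_sub_iff_add_eq, ← eq_sub_iff_add_eq',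
    ← Finset.sum_sub_distrib]
  have key : ∀ s : O.stdDegs N, (quotBasis hu).repr (Ideal.Quotient.mk _ (h * O.elt s)) s -
      (quotBasis hu').repr (Ideal.Quotient.mk _ (h * O.elt s)) s =
      if ∃ m ∈ O.degs, d + s = N + m then κ else 0 := by
    intro s
    have hs := mem_stdDegs.mp s.2
    have hes := elt_hasDeg hs.1
    obtain ⟨v, hv, r, hr, hdiv⟩ := exists_division hu (hh.mul hes).1
    have hr' := Submodule.span_mono (R := F) (Set.image_mono (f := O.elt)
      (show {m | m ∈ O.stdDegs N ∧ m < d + s + 1} ⊆ {m | m ∈ O.stdDegs N} from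
        fun m hm => hm.1)) hr
    have e1 : Ideal.Quotient.mk (Ideal.span {u}) (h * O.elt s) = Ideal.Quotient.mk _ r := by
      rw [Ideal.Quotient.eq, hdiv, Ideal.mem_span_singleton]
      exact ⟨v, by ring⟩
    have e2 : Ideal.Quotient.mk (Ideal.span {u + w}) (h * O.elt s) =
        Ideal.Quotient.mk _ r - Ideal.Quotient.mk _ (w * v) := by
      rw [← map_sub, Ideal.Quotient.eq, hdiv, Ideal.mem_span_singleton]
      exact ⟨v, by ring⟩
    rw [e1, e2, map_sub, Finsupp.sub_apply, repr_eq_repr hu hu' s hr', sub_sub_cancel]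
    split_ifs with hcase
    · apply repr_of_sub_mem
      obtain ⟨m, hm, hsm⟩ := hcase
      have hrV : r ∈ O.V (d + s) := by
        refine Submodule.span_le.mpr ?_ hr
        rintro _ ⟨k, ⟨hk, hk'⟩, rfl⟩
        have hne : k ≠ d + s := by
          rintro rfl
          exact (mem_stdDegs.mp hk).2 ⟨m, hm, hsm⟩
        exact O.mono (by omega) (elt_hasDeg (mem_stdDegs.mp hk).1).1
      refine mem_of_mul_mem hh.2 ?_
      have e3 : h * (w * v - κ • O.elt s) = v * (h * w - κ • u) - κ • r := by
        rw [mul_sub, mul_smul_comm, hdiv, mul_sub, mul_smul_comm, smul_add, mul_comm u v]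
        ring
      rw [e3]
      refine sub_mem ?_ (Submodule.smul_mem _ _ hrV)
      rw [show d + (s : ℕ) + 1 - N = m + 1 by omega] at hv
      have := O.mul_mem hv hκ
      rwa [show m + N = d + s by omega] at this
    · apply repr_of_mem
      by_cases hlt : d + (s : ℕ) + 1 ≤ N
      · rw [show d + (s : ℕ) + 1 - N = 0 by omega, O.V_zero, Submodule.mem_bot] at hv
        simp [hv]
      · have hv' : v ∈ O.V (d + s - N) := by
          by_contra hc
          refine hcase ⟨d + s - N, ⟨v, ?_, hc⟩, by omega⟩
          rwa [show d + (s : ℕ) - N + 1 = d + s + 1 - N by omega]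
        have := O.mul_mem hw hv'
        rwa [show N - d + (d + (s : ℕ) - N) = s by omega] at this
  rw [Finset.sum_congr rfl fun s _ => key s, ← Finset.sum_filter, Finset.sum_const,
    nsmul_eq_mul]
  congr 2
  conv_lhs => rw [← card_stdDegs_filter hh hN]
  rw [← Finset.card_map (Function.Embedding.subtype (· ∈ O.stdDegs N))]
  congr 1
  ext s
  simp only [Finset.mem_map, Finset.mem_filter, Finset.mem_univ, true_and,
    Function.Embedding.coe_subtype, Subtype.exists, exists_and_right, exists_eq_right]
  tauto

end PoleFiltration

end

section

open Module Polynomial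

namespace PoleFiltration

/-- The filtration of `F[X]` by degree. -/
noncomputable def polynomial (F : Type*) [Field F] : PoleFiltration F F[X] where
  V n := degreeLT F n
  V_zero := by
    rw [eq_bot_iff]
    intro f hf
    rw [mem_degreeLT] at hf
    simpa [Polynomial.degree_lt_iff_coeff_zero, Polynomial.ext_iff] using hf
  mono _ _ h := degreeLT_mono h
  exhaust u := ⟨u.natDegree + 1, by
    rw [mem_degreeLT]
    exact lt_of_le_of_lt degree_le_natDegree (by exact_mod_cast Nat.lt_succ_self _)⟩
  one_mem := by rw [mem_degreeLT]; simp
  mul_mem {u v m n} hu hv := by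
    by_cases hu0 : u = 0
    · simp [hu0]
    by_cases hv0 : v = 0
    · simp [hv0]
    rw [mem_degreeLT, degree_eq_natDegree (by assumption)] at hu hv
    rw [mem_degreeLT, degree_mul, degree_eq_natDegree hu0, degree_eq_natDegree hv0]
    norm_cast at hu hv ⊢
    omega
  mul_notMem {u v m n} hu hv := by
    rw [mem_degreeLT, not_lt] at hu hv ⊢
    rw [degree_mul, Nat.cast_add]
    exact add_le_add hu hv
  one_dim {u v n} hu hv hvn := by
    rw [mem_degreeLT, degree_lt_iff_coeff_zero] at hu hv hvn
    push Not at hvn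
    obtain ⟨m, hm, hvm⟩ := hvn
    have hmn : m = n := by
      by_contra hne
      exact hvm (hv m (by omega))
    subst hmn
    refine ⟨u.coeff m / v.coeff m, ?_⟩
    rw [mem_degreeLT, degree_lt_iff_coeff_zero]
    intro i hi
    rcases hi.lt_or_eq with h | h
    · simp [hu i h, hv i h]
    · subst h
      simp [div_mul_cancel₀ _ hvm]
  gap := 0
  le_finrank n := by
    rw [(degreeLTEquiv F n).finrank_eq, finrank_fin_fun, add_zero]

lemma polynomial_hasDeg {F : Type*} [Field F] {f : F[X]} (hf : f ≠ 0) :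
    (polynomial F).HasDeg f f.natDegree := by
  refine ⟨?_, ?_⟩
  · change f ∈ degreeLT F _
    rw [mem_degreeLT, degree_eq_natDegree hf]
    exact_mod_cast Nat.lt_succ_self _
  · change f ∉ degreeLT F _
    rw [mem_degreeLT, degree_eq_natDegree hf]
    exact lt_irrefl _

section Tower

variable {F R A : Type*} [Field F] [CommRing R] [CommRing A] [Algebra F R] [Algebra R A]
  [Algebra F A] [IsScalarTower F R A] (O : PoleFiltration F R) (pb : PowerBasis R A)
  (j : ℕ)

/-- Candidate filtration on `A = R[Y]` where `Y` has order `j`, and elements of `R` have their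
order multiplied by the degree. -/
def towerV (n : ℕ) : Submodule F A where
  carrier := {u | ∀ (b : Fin pb.dim) (i : ℕ), n ≤ pb.dim * i + j * b → pb.basis.repr u b ∈ O.V i}
  zero_mem' b i _ := by simp
  add_mem' hu hv b i h := by
    rw [map_add, Finsupp.add_apply]
    exact add_mem (hu b i h) (hv b i h)
  smul_mem' t u hu b i h := by
    rw [← algebraMap_smul R t u, map_smul, Finsupp.smul_apply, algebraMap_smul]
    exact Submodule.smul_mem _ _ (hu b i h)

variable {O pb j}

lemma mem_towerV {n : ℕ} {u : A} : u ∈ towerV O pb j n ↔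
    ∀ (b : Fin pb.dim) (i : ℕ), n ≤ pb.dim * i + j * b → pb.basis.repr u b ∈ O.V i := Iff.rfl

lemma towerV_mono : Monotone (towerV O pb j) := fun _ _ h _ hu b i hi => hu b i (h.trans hi)

lemma repr_smul_basis (a : R) (b b' : Fin pb.dim) :
    pb.basis.repr (a • pb.gen ^ (b : ℕ)) b' = if b = b' then a else 0 := by
  rw [← pb.basis_eq_pow b, map_smul, Basis.repr_self, Finsupp.smul_single, smul_eq_mul, mul_one,
    Finsupp.single_apply]

lemma smul_pow_mem {a : R} {d : ℕ} (ha : a ∈ O.V (d + 1)) (b : Fin pb.dim) {n : ℕ}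
    (h : pb.dim * d + j * b < n) : a • pb.gen ^ (b : ℕ) ∈ towerV O pb j n := by
  intro b' i hi
  rw [repr_smul_basis]
  split_ifs with hb
  · subst hb
    refine O.mono ?_ ha
    have : pb.dim * d < pb.dim * i := by omega
    exact lt_of_mul_lt_mul_left this (Nat.zero_le _)
  · exact zero_mem _

lemma pow_smul_notMem {a : R} {d : ℕ} (ha : a ∉ O.V d) (b : Fin pb.dim) {n : ℕ}
    (h : n ≤ pb.dim * d + j * b) : a • pb.gen ^ (b : ℕ) ∉ towerV O pb j n := by
  intro hc
  have := hc b d h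
  rw [repr_smul_basis, if_pos rfl] at this
  exact ha this

lemma eq_sum_smul_pow (u : A) :
    u = ∑ b : Fin pb.dim, pb.basis.repr u b • pb.gen ^ (b : ℕ) := by
  conv_lhs => rw [← pb.basis.sum_repr u]
  simp_rw [pb.basis_eq_pow]

lemma exists_repr_hasDeg {u : A} {n : ℕ} (hu : u ∈ towerV O pb j (n + 1))
    (hn : u ∉ towerV O pb j n) :
    ∃ (b : Fin pb.dim) (i : ℕ), n = pb.dim * i + j * b ∧ O.HasDeg (pb.basis.repr u b) i := by
  simp only [mem_towerV, not_forall] at hn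
  obtain ⟨b, i, hi, hb⟩ := hn
  have hk : 0 < pb.dim := b.pos
  have : n = pb.dim * i + j * b := by
    by_contra hne
    exact hb (hu b i (by omega))
  refine ⟨b, i, this, hu b (i + 1) ?_, hb⟩
  rw [mul_add, mul_one]; omega

lemma fin_eq_of_coprime (hjk : Nat.Coprime j pb.dim) {b b' : Fin pb.dim} {i i' : ℕ}
    (h : pb.dim * i + j * b = pb.dim * i' + j * b') : b = b' := by
  have h1 : j * (b : ℕ) ≡ j * b' [MOD pb.dim] := by
    have := congrArg (· % pb.dim) h
    simpa [Nat.ModEq, Nat.mul_add_mod] using this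
  have h2 := Nat.ModEq.cancel_left_of_coprime (by rw [Nat.gcd_comm]; exact hjk) h1
  rw [Nat.ModEq, Nat.mod_eq_of_lt b.2, Nat.mod_eq_of_lt b'.2] at h2
  exact Fin.ext h2

lemma sub_leading_mem (hjk : Nat.Coprime j pb.dim) {u : A} {b : Fin pb.dim} {i : ℕ}
    (hu : u ∈ towerV O pb j (pb.dim * i + j * b + 1)) {u' : A}
    (hu' : u' ∈ towerV O pb j (pb.dim * i + j * b + 1))
    (h : pb.basis.repr u b - pb.basis.repr u' b ∈ O.V i) :
    u - u' ∈ towerV O pb j (pb.dim * i + j * b) := by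
  intro b' i' hi
  rw [map_sub, Finsupp.sub_apply]
  rcases hi.eq_or_lt with h' | h'
  · have hb := fin_eq_of_coprime hjk h'
    subst hb
    have : i = i' := Nat.eq_of_mul_eq_mul_left b.pos (by omega)
    subst this
    exact h
  · exact sub_mem (hu b' i' h') (hu' b' i' h')

lemma exists_leading (hjk : Nat.Coprime j pb.dim) {u : A} {n : ℕ}
    (hu : u ∈ towerV O pb j (n + 1)) (hn : u ∉ towerV O pb j n) :
    ∃ (b : Fin pb.dim) (i : ℕ) (a : R), n = pb.dim * i + j * b ∧ O.HasDeg a i ∧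
      u - a • pb.gen ^ (b : ℕ) ∈ towerV O pb j n := by
  obtain ⟨b, i, rfl, h⟩ := exists_repr_hasDeg hu hn
  refine ⟨b, i, _, rfl, h, sub_leading_mem hjk hu (smul_pow_mem h.1 b (Nat.lt_succ_self _)) ?_⟩
  rw [repr_smul_basis, if_pos rfl, sub_self]
  exact zero_mem _

variable {r : Fin pb.dim → F} {c : R}

lemma gen_mul_smul_pow_mem (hc : c ∈ O.V (j + 1))
    (hr : pb.gen ^ pb.dim = algebraMap R A c - ∑ i, r i • pb.gen ^ (i : ℕ)) {a : R} {d n : ℕ}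
    (ha : a ∈ O.V (d + 1)) (b : Fin pb.dim) (h : pb.dim * d + j * b < n) :
    pb.gen * a • pb.gen ^ (b : ℕ) ∈ towerV O pb j (n + j) := by
  rw [mul_smul_comm, ← pow_succ']
  by_cases hb : (b : ℕ) + 1 < pb.dim
  · refine smul_pow_mem ha ⟨b + 1, hb⟩ ?_
    dsimp only
    rw [mul_add, mul_one]
    omega
  · have hb' : (b : ℕ) + 1 = pb.dim := by omega
    rw [hb', hr, smul_sub, Finset.smul_sum]
    refine sub_mem ?_ (Submodule.sum_mem _ fun i _ => ?_)
    · have : a • algebraMap R A c = (a * c) • pb.gen ^ ((⟨0, b.pos⟩ : Fin pb.dim) : ℕ) := by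
        rw [pow_zero, Algebra.smul_def, Algebra.smul_def, map_mul, mul_one]
      rw [this]
      refine smul_pow_mem (d := d + j) (by rw [add_assoc]; exact O.mul_mem ha hc) _ ?_
      have : j * pb.dim = j * b + j := by rw [← mul_add_one j (b : ℕ), hb']
      have : pb.dim * (d + j) = pb.dim * d + j * pb.dim := by ring
      simp only [mul_zero, add_zero]
      omega
    · rw [smul_comm]
      refine Submodule.smul_mem _ _ (smul_pow_mem ha i ?_)
      have : j * (i : ℕ) ≤ j * b := Nat.mul_le_mul_left _ (by have := i.2; omega)
      omega

lemma exists_smul_pow_of_mem {u : A} {n : ℕ} (hu : u ∈ towerV O pb j n) (b : Fin pb.dim) :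
    pb.basis.repr u b = 0 ∨
      ∃ d, pb.basis.repr u b ∈ O.V (d + 1) ∧ pb.dim * d + j * b < n := by
  by_cases h0 : pb.basis.repr u b = 0
  · exact Or.inl h0
  · obtain ⟨d, hd⟩ := exists_hasDeg (O := O) h0
    refine Or.inr ⟨d, hd.1, ?_⟩
    by_contra hc
    exact hd.2 (hu b d (not_lt.mp hc))

lemma gen_mul_mem (hc : c ∈ O.V (j + 1))
    (hr : pb.gen ^ pb.dim = algebraMap R A c - ∑ i, r i • pb.gen ^ (i : ℕ)) {u : A} {n : ℕ}
    (hu : u ∈ towerV O pb j n) : pb.gen * u ∈ towerV O pb j (n + j) := by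
  rw [eq_sum_smul_pow (pb := pb) u, Finset.mul_sum]
  refine Submodule.sum_mem _ fun b _ => ?_
  rcases exists_smul_pow_of_mem hu b with h | ⟨d, hd, h⟩
  · rw [h, zero_smul, mul_zero]; exact zero_mem _
  · exact gen_mul_smul_pow_mem hc hr hd b h

lemma smul_mem_towerV {a : R} {d : ℕ} (ha : a ∈ O.V (d + 1)) {u : A} {n : ℕ}
    (hu : u ∈ towerV O pb j n) : a • u ∈ towerV O pb j (n + pb.dim * d) := by
  rw [eq_sum_smul_pow (pb := pb) u, Finset.smul_sum]
  refine Submodule.sum_mem _ fun b _ => ?_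
  rcases exists_smul_pow_of_mem hu b with h | ⟨e, he, h⟩
  · rw [h, zero_smul, smul_zero]; exact zero_mem _
  · rw [smul_smul]
    refine smul_pow_mem (d := d + e) (by rw [add_assoc]; exact O.mul_mem ha he) b ?_
    rw [mul_add]; omega

lemma gen_pow_mul_mem (hc : c ∈ O.V (j + 1))
    (hr : pb.gen ^ pb.dim = algebraMap R A c - ∑ i, r i • pb.gen ^ (i : ℕ)) {u : A} {n : ℕ}
    (hu : u ∈ towerV O pb j n) (e : ℕ) : pb.gen ^ e * u ∈ towerV O pb j (n + j * e) := by
  induction e with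
  | zero => simpa using hu
  | succ e ih =>
    rw [pow_succ', mul_assoc, mul_add, mul_one, ← add_assoc]
    exact gen_mul_mem hc hr ih

lemma towerV_mul_mem (hc : c ∈ O.V (j + 1))
    (hr : pb.gen ^ pb.dim = algebraMap R A c - ∑ i, r i • pb.gen ^ (i : ℕ)) {u v : A} {m n : ℕ}
    (hu : u ∈ towerV O pb j (m + 1)) (hv : v ∈ towerV O pb j n) :
    u * v ∈ towerV O pb j (m + n) := by
  rw [eq_sum_smul_pow (pb := pb) u, Finset.sum_mul]
  refine Submodule.sum_mem _ fun b _ => ?_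
  rcases exists_smul_pow_of_mem hu b with h | ⟨d, hd, h⟩
  · rw [h, zero_smul, zero_mul]; exact zero_mem _
  · rw [smul_mul_assoc]
    exact towerV_mono (by omega) (smul_mem_towerV hd (gen_pow_mul_mem hc hr hv b))

lemma gen_mul_notMem (hjk : Nat.Coprime j pb.dim) (hj : 0 < j) (hc : O.HasDeg c j)
    (hr : pb.gen ^ pb.dim = algebraMap R A c - ∑ i, r i • pb.gen ^ (i : ℕ)) {u : A} {n : ℕ}
    (hu : u ∈ towerV O pb j (n + 1)) (hn : u ∉ towerV O pb j n) :
    pb.gen * u ∉ towerV O pb j (n + j) := by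
  obtain ⟨b, d, a, hnd, had, hlead⟩ := exists_leading hjk hu hn
  intro hcon
  have h1 := sub_mem hcon (gen_mul_mem hc.1 hr hlead)
  rw [← mul_sub, sub_sub_cancel, mul_smul_comm, ← pow_succ'] at h1
  by_cases hb : (b : ℕ) + 1 < pb.dim
  · refine pow_smul_notMem had.2 ⟨b + 1, hb⟩ ?_ h1
    dsimp only
    rw [mul_add, mul_one]
    omega
  · have hb' : (b : ℕ) + 1 = pb.dim := by omega
    rw [hb', hr, smul_sub, Finset.smul_sum] at h1
    have h2 : ∑ i, a • r i • pb.gen ^ (i : ℕ) ∈ towerV O pb j (n + j) := by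
      refine Submodule.sum_mem _ fun i _ => ?_
      rw [smul_comm]
      refine Submodule.smul_mem _ _ (smul_pow_mem had.1 i ?_)
      have : j * (i : ℕ) ≤ j * b := Nat.mul_le_mul_left _ (by have := i.2; omega)
      omega
    have h3 := add_mem h1 h2
    rw [sub_add_cancel] at h3
    have : a • algebraMap R A c = (a * c) • pb.gen ^ ((⟨0, b.pos⟩ : Fin pb.dim) : ℕ) := by
      rw [pow_zero, Algebra.smul_def, Algebra.smul_def, map_mul, mul_one]
    rw [this] at h3
    refine pow_smul_notMem (O.mul_notMem had.2 hc.2) _ ?_ h3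
    have : j * pb.dim = j * b + j := by rw [← mul_add_one j (b : ℕ), hb']
    have : pb.dim * (d + j) = pb.dim * d + j * pb.dim := by ring
    simp only [mul_zero, add_zero]
    omega

lemma gen_pow_mul_notMem (hjk : Nat.Coprime j pb.dim) (hj : 0 < j) (hc : O.HasDeg c j)
    (hr : pb.gen ^ pb.dim = algebraMap R A c - ∑ i, r i • pb.gen ^ (i : ℕ)) {u : A} {n : ℕ}
    (hu : u ∈ towerV O pb j (n + 1)) (hn : u ∉ towerV O pb j n) (e : ℕ) :
    pb.gen ^ e * u ∉ towerV O pb j (n + j * e) := by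
  induction e with
  | zero => simpa using hn
  | succ e ih =>
    rw [pow_succ', mul_assoc, mul_add, mul_one, ← add_assoc]
    refine gen_mul_notMem hjk hj hc hr ?_ ih
    have := gen_pow_mul_mem hc.1 hr hu e
    rwa [add_right_comm] at this

lemma smul_notMem_towerV {a : R} {d : ℕ} (ha : a ∉ O.V d) {u : A}
    {n : ℕ} (hu : u ∉ towerV O pb j n) : a • u ∉ towerV O pb j (n + pb.dim * d) := by
  simp only [mem_towerV, not_forall] at hu
  obtain ⟨b, i, hi, hb⟩ := hu
  intro h
  have := h b (d + i) (by rw [mul_add]; omega)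
  rw [map_smul, Finsupp.smul_apply, smul_eq_mul] at this
  exact O.mul_notMem ha hb this

lemma towerV_exhaust (u : A) : ∃ n, u ∈ towerV O pb j n := by
  choose f hf using fun b => O.exhaust (pb.basis.repr u b)
  refine ⟨∑ b, (pb.dim * f b + j * pb.dim), fun b i hi => O.mono ?_ (hf b)⟩
  have h1 : pb.dim * f b + j * pb.dim ≤ ∑ b, (pb.dim * f b + j * pb.dim) :=
    Finset.single_le_sum (f := fun b => pb.dim * f b + j * pb.dim)
      (fun _ _ => Nat.zero_le _) (Finset.mem_univ b)
  have h2 : j * (b : ℕ) ≤ j * pb.dim := Nat.mul_le_mul_left _ b.2.le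
  exact le_of_mul_le_mul_left (by omega : pb.dim * f b ≤ pb.dim * i) b.pos

lemma towerV_zero : towerV O pb j 0 = ⊥ := by
  rw [eq_bot_iff]
  intro u hu
  rw [Submodule.mem_bot, eq_sum_smul_pow (pb := pb) u]
  refine Finset.sum_eq_zero fun b _ => ?_
  have := hu b 0 (Nat.zero_le _)
  rw [O.V_zero, Submodule.mem_bot] at this
  rw [this, zero_smul]

lemma exists_exact_of_notMem {u : A} {n : ℕ} (hn : u ∉ towerV O pb j n) :
    ∃ m, n ≤ m ∧ u ∈ towerV O pb j (m + 1) ∧ u ∉ towerV O pb j m := by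
  classical
  have hex := towerV_exhaust (O := O) (pb := pb) (j := j) u
  have hlt : n < Nat.find hex := by
    by_contra hc
    exact hn (towerV_mono (not_lt.mp hc) (Nat.find_spec hex))
  obtain ⟨m, hm⟩ := Nat.exists_eq_succ_of_ne_zero (Nat.ne_zero_of_lt hlt)
  refine ⟨m, by omega, ?_, Nat.find_min hex (by omega)⟩
  have := Nat.find_spec hex
  rwa [hm] at this

lemma towerV_mul_notMem (hjk : Nat.Coprime j pb.dim) (hj : 0 < j) (hc : O.HasDeg c j)
    (hr : pb.gen ^ pb.dim = algebraMap R A c - ∑ i, r i • pb.gen ^ (i : ℕ)) {u v : A} {m n : ℕ}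
    (hu : u ∉ towerV O pb j m) (hv : v ∉ towerV O pb j n) : u * v ∉ towerV O pb j (m + n) := by
  obtain ⟨m', hm, hu1, hu2⟩ := exists_exact_of_notMem hu
  obtain ⟨n', hn, hv1, hv2⟩ := exists_exact_of_notMem hv
  intro hcon
  replace hcon := towerV_mono (add_le_add hm hn) hcon
  obtain ⟨b, d, a, hnd, had, hlead⟩ := exists_leading hjk hu1 hu2
  have h1 : (u - a • pb.gen ^ (b : ℕ)) * v ∈ towerV O pb j (m' + n') := by
    rw [mul_comm, add_comm]
    exact towerV_mul_mem hc.1 hr hv1 hlead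
  have h2 := sub_mem hcon h1
  rw [← sub_mul, sub_sub_cancel, smul_mul_assoc] at h2
  refine smul_notMem_towerV had.2 (gen_pow_mul_notMem hjk hj hc hr hv1 hv2 b) ?_
  rw [hnd] at h2
  convert h2 using 2
  ring

lemma towerV_one_dim (hjk : Nat.Coprime j pb.dim) {u v : A} {n : ℕ}
    (hu : u ∈ towerV O pb j (n + 1)) (hv : v ∈ towerV O pb j (n + 1))
    (hn : v ∉ towerV O pb j n) : ∃ t : F, u - t • v ∈ towerV O pb j n := by
  obtain ⟨b, i, rfl, h⟩ := exists_repr_hasDeg hv hn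
  obtain ⟨t, ht⟩ := O.one_dim (u := pb.basis.repr u b)
    (hu b (i + 1) (by rw [mul_add, mul_one]; have := b.pos; omega)) h.1 h.2
  refine ⟨t, sub_leading_mem hjk hu (Submodule.smul_mem _ _ hv) ?_⟩
  rwa [← algebraMap_smul R t v, map_smul, Finsupp.smul_apply, algebraMap_smul]

/-- The space `towerV n` is a product of spaces `O.V i`. -/
noncomputable def towerVEquiv (i : Fin pb.dim → ℕ) (n : ℕ)
    (hi : ∀ (b : Fin pb.dim) (m : ℕ), n ≤ pb.dim * m + j * b ↔ i b ≤ m) :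
    towerV O pb j n ≃ₗ[F] (∀ b, O.V (i b)) where
  toFun u b := ⟨pb.basis.repr u.1 b, u.2 b _ ((hi b _).mpr le_rfl)⟩
  map_add' u v := by ext b; simp
  map_smul' t u := by
    ext b
    simp only [Submodule.coe_smul, RingHom.id_apply, Pi.smul_apply]
    rw [← algebraMap_smul R t (u : A), map_smul, Finsupp.smul_apply, algebraMap_smul]
  invFun f := ⟨pb.basis.equivFun.symm fun b => (f b : R), fun b m hm => by
    rw [← pb.basis.equivFun_apply, LinearEquiv.apply_symm_apply]
    exact O.mono ((hi b m).mp hm) (f b).2⟩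
  left_inv u := by
    ext
    simp only
    exact pb.basis.equivFun.symm_apply_apply _
  right_inv f := by
    ext b
    simp only
    rw [← pb.basis.equivFun_apply, LinearEquiv.apply_symm_apply]

lemma towerV_le_finrank (hk : 0 < pb.dim) (n : ℕ) :
    n ≤ finrank F (towerV O pb j n) + (j * pb.dim + pb.dim * O.gap) := by
  have hd : ∀ b : Fin pb.dim, ∃ i : ℕ, ∀ m : ℕ, n ≤ pb.dim * m + j * b ↔ i ≤ m := by
    intro b
    refine ⟨(n - j * b) ⌈/⌉ pb.dim, fun m => ?_⟩
    rw [ceilDiv_le_iff_le_mul hk]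
    omega
  choose i hi using hd
  rw [(towerVEquiv i n hi).finrank_eq, Module.finrank_pi_fintype]
  have h1 : ∀ b : Fin pb.dim, n ≤ pb.dim * (finrank F (O.V (i b)) + O.gap + j) := by
    intro b
    have h := O.le_finrank (i b)
    have h2 := (hi b _).mpr h
    have h3 : j * (b : ℕ) ≤ j * pb.dim := Nat.mul_le_mul_left _ b.2.le
    rw [mul_add, mul_comm pb.dim j]
    omega
  have h4 : pb.dim * n ≤ pb.dim * ∑ b : Fin pb.dim, (finrank F (O.V (i b)) + O.gap + j) := by
    rw [Finset.mul_sum]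
    calc pb.dim * n = ∑ _b : Fin pb.dim, n := by simp
      _ ≤ _ := Finset.sum_le_sum fun b _ => h1 b
  have h5 := le_of_mul_le_mul_left h4 hk
  simp only [Finset.sum_add_distrib, Finset.sum_const, Finset.card_univ, Fintype.card_fin,
    smul_eq_mul] at h5
  rw [mul_comm j]
  omega

variable (O pb j) in
/-- The filtration on a simple extension, totally ramified at infinity. -/
noncomputable def tower (hk : 0 < pb.dim) (hjk : Nat.Coprime j pb.dim) (hj : 0 < j)
    (hc : O.HasDeg c j)
    (hr : pb.gen ^ pb.dim = algebraMap R A c - ∑ i, r i • pb.gen ^ (i : ℕ)) :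
    PoleFiltration F A where
  V := towerV O pb j
  V_zero := towerV_zero
  mono := towerV_mono
  exhaust := towerV_exhaust
  one_mem := by
    have := smul_pow_mem (j := j) O.one_mem (⟨0, hk⟩ : Fin pb.dim) (n := 1) (by simp)
    simpa using this
  mul_mem := towerV_mul_mem hc.1 hr
  mul_notMem := towerV_mul_notMem hjk hj hc hr
  one_dim := towerV_one_dim hjk
  gap := j * pb.dim + pb.dim * O.gap
  le_finrank := towerV_le_finrank hk

lemma tower_hasDeg_algebraMap (hk : 0 < pb.dim) (hjk : Nat.Coprime j pb.dim) (hj : 0 < j)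
    (hc : O.HasDeg c j)
    (hr : pb.gen ^ pb.dim = algebraMap R A c - ∑ i, r i • pb.gen ^ (i : ℕ)) {a : R} {d : ℕ}
    (ha : O.HasDeg a d) : (tower O pb j hk hjk hj hc hr).HasDeg (algebraMap R A a) (pb.dim * d) := by
  have : algebraMap R A a = a • pb.gen ^ ((⟨0, hk⟩ : Fin pb.dim) : ℕ) := by
    rw [pow_zero, Algebra.smul_def, mul_one]
  rw [this]
  exact ⟨smul_pow_mem ha.1 _ (by simp), pow_smul_notMem ha.2 _ (by simp)⟩

lemma tower_hasDeg_gen (hk : 1 < pb.dim) (hjk : Nat.Coprime j pb.dim) (hj : 0 < j)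
    (hc : O.HasDeg c j)
    (hr : pb.gen ^ pb.dim = algebraMap R A c - ∑ i, r i • pb.gen ^ (i : ℕ)) [Nontrivial R] :
    (tower O pb j (by omega) hjk hj hc hr).HasDeg pb.gen j := by
  have : pb.gen = (1 : R) • pb.gen ^ ((⟨1, hk⟩ : Fin pb.dim) : ℕ) := by
    rw [pow_one, one_smul]
  rw [this]
  exact ⟨smul_pow_mem O.one_mem _ (by simp),
    pow_smul_notMem (d := 0) (by rw [O.V_zero]; simp) _ (by simp)⟩

end Tower

end PoleFiltration

end

section

open Module Polynomial

namespace PoleFiltration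

section Overring

variable {F A S : Type*} [Field F] [CommRing A] [CommRing S] [Algebra F A] [Algebra F S]
  [Algebra A S] [IsScalarTower F A S] (O : PoleFiltration F A) (c : A) (d : ℕ)

/-- The functions `s` on an overring, with `c s` a function on `A`, of pole order `< n`. -/
def overV (n : ℕ) : Submodule F S :=
  ((O.V (n + d)).map (IsScalarTower.toAlgHom F A S).toLinearMap).comap
    (LinearMap.mulLeft F (algebraMap A S c))

variable {O c d}

lemma mem_overV {n : ℕ} {s : S} :
    s ∈ overV O c d n ↔ ∃ a ∈ O.V (n + d), algebraMap A S a = algebraMap A S c * s := by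
  simp [overV]

lemma mem_overV_iff (hinj : Function.Injective (algebraMap A S)) {n : ℕ} {s : S} {a : A}
    (ha : algebraMap A S a = algebraMap A S c * s) :
    s ∈ overV O c d n ↔ a ∈ O.V (n + d) := by
  rw [mem_overV]
  constructor
  · rintro ⟨b, hb, hbs⟩
    rwa [hinj (ha.trans hbs.symm)]
  · exact fun h => ⟨a, h, ha⟩

lemma algebraMap_mem_overV (hinj : Function.Injective (algebraMap A S)) (hc : O.HasDeg c d)
    {n : ℕ} {a : A} : algebraMap A S a ∈ overV O c d n ↔ a ∈ O.V n := by
  rw [mem_overV_iff hinj (map_mul _ c a)]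
  constructor
  · intro h
    rw [add_comm] at h
    exact mem_of_mul_mem hc.2 h
  · intro h
    rw [add_comm]
    exact O.mul_mem hc.1 h

lemma overV_zero [IsDomain S] (hinj : Function.Injective (algebraMap A S)) (hc : O.HasDeg c d)
    (hS : ∀ s : S, ∃ a, algebraMap A S a = algebraMap A S c * s) :
    (overV O c d 0 : Submodule F S) = ⊥ := by
  rw [eq_bot_iff]
  intro s hs
  rw [Submodule.mem_bot]
  by_contra hs0
  obtain ⟨a, ha, has⟩ := mem_overV.mp hs
  rw [zero_add] at ha
  have hcS : algebraMap A S c ≠ 0 := by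
    rw [Ne, map_eq_zero_iff _ hinj]; exact hc.ne_zero
  have ha0 : a ≠ 0 := by
    rintro rfl
    rw [map_zero] at has
    exact mul_ne_zero hcS hs0 has.symm
  obtain ⟨e, he⟩ := exists_hasDeg (O := O) ha0
  have hed := he.le_of_mem ha
  have key : ∀ n : ℕ, ∃ (b : A) (m : ℕ), O.HasDeg b m ∧
      algebraMap A S b = algebraMap A S c * s ^ n ∧ m + n ≤ d := by
    intro n
    induction n with
    | zero => exact ⟨c, d, hc, by simp, by simp⟩
    | succ n ih =>
      obtain ⟨b, m, hb, hbs, hmn⟩ := ih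
      obtain ⟨b', hb'⟩ := hS (s ^ (n + 1))
      have hb0 : b' ≠ 0 := by
        rintro rfl
        rw [map_zero] at hb'
        exact mul_ne_zero hcS (pow_ne_zero _ hs0) hb'.symm
      obtain ⟨m', hm'⟩ := exists_hasDeg (O := O) hb0
      have heq : c * b' = b * a := by
        apply hinj
        rw [map_mul, map_mul, hb', hbs, has]
        ring
      have h1 := hc.mul hm'
      rw [heq] at h1
      have := h1.unique (hb.mul he)
      exact ⟨b', m', hm', hb', by omega⟩
  obtain ⟨b, m, -, -, h⟩ := key (d + 1)
  omega

variable (O c d) in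
/-- Extension of a filtration to an overring with the same field of fractions. -/
def overring [IsDomain S] (hinj : Function.Injective (algebraMap A S)) (hc : O.HasDeg c d)
    (hS : ∀ s : S, ∃ a, algebraMap A S a = algebraMap A S c * s) : PoleFiltration F S where
  V := overV O c d
  V_zero := overV_zero hinj hc hS
  mono m n h s hs := by
    obtain ⟨a, ha, has⟩ := mem_overV.mp hs
    exact mem_overV.mpr ⟨a, O.mono (by omega) ha, has⟩
  exhaust s := by
    obtain ⟨a, ha⟩ := hS s
    obtain ⟨n, hn⟩ := O.exhaust a
    exact ⟨n, (mem_overV_iff hinj ha).mpr (O.mono (by omega) hn)⟩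
  one_mem := by
    rw [← map_one (algebraMap A S), algebraMap_mem_overV hinj hc]
    exact O.one_mem
  mul_mem {u v m n} hu hv := by
    obtain ⟨a, ha⟩ := hS u
    obtain ⟨b, hb⟩ := hS v
    obtain ⟨e, he⟩ := hS (u * v)
    rw [mem_overV_iff hinj ha] at hu
    rw [mem_overV_iff hinj hb] at hv
    rw [mem_overV_iff hinj he]
    have heq : c * e = a * b := by
      apply hinj
      rw [map_mul, map_mul, he, ha, hb]
      ring
    refine mem_of_mul_mem hc.2 (n := m + n + d) (u := c) ?_
    rw [heq]
    have := O.mul_mem (m := m + d) (by rwa [add_right_comm]) hv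
    convert this using 2
    ring
  mul_notMem {u v m n} hu hv := by
    obtain ⟨a, ha⟩ := hS u
    obtain ⟨b, hb⟩ := hS v
    obtain ⟨e, he⟩ := hS (u * v)
    rw [mem_overV_iff hinj ha] at hu
    rw [mem_overV_iff hinj hb] at hv
    rw [mem_overV_iff hinj he]
    have heq : c * e = a * b := by
      apply hinj
      rw [map_mul, map_mul, he, ha, hb]
      ring
    intro hcon
    have h1 := O.mul_mem hc.1 hcon
    rw [heq] at h1
    refine O.mul_notMem hu hv ?_
    convert h1 using 2
    ring
  one_dim {u v n} hu hv hn := by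
    obtain ⟨a, ha⟩ := hS u
    obtain ⟨b, hb⟩ := hS v
    rw [mem_overV_iff hinj ha, add_right_comm] at hu
    rw [mem_overV_iff hinj hb, add_right_comm] at hv
    rw [mem_overV_iff hinj hb] at hn
    obtain ⟨t, ht⟩ := O.one_dim hu hv hn
    refine ⟨t, (mem_overV_iff hinj ?_).mpr ht⟩
    rw [map_sub, mul_sub, ha, mul_smul_comm, ← hb]
    congr 1
    exact map_smul (IsScalarTower.toAlgHom F A S) t b
  gap := O.gap
  le_finrank n := by
    refine (O.le_finrank n).trans (Nat.add_le_add_right ?_ _)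
    have : FiniteDimensional F (overV O c d n : Submodule F S) := by
      unfold overV
      refine FiniteDimensional.of_injective
        (V₂ := ((O.V (n + d)).map (IsScalarTower.toAlgHom F A S).toLinearMap))
        ((LinearMap.mulLeft F (algebraMap A S c)).restrict fun x hx => hx) ?_
      intro x y hxy
      have h1 := congrArg Subtype.val hxy
      have hcS : algebraMap A S c ≠ 0 := by
        rw [Ne, map_eq_zero_iff _ hinj]; exact hc.ne_zero
      exact Subtype.ext (mul_left_cancel₀ hcS h1)
    refine LinearMap.finrank_le_finrank_of_injective
      (f := (IsScalarTower.toAlgHom F A S).toLinearMap.restrict fun a ha =>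
        (algebraMap_mem_overV hinj hc).mpr ha) ?_
    intro x y hxy
    exact Subtype.ext (hinj (congrArg Subtype.val hxy))

lemma overring_hasDeg [IsDomain S] (hinj : Function.Injective (algebraMap A S))
    (hc : O.HasDeg c d) (hS : ∀ s : S, ∃ a, algebraMap A S a = algebraMap A S c * s) {a : A}
    {n : ℕ} (ha : O.HasDeg a n) : (overring O c d hinj hc hS).HasDeg (algebraMap A S a) n :=
  ⟨(algebraMap_mem_overV hinj hc).mpr ha.1, fun h => ha.2 ((algebraMap_mem_overV hinj hc).mp h)⟩

end Overring

end PoleFiltration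

end

section

open Module Polynomial

namespace PoleFiltration

lemma HasDeg.pow {F A : Type*} [Field F] [CommRing A] [Nontrivial A] [Algebra F A]
    {O : PoleFiltration F A} {y : A} {j : ℕ} (hy : O.HasDeg y j) (n : ℕ) :
    O.HasDeg (y ^ n) (j * n) := by
  induction n with
  | zero =>
    refine ⟨by simpa using O.one_mem, ?_⟩
    rw [pow_zero, mul_zero, O.V_zero]
    simp
  | succ n ih => rw [pow_succ, mul_add, mul_one]; exact ih.mul hy

lemma HasDeg.aeval {F A : Type*} [Field F] [CommRing A] [Nontrivial A] [Algebra F A]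
    {O : PoleFiltration F A} {y : A} {j : ℕ} (hy : O.HasDeg y j) (hj : 0 < j) {q : F[X]}
    (hq : q ≠ 0) : O.HasDeg (aeval y q) (j * q.natDegree) := by
  rw [aeval_eq_sum_range, Finset.sum_range_succ, add_comm]
  refine HasDeg.add ((hy.pow _).smul (by simpa using hq)) (Submodule.sum_mem _ fun i hi => ?_)
  refine Submodule.smul_mem _ _ (O.mono ?_ (hy.pow i).1)
  rw [Finset.mem_range] at hi
  have := Nat.mul_lt_mul_of_pos_left hi hj
  exact this

end PoleFiltration

/-- If `A = R[y]` is monogenic and separable over an integrally closed `R`, the integral closure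
is a Dedekind domain whose conductor contains the derivative of the minimal polynomial. -/
theorem exists_dedekind_overring {F R A : Type} [Field F] [CommRing R] [IsDedekindDomain R]
    [CommRing A] [IsDomain A] [Algebra F R] [Algebra R A] [Algebra F A] [IsScalarTower F R A]
    [FaithfulSMul R A] (pb : PowerBasis R A)
    (hc : aeval pb.gen (derivative (minpoly R pb.gen)) ≠ 0) :
    ∃ (S : Type) (_ : CommRing S) (_ : Algebra F S) (_ : Algebra A S) (_ : IsScalarTower F A S)
      (_ : IsDedekindDomain S), Function.Injective (algebraMap A S) ∧
      ∀ s : S, ∃ a, algebraMap A S a =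
        algebraMap A S (aeval pb.gen (derivative (minpoly R pb.gen))) * s := by
  have : Module.Finite R A := pb.finite
  let K := FractionRing R
  let E := FractionRing A
  let : Algebra K E := FractionRing.liftAlgebra R E
  have : IsScalarTower R K E := FractionRing.isScalarTower_liftAlgebra R E
  have hinjE : Function.Injective (algebraMap A E) := IsFractionRing.injective A E
  have : FiniteDimensional K E := inferInstance
  have hint : IsIntegral R pb.gen := Algebra.IsIntegral.isIntegral _
  have hxint : IsIntegral R (algebraMap A E pb.gen) := hint.map (IsScalarTower.toAlgHom R A E)
  have hmin : minpoly R (algebraMap A E pb.gen) = minpoly R pb.gen :=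
    minpoly.algebraMap_eq hinjE _
  have hminK : minpoly K (algebraMap A E pb.gen) = (minpoly R pb.gen).map (algebraMap R K) := by
    rw [minpoly.isIntegrallyClosed_eq_field_fractions' K hxint, hmin]
  have hsep : IsSeparable K (algebraMap A E pb.gen) := by
    rw [IsSeparable, separable_iff_derivative_ne_zero (minpoly.irreducible hxint.tower_top),
      hminK, derivative_map]
    intro h0
    apply hc
    have h1 := (Polynomial.map_eq_zero_iff (IsFractionRing.injective R K)).mp h0
    rw [h1, map_zero]
  have hadj : Algebra.adjoin R {pb.gen} = ⊤ := pb.adjoin_gen_eq_top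
  have hmem : ∀ a : A, algebraMap A E a ∈ Algebra.adjoin R {algebraMap A E pb.gen} := by
    intro a
    have ha : a ∈ Algebra.adjoin R {pb.gen} := by rw [hadj]; trivial
    have h2 : Algebra.adjoin R {algebraMap A E pb.gen} =
        (Algebra.adjoin R {pb.gen}).map (IsScalarTower.toAlgHom R A E) := by
      rw [AlgHom.map_adjoin_singleton]; rfl
    rw [h2]
    exact ⟨a, ha, rfl⟩
  have hmem' : ∀ z ∈ Algebra.adjoin R {algebraMap A E pb.gen}, ∃ a, algebraMap A E a = z := by
    intro z hz
    have h2 : Algebra.adjoin R {algebraMap A E pb.gen} =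
        (Algebra.adjoin R {pb.gen}).map (IsScalarTower.toAlgHom R A E) := by
      rw [AlgHom.map_adjoin_singleton]; rfl
    rw [h2] at hz
    obtain ⟨a, -, ha⟩ := hz
    exact ⟨a, ha⟩
  have hmemK : ∀ a : A, algebraMap A E a ∈ IntermediateField.adjoin K {algebraMap A E pb.gen} := by
    intro a
    have h3 : Algebra.adjoin R {algebraMap A E pb.gen} ≤
        (IntermediateField.adjoin K {algebraMap A E pb.gen}).toSubalgebra.restrictScalars R := by
      rw [Algebra.adjoin_le_iff, Set.singleton_subset_iff]
      exact IntermediateField.mem_adjoin_simple_self K _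
    exact h3 (hmem a)
  have htop : IntermediateField.adjoin K {algebraMap A E pb.gen} = ⊤ := by
    rw [eq_top_iff]
    rintro z -
    obtain ⟨a, b, -, rfl⟩ := IsFractionRing.div_surjective (A := A) z
    exact div_mem (hmemK a) (hmemK b)
  have hsepE : Algebra.IsSeparable K E := by
    have h4 := (IntermediateField.isSeparable_adjoin_simple_iff_isSeparable K E).mpr hsep
    rw [htop] at h4
    exact Algebra.IsSeparable.of_algHom K _ (IntermediateField.topEquiv (F := K) (E := E)).symm.toAlgHom
  have hadjK : Algebra.adjoin K {algebraMap A E pb.gen} = ⊤ := by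
    rw [← IntermediateField.adjoin_simple_toSubalgebra_of_isAlgebraic (IsAlgebraic.of_finite K _), htop]
    rfl
  let S := integralClosure R E
  have hDed : IsDedekindDomain S := integralClosure.isDedekindDomain R K E
  let ιA : A →ₐ[R] S := (IsScalarTower.toAlgHom R A E).codRestrict S fun a =>
    (Algebra.IsIntegral.isIntegral a).map (IsScalarTower.toAlgHom R A E)
  have hι : ∀ a, (ιA a : E) = algebraMap A E a := fun a => rfl
  let : Algebra A S := ιA.toRingHom.toAlgebra
  let : Algebra F S := (ιA.toRingHom.comp (algebraMap F A)).toAlgebra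
  have hinjS : Function.Injective (algebraMap A S) := fun a b h =>
    hinjE (congrArg Subtype.val h)
  refine ⟨S, inferInstance, inferInstance, inferInstance, IsScalarTower.of_algebraMap_eq' rfl,
    hDed, hinjS, fun s => ?_⟩
  have hcond := conductor_mul_differentIdeal R K E (B := S) (ιA pb.gen) hadjK
  have hc' : aeval (ιA pb.gen) (derivative (minpoly R (ιA pb.gen))) ∈ conductor R (ιA pb.gen) := by
    apply Ideal.mul_le_right (I := differentIdeal R S)
    rw [mul_comm, hcond]
    exact Ideal.mem_span_singleton_self _
  have hminS : minpoly R (ιA pb.gen) = minpoly R pb.gen := minpoly.algHom_eq ιA hinjS _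
  rw [hminS] at hc'
  have h5 := (mem_conductor_iff.mp hc') s
  obtain ⟨a, ha⟩ := hmem' ((aeval (ιA pb.gen) (derivative (minpoly R pb.gen)) * s : S) : E) (by
    have h6 : Algebra.adjoin R {algebraMap A E pb.gen} =
        (Algebra.adjoin R {ιA pb.gen}).map S.val := by
      rw [AlgHom.map_adjoin_singleton]; rfl
    rw [h6]
    exact ⟨_, h5, rfl⟩)
  refine ⟨a, Subtype.ext ?_⟩
  change algebraMap A E a = _
  rw [ha, aeval_algHom_apply]
  rfl

end

section

open Module

lemma LinearMap.trace_of_exact {K V₁ V V₂ : Type*} [Field K] [AddCommGroup V₁] [AddCommGroup V]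
    [AddCommGroup V₂] [Module K V₁] [Module K V] [Module K V₂] [FiniteDimensional K V₁]
    [FiniteDimensional K V] [FiniteDimensional K V₂] {f : V₁ →ₗ[K] V} {g : V →ₗ[K] V₂}
    (hf : Function.Injective f) (hg : Function.Surjective g) (hfg : Function.Exact f g)
    {T₁ : V₁ →ₗ[K] V₁} {T : V →ₗ[K] V} {T₂ : V₂ →ₗ[K] V₂} (h₁ : T ∘ₗ f = f ∘ₗ T₁)
    (h₂ : g ∘ₗ T = T₂ ∘ₗ g) :
    LinearMap.trace K V T = LinearMap.trace K V₁ T₁ + LinearMap.trace K V₂ T₂ := by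
  obtain ⟨ρ, hρ⟩ := f.exists_leftInverse_of_injective (LinearMap.ker_eq_bot.mpr hf)
  obtain ⟨s, hs⟩ := g.exists_rightInverse_of_surjective (LinearMap.range_eq_top.mpr hg)
  have hρ' : ∀ x, ρ (f x) = x := fun x => LinearMap.congr_fun hρ x
  have hs' : ∀ x, g (s x) = x := fun x => LinearMap.congr_fun hs x
  have hgf : ∀ x, g (f x) = 0 := fun x => (hfg _).mpr ⟨x, rfl⟩
  have hid : LinearMap.id = f ∘ₗ ρ + ((LinearMap.id - f ∘ₗ ρ) ∘ₗ s) ∘ₗ g := by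
    ext v
    obtain ⟨w, hw⟩ := (hfg (v - s (g v))).mp (by rw [map_sub, hs', sub_self])
    have hv : v = f w + s (g v) := by rw [hw, sub_add_cancel]
    simp only [LinearMap.id_coe, id_eq, LinearMap.add_apply, LinearMap.comp_apply,
      LinearMap.sub_apply]
    conv_lhs => rw [hv]
    conv_rhs => enter [1]; rw [hv]
    simp only [map_add, hρ']
    abel
  have h3 : T = T ∘ₗ f ∘ₗ ρ + T ∘ₗ ((LinearMap.id - f ∘ₗ ρ) ∘ₗ s) ∘ₗ g := by
    conv_lhs => rw [← LinearMap.comp_id T, hid, LinearMap.comp_add]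
  rw [h3, map_add]
  congr 1
  · rw [← LinearMap.comp_assoc, LinearMap.trace_comp_comm', h₁, ← LinearMap.comp_assoc, hρ,
      LinearMap.id_comp]
  · rw [← LinearMap.comp_assoc, LinearMap.trace_comp_comm', ← LinearMap.comp_assoc, h₂]
    congr 1
    ext v
    simp [hs', hgf]

namespace PoleFiltration

variable {F S : Type*} [Field F] [CommRing S] [IsDedekindDomain S] [Algebra F S]

lemma finiteDimensional_quot_ideal (O : PoleFiltration F S) {I : Ideal S} (hI : I ≠ ⊥) :
    FiniteDimensional F (S ⧸ I) := by
  obtain ⟨u, hu, hu0⟩ := Submodule.exists_mem_ne_zero_of_ne_bot hI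
  obtain ⟨N, hN⟩ := exists_hasDeg (O := O) hu0
  have := finiteDimensional_quot hN
  have hle : Ideal.span {u} ≤ I := (Ideal.span_singleton_le_iff_mem I).mpr hu
  exact Module.Finite.of_surjective (Ideal.Quotient.factorₐ F hle).toLinearMap
    (Ideal.Quotient.factor_surjective hle)

end PoleFiltration

variable {F S : Type*} [Field F] [CommRing S] [IsDedekindDomain S] [Algebra F S]

variable (F) in
/-- The degree of an ideal. -/
noncomputable def idealDeg (I : Ideal S) : ℕ := finrank F (S ⧸ I)

variable (F) in
/-- The trace of a function over the zero divisor given by an ideal. -/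
noncomputable def idealTr (h : S) (I : Ideal S) : F :=
  Algebra.trace F (S ⧸ I) (Ideal.Quotient.mk I h)

lemma exists_mul_mem_iff {P J : Ideal S} (hP : P.IsPrime) (hP0 : P ≠ ⊥) (hJ : J ≠ ⊥) :
    ∃ α ∈ J, (∀ a, a * α ∈ P * J ↔ a ∈ P) ∧ ∀ b ∈ J, ∃ a, b - a * α ∈ P * J := by
  have hle' : P * J ≤ J := Ideal.mul_le_right
  have hlt : P * J < J := by
    refine lt_of_le_of_ne hle' fun h => hP.ne_top ?_
    have : P * J = 1 * J := by rw [one_mul]; exact h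
    rw [← Ideal.one_eq_top]
    exact mul_right_cancel₀ hJ this
  obtain ⟨α, hα, hα'⟩ := SetLike.exists_of_lt hlt
  have hmax : P.IsMaximal := hP.isMaximal hP0
  have hsup : Ideal.span {α} ⊔ P * J = J := by
    have hle : Ideal.span {α} ⊔ P * J ≤ J :=
      sup_le ((Ideal.span_singleton_le_iff_mem J).mpr hα) hle'
    obtain ⟨Q, hQ⟩ := Ideal.dvd_iff_le.mpr hle
    have hPQ : P ≤ Q := by
      have : J * P ≤ J * Q := by rw [← hQ, mul_comm]; exact le_sup_right
      rwa [← Ideal.dvd_iff_le, mul_dvd_mul_iff_left hJ, Ideal.dvd_iff_le] at this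
    rcases hmax.out.le_iff.mp hPQ with h | h
    · rw [hQ, h]; exact Ideal.mul_top J
    · exfalso
      apply hα'
      rw [h, mul_comm J] at hQ
      rw [← hQ]
      exact Ideal.mem_sup_left (Ideal.mem_span_singleton_self α)
  refine ⟨α, hα, fun a => ⟨fun h => ?_, fun ha => Ideal.mul_mem_mul ha hα⟩, fun b hb => ?_⟩
  · by_contra ha
    obtain ⟨s, π, hπ, hs⟩ := Ideal.IsMaximal.exists_inv hmax ha
    apply hα'
    have : α = s * (a * α) + π * α := by
      rw [← mul_assoc, ← add_mul, hs, one_mul]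
    rw [this]
    exact add_mem (Ideal.mul_mem_left _ _ h) (Ideal.mul_mem_mul hπ hα)
  · rw [← hsup, Ideal.mem_span_singleton_sup] at hb
    obtain ⟨a, z, hz, rfl⟩ := hb
    exact ⟨a, by simpa using hz⟩

lemma idealDegTr_prime_mul (O : PoleFiltration F S) {P J : Ideal S} (hP : P.IsPrime) (hP0 : P ≠ ⊥)
    (hJ : J ≠ ⊥) (h : S) :
    idealDeg F (P * J) = idealDeg F P + idealDeg F J ∧
      idealTr F h (P * J) = idealTr F h P + idealTr F h J := by
  have := O.finiteDimensional_quot_ideal hP0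
  have := O.finiteDimensional_quot_ideal hJ
  have := O.finiteDimensional_quot_ideal (mul_ne_zero hP0 hJ)
  obtain ⟨α, hα, h1, h2⟩ := exists_mul_mem_iff hP hP0 hJ
  let m : S →ₗ[S] S ⧸ P * J := (P * J).mkQ ∘ₗ LinearMap.mulRight S α
  have hm : ∀ a, m a = Ideal.Quotient.mk (P * J) (a * α) := fun a => rfl
  have hmP : P ≤ LinearMap.ker m := fun a ha => by
    rw [LinearMap.mem_ker, hm, Ideal.Quotient.eq_zero_iff_mem]
    exact (h1 a).mpr ha
  let f : (S ⧸ P) →ₗ[F] (S ⧸ P * J) := (Submodule.liftQ P m hmP).restrictScalars F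
  have hf : ∀ a, f (Ideal.Quotient.mk P a) = Ideal.Quotient.mk (P * J) (a * α) := fun a => rfl
  have hle : P * J ≤ J := Ideal.mul_le_right
  let g : (S ⧸ P * J) →ₗ[F] (S ⧸ J) := (Ideal.Quotient.factorₐ F hle).toLinearMap
  have hg : ∀ a, g (Ideal.Quotient.mk (P * J) a) = Ideal.Quotient.mk J a := fun a => rfl
  clear_value f g
  have hfi : Function.Injective f := by
    rw [injective_iff_map_eq_zero]
    intro a ha
    obtain ⟨a, rfl⟩ := Ideal.Quotient.mk_surjective a
    rw [hf, Ideal.Quotient.eq_zero_iff_mem, h1] at ha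
    exact Ideal.Quotient.eq_zero_iff_mem.mpr ha
  have hgs : Function.Surjective g := fun b => by
    obtain ⟨b, rfl⟩ := Ideal.Quotient.mk_surjective b
    exact ⟨_, hg b⟩
  have hex : Function.Exact f g := fun b => by
    obtain ⟨b, rfl⟩ := Ideal.Quotient.mk_surjective b
    rw [hg, Ideal.Quotient.eq_zero_iff_mem]
    constructor
    · intro hb
      obtain ⟨a, ha⟩ := h2 b hb
      exact ⟨Ideal.Quotient.mk P a, by rw [hf]; exact ((Ideal.Quotient.eq).mpr ha).symm⟩
    · rintro ⟨a, ha⟩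
      obtain ⟨a, rfl⟩ := Ideal.Quotient.mk_surjective a
      rw [hf, Ideal.Quotient.eq] at ha
      have h3 := sub_mem (J.mul_mem_left a hα) (hle ha)
      simpa using h3
  constructor
  · have h1 := g.finrank_range_add_finrank_ker
    rw [LinearMap.exact_iff.mp hex, LinearMap.finrank_range_of_inj hfi,
      LinearMap.range_eq_top.mpr hgs, finrank_top] at h1
    rw [idealDeg, idealDeg, idealDeg, ← h1, add_comm]
  · refine LinearMap.trace_of_exact hfi hgs hex ?_ ?_
    · refine LinearMap.ext fun x => ?_
      obtain ⟨x, rfl⟩ := Ideal.Quotient.mk_surjective x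
      change Ideal.Quotient.mk (P * J) h * f (Ideal.Quotient.mk P x) =
        f (Ideal.Quotient.mk P h * Ideal.Quotient.mk P x)
      rw [← map_mul, hf, hf, ← map_mul, mul_assoc]
    · refine LinearMap.ext fun x => ?_
      obtain ⟨x, rfl⟩ := Ideal.Quotient.mk_surjective x
      change g (Ideal.Quotient.mk (P * J) h * Ideal.Quotient.mk (P * J) x) =
        Ideal.Quotient.mk J h * g (Ideal.Quotient.mk (P * J) x)
      rw [← map_mul, hg, hg, ← map_mul]

lemma idealDeg_top : idealDeg F (⊤ : Ideal S) = 0 := by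
  have : Subsingleton (S ⧸ (⊤ : Ideal S)) := Ideal.Quotient.subsingleton_iff.mpr rfl
  exact finrank_zero_of_subsingleton

lemma idealTr_top (h : S) : idealTr F h (⊤ : Ideal S) = 0 := by
  have : Subsingleton (S ⧸ (⊤ : Ideal S)) := Ideal.Quotient.subsingleton_iff.mpr rfl
  rw [idealTr, Subsingleton.elim (Ideal.Quotient.mk ⊤ h) 0, map_zero]

lemma idealDegTr_mul (O : PoleFiltration F S) {I J : Ideal S} (hI : I ≠ ⊥) (hJ : J ≠ ⊥) (h : S) :
    idealDeg F (I * J) = idealDeg F I + idealDeg F J ∧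
      idealTr F h (I * J) = idealTr F h I + idealTr F h J := by
  induction I using UniqueFactorizationMonoid.induction_on_prime with
  | h₁ => exact absurd rfl hI
  | h₂ I hu =>
    rw [Ideal.isUnit_iff.mp hu, idealDeg_top, idealTr_top, Ideal.top_mul]
    simp
  | h₃ I P hI0 hP ih =>
    have hPp := Ideal.isPrime_of_prime hP
    obtain ⟨h1, h2⟩ := idealDegTr_prime_mul O hPp hP.ne_zero hI0 h
    obtain ⟨h3, h4⟩ := idealDegTr_prime_mul O hPp hP.ne_zero (mul_ne_zero hI0 hJ) h
    obtain ⟨h5, h6⟩ := ih hI0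
    rw [mul_assoc, h1, h2, h3, h4, h5, h6]
    constructor <;> ring

lemma idealDeg_mul (O : PoleFiltration F S) {I J : Ideal S} (hI : I ≠ ⊥) (hJ : J ≠ ⊥) :
    idealDeg F (I * J) = idealDeg F I + idealDeg F J := (idealDegTr_mul O hI hJ 0).1

lemma idealDeg_pos (O : PoleFiltration F S) {I : Ideal S} (hI : I ≠ ⊥) (hI' : I ≠ ⊤) :
    0 < idealDeg F I := by
  have := O.finiteDimensional_quot_ideal hI
  have : Nontrivial (S ⧸ I) := Ideal.Quotient.nontrivial_iff.mpr hI'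
  exact finrank_pos

lemma idealDeg_span {O : PoleFiltration F S} {u : S} {N : ℕ} (hu : O.HasDeg u N) :
    idealDeg F (Ideal.span {u}) = N :=
  PoleFiltration.finrank_quot hu

section FiniteField

variable [Finite F]

lemma finite_ideals_containing (O : PoleFiltration F S) {u : S} (hu : u ≠ 0) :
    {I : Ideal S | u ∈ I}.Finite := by
  have : FiniteDimensional F (S ⧸ Ideal.span {u}) := by
    apply O.finiteDimensional_quot_ideal
    simpa using hu
  have : Finite (S ⧸ Ideal.span {u}) := Module.finite_of_finite F
  have : Finite (Ideal (S ⧸ Ideal.span {u})) :=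
    Finite.of_injective (fun I => (I : Set (S ⧸ Ideal.span {u}))) SetLike.coe_injective
  refine (Set.finite_range (Ideal.comap (Ideal.Quotient.mk (Ideal.span {u})))).subset ?_
  intro I hI
  refine ⟨I.map (Ideal.Quotient.mk _), ?_⟩
  rw [Ideal.comap_map_of_surjective _ Ideal.Quotient.mk_surjective, ← RingHom.ker_eq_comap_bot,
    Ideal.mk_ker, sup_eq_left]
  exact (Ideal.span_singleton_le_iff_mem I).mpr hI

lemma finite_idealDeg (O : PoleFiltration F S) (n : ℕ) :
    {I : Ideal S | I ≠ ⊥ ∧ idealDeg F I = n}.Finite := by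
  have : Finite (O.V (2 * O.gap + n + 1)) := Module.finite_of_finite F
  have hfin : {u : S | O.HasDeg u (2 * O.gap + n)}.Finite :=
    (Set.toFinite (O.V (2 * O.gap + n + 1) : Set S)).subset fun u hu => hu.1
  refine (hfin.biUnion fun u hu => finite_ideals_containing O hu.ne_zero).subset ?_
  rintro I ⟨hI, rfl⟩
  have := O.finiteDimensional_quot_ideal hI
  obtain ⟨u, hu, hu'⟩ := PoleFiltration.exists_hasDeg_mem (O := O) I le_rfl
  exact Set.mem_biUnion (x := u) hu' hu

/-- The nonzero ideals of a given degree. -/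
noncomputable def idealsOfDeg (O : PoleFiltration F S) (n : ℕ) : Finset (Ideal S) :=
  (finite_idealDeg O n).toFinset

lemma mem_idealsOfDeg {O : PoleFiltration F S} {n : ℕ} {I : Ideal S} :
    I ∈ idealsOfDeg O n ↔ I ≠ ⊥ ∧ idealDeg F I = n := by
  simp [idealsOfDeg]

end FiniteField

end

section

open Module Finset

section LSeries

variable {F S : Type*} [Field F] [CommRing S] [IsDedekindDomain S] [Algebra F S] [Fintype F]

lemma finite_hasDeg (O : PoleFiltration F S) (N : ℕ) : {u : S | O.HasDeg u N}.Finite := by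
  have : Finite (O.V (N + 1)) := Module.finite_of_finite F
  exact (Set.toFinite (O.V (N + 1) : Set S)).subset fun u hu => hu.1

/-- The functions of exact pole order `N`. -/
noncomputable def hasDegFinset (O : PoleFiltration F S) (N : ℕ) : Finset S :=
  (finite_hasDeg O N).toFinset

lemma mem_hasDegFinset {O : PoleFiltration F S} {N : ℕ} {u : S} :
    u ∈ hasDegFinset O N ↔ O.HasDeg u N := by
  simp [hasDegFinset]

/-- The coefficients of the L-function attached to an additive character and a function. -/
noncomputable def lCoeff (O : PoleFiltration F S) (ψ : AddChar F ℂ) (h : S) (n : ℕ) : ℂ :=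
  ∑ I ∈ idealsOfDeg O n, ψ (idealTr F h I)

open Classical in
lemma card_hasDegFinset_filter (O : PoleFiltration F S) {I : Ideal S} (hI : I ≠ ⊥) {M N : ℕ}
    (hN : idealDeg F I + M = N) (hM : 2 * O.gap ≤ M) :
    ((hasDegFinset O N).filter (· ∈ I)).card * Fintype.card F ^ idealDeg F I =
      (Fintype.card F - 1) * Fintype.card F ^ finrank F (O.V N) := by
  have := O.finiteDimensional_quot_ideal hI
  have h1 := PoleFiltration.finrank_inf_add (O := O) I (n := N)
    (by change 2 * O.gap + idealDeg F I ≤ N; omega)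
  have h2 := PoleFiltration.finrank_inf_add (O := O) I (n := N + 1)
    (by change 2 * O.gap + idealDeg F I ≤ N + 1; omega)
  rw [PoleFiltration.finrank_V_add (by omega)] at h2
  change _ + idealDeg F I = _ at h1 h2
  set W₁ := O.V N ⊓ I.restrictScalars F
  set W₂ := O.V (N + 1) ⊓ I.restrictScalars F
  have hW : (W₁ : Set S) ⊆ W₂ := fun x hx => ⟨O.mono (Nat.le_succ N) hx.1, hx.2⟩
  have : FiniteDimensional F W₂ := Submodule.finiteDimensional_of_le (S₂ := O.V (N+1)) inf_le_left
  have : Finite W₂ := Module.finite_of_finite F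
  have hc : (((hasDegFinset O N).filter (· ∈ I) : Finset S) : Set S) = (W₂ : Set S) \ W₁ := by
    ext x
    simp only [coe_filter, mem_hasDegFinset, Set.mem_ofPred_eq, Set.mem_sdiff]
    change _ ∧ _ ↔ (_ ∧ _) ∧ ¬ (_ ∧ _)
    simp only [PoleFiltration.HasDeg]
    tauto
  have hcard : ((hasDegFinset O N).filter (· ∈ I)).card + Fintype.card F ^ finrank F W₁ =
      Fintype.card F ^ finrank F W₂ := by
    have e1 : (W₁ : Set S).ncard = Fintype.card F ^ finrank F W₁ := by
      rw [← Nat.card_coe_set_eq, ← Nat.card_eq_fintype_card]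
      have : FiniteDimensional F W₁ := Submodule.finiteDimensional_of_le (S₂ := O.V N) inf_le_left
      exact Module.natCard_eq_pow_finrank
    have e2 : (W₂ : Set S).ncard = Fintype.card F ^ finrank F W₂ := by
      rw [← Nat.card_coe_set_eq, ← Nat.card_eq_fintype_card]
      exact Module.natCard_eq_pow_finrank
    rw [← e1, ← e2, ← Set.ncard_coe_finset, hc]
    exact Set.ncard_sdiff_add_ncard_of_subset hW (Set.toFinite _)
  have h3 : finrank F W₂ = finrank F W₁ + 1 := by omega
  rw [h3] at hcard
  have h4 : ((hasDegFinset O N).filter (· ∈ I)).card =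
      (Fintype.card F - 1) * Fintype.card F ^ finrank F W₁ := by
    rw [Nat.sub_mul, one_mul, ← pow_succ']
    omega
  rw [h4, ← h1, pow_add, mul_assoc]

open Classical in
lemma sum_ideals_eq_sum_complement {O : PoleFiltration F S} (ψ : AddChar F ℂ) (h : S) {u : S}
    {n M : ℕ} (hu : O.HasDeg u (n + M)) :
    ∑ I ∈ (idealsOfDeg O n).filter (u ∈ ·), ψ (idealTr F h I) =
      ∑ E ∈ (idealsOfDeg O M).filter (u ∈ ·),
        ψ (- idealTr F h E) * ψ (idealTr F h (Ideal.span {u})) := by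
  have hu0 : Ideal.span {u} ≠ ⊥ := by simpa using hu.ne_zero
  have key : ∀ a b (I : Ideal S), O.HasDeg u (a + b) → I ∈ (idealsOfDeg O a).filter (u ∈ ·) →
      ∃ E ∈ (idealsOfDeg O b).filter (u ∈ ·), I * E = Ideal.span {u} := by
    intro a b I hu hI
    rw [mem_filter, mem_idealsOfDeg] at hI
    obtain ⟨⟨hI0, hIa⟩, hIu⟩ := hI
    obtain ⟨E, hE⟩ := Ideal.dvd_span_singleton.mpr hIu
    have hE0 : E ≠ ⊥ := by
      rintro rfl
      rw [Ideal.mul_bot] at hE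
      exact hu0 hE
    refine ⟨E, ?_, hE.symm⟩
    rw [mem_filter, mem_idealsOfDeg]
    refine ⟨⟨hE0, ?_⟩, ?_⟩
    · have h1 := idealDeg_mul O hI0 hE0
      rw [← hE, idealDeg_span hu] at h1
      omega
    · exact Ideal.mul_le_left (I := E) (J := I) (by
        rw [mul_comm, ← hE]; exact Ideal.mem_span_singleton_self u)
  choose! f hf hfe using fun I => key n M I hu
  choose! g hg hge using fun E => key M n E (by rwa [add_comm])
  refine sum_bij' (fun I _ => f I) (fun E _ => g E) hf hg ?_ ?_ ?_
  · intro I hI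
    have h1 := hfe I hI
    have h2 := hge _ (hf I hI)
    have h0 : f I ≠ ⊥ := by
      intro h0; rw [h0, Ideal.mul_bot] at h1; exact hu0 h1.symm
    rw [← h1, mul_comm I] at h2
    exact mul_left_cancel₀ h0 h2
  · intro I hI
    have h1 := hge I hI
    have h2 := hfe _ (hg I hI)
    have h0 : g I ≠ ⊥ := by
      intro h0; rw [h0, Ideal.mul_bot] at h1; exact hu0 h1.symm
    rw [← h1, mul_comm I] at h2
    exact mul_left_cancel₀ h0 h2
  · intro I hI
    have h1 := hfe I hI
    have hI0 : I ≠ ⊥ := (mem_idealsOfDeg.mp (mem_filter.mp hI).1).1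
    have hE0 : f I ≠ ⊥ := (mem_idealsOfDeg.mp (mem_filter.mp (hf I hI)).1).1
    rw [← h1, (idealDegTr_mul O hI0 hE0 h).2, ← AddChar.map_add_eq_mul]
    congr 1
    ring

open Classical in
lemma lCoeff_mul {O : PoleFiltration F S} (ψ : AddChar F ℂ) (h : S) (n : ℕ) {M : ℕ}
    (hM : 2 * O.gap ≤ M) :
    lCoeff O ψ h n * ((Fintype.card F - 1 : ℕ) * Fintype.card F ^ finrank F (O.V (n + M)) : ℂ) =
      Fintype.card F ^ n * ∑ E ∈ idealsOfDeg O M, ψ (- idealTr F h E) *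
        ∑ u ∈ (hasDegFinset O (n + M)).filter (· ∈ E), ψ (idealTr F h (Ideal.span {u})) := by
  have h1 : ∑ u ∈ hasDegFinset O (n + M), ∑ I ∈ (idealsOfDeg O n).filter (u ∈ ·),
      ψ (idealTr F h I) = ∑ u ∈ hasDegFinset O (n + M), ∑ E ∈ (idealsOfDeg O M).filter (u ∈ ·),
        ψ (- idealTr F h E) * ψ (idealTr F h (Ideal.span {u})) :=
    sum_congr rfl fun u hu => sum_ideals_eq_sum_complement ψ h (mem_hasDegFinset.mp hu)
  simp only [sum_filter] at h1
  rw [sum_comm, sum_comm (s := hasDegFinset O (n + M)) (t := idealsOfDeg O M)] at h1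
  simp only [← sum_filter, sum_const, ← mul_sum] at h1
  rw [← h1, lCoeff, sum_mul, mul_sum]
  refine sum_congr rfl fun I hI => ?_
  obtain ⟨hI0, hIn⟩ := mem_idealsOfDeg.mp hI
  have h2 := card_hasDegFinset_filter O hI0 (by rw [hIn]) hM
  rw [hIn] at h2
  rw [nsmul_eq_mul]
  have h3 : (((Fintype.card F - 1 : ℕ) : ℂ) * Fintype.card F ^ finrank F (O.V (n + M)) : ℂ) =
      ((hasDegFinset O (n + M)).filter (· ∈ I)).card * Fintype.card F ^ n := by
    exact_mod_cast h2.symm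
  rw [h3]
  ring

lemma card_factor_ne_zero (O : PoleFiltration F S) (N : ℕ) :
    ((Fintype.card F - 1 : ℕ) * Fintype.card F ^ finrank F (O.V N) : ℂ) ≠ 0 := by
  have := Fintype.one_lt_card (α := F)
  refine mul_ne_zero (by exact_mod_cast (by omega)) (pow_ne_zero _ (by exact_mod_cast (by omega)))

lemma lCoeff_zero_succ {O : PoleFiltration F S} (ψ : AddChar F ℂ) {n : ℕ} (hn : 2 * O.gap ≤ n) :
    lCoeff O ψ 0 (n + 1) = Fintype.card F * lCoeff O ψ 0 n := by
  classical
  have key : ∀ a b, 2 * O.gap ≤ b → lCoeff O ψ 0 a *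
      ((Fintype.card F - 1 : ℕ) * Fintype.card F ^ finrank F (O.V (a + b)) : ℂ) =
      Fintype.card F ^ a * ∑ E ∈ idealsOfDeg O b,
        (((hasDegFinset O (a + b)).filter (· ∈ E)).card : ℂ) := by
    intro a b hb
    rw [lCoeff_mul ψ 0 a hb]
    simp [idealTr]
  have hq : (Fintype.card F : ℂ) ≠ 0 := by exact_mod_cast Fintype.card_ne_zero
  have h1 := key n (n + 1) (by omega)
  have hz := card_factor_ne_zero O (n + (n + 1))
  have h2 : ∑ E ∈ idealsOfDeg O (n + 1),
      (((hasDegFinset O (n + (n + 1))).filter (· ∈ E)).card : ℂ) * Fintype.card F ^ (n + 1) =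
      lCoeff O ψ 0 (n + 1) *
        ((Fintype.card F - 1 : ℕ) * Fintype.card F ^ finrank F (O.V (n + (n + 1))) : ℂ) := by
    have h3 : ∀ E ∈ idealsOfDeg O (n + 1),
        (((hasDegFinset O (n + (n + 1))).filter (· ∈ E)).card : ℂ) * Fintype.card F ^ (n + 1) =
        ((Fintype.card F - 1 : ℕ) * Fintype.card F ^ finrank F (O.V (n + (n + 1))) : ℂ) := by
      intro E hE
      obtain ⟨hE0, hEn⟩ := mem_idealsOfDeg.mp hE
      have := card_hasDegFinset_filter O hE0 (M := n) (N := n + (n + 1)) (by omega) hn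
      rw [hEn] at this
      exact_mod_cast this
    rw [sum_congr rfl h3, sum_const, nsmul_eq_mul]
    congr 1
    simp [lCoeff, idealTr]
  rw [← sum_mul] at h2
  apply mul_right_cancel₀ hz
  rw [← h2, mul_assoc, h1]
  ring

lemma sum_trace_eq_zero {O : PoleFiltration F S} {ψ : AddChar F ℂ} (hψ : ψ.IsPrimitive) {h : S}
    {d : ℕ} (hh : O.HasDeg h d) (hd : (d : F) ≠ 0) {E : Ideal S} (hE : E ≠ ⊥) {N : ℕ}
    (hN : 2 * O.gap + d + idealDeg F E ≤ N) [DecidablePred (· ∈ E)] :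
    ∑ u ∈ (hasDegFinset O N).filter (· ∈ E), ψ (idealTr F h (Ideal.span {u})) = 0 := by
  classical
  have := O.finiteDimensional_quot_ideal hE
  have hd0 : 0 < d := Nat.pos_of_ne_zero fun h0 => hd (by simp [h0])
  obtain ⟨w, hwE, hw⟩ := PoleFiltration.exists_hasDeg_mem (O := O) E (n := N - d)
    (by change 2 * O.gap + idealDeg F E ≤ N - d; omega)
  have hwN : w ∈ O.V N := O.mono (by omega) hw.1
  have hhw : O.HasDeg (h * w) N := by
    have := hh.mul hw
    rwa [show d + (N - d) = N by omega] at this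
  have hmem : ∀ t : F, ∀ u, u + t • w ∈ (hasDegFinset O N).filter (· ∈ E) ↔
      u ∈ (hasDegFinset O N).filter (· ∈ E) := by
    have h1 : ∀ t : F, ∀ u, u ∈ (hasDegFinset O N).filter (· ∈ E) →
        u + t • w ∈ (hasDegFinset O N).filter (· ∈ E) := by
      intro t u hu
      rw [mem_filter, mem_hasDegFinset] at hu ⊢
      exact ⟨hu.1.add ((O.V N).smul_mem t hwN),
        add_mem hu.2 (Submodule.smul_of_tower_mem E t hwE)⟩
    refine fun t u => ⟨fun hu => ?_, h1 t u⟩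
    have := h1 (-t) _ hu
    simpa using this
  have hshift : ∀ t : F, ∑ u ∈ (hasDegFinset O N).filter (· ∈ E),
      ψ (idealTr F h (Ideal.span {u + t • w})) =
      ∑ u ∈ (hasDegFinset O N).filter (· ∈ E), ψ (idealTr F h (Ideal.span {u})) := by
    intro t
    refine sum_bij' (fun u _ => u + t • w) (fun u _ => u + (-t) • w)
      (fun u hu => (hmem t u).mpr hu) (fun u hu => (hmem (-t) u).mpr hu) ?_ ?_ ?_
    · intro u _; simp
    · intro u _; simp
    · intro u _; rfl
  have hinner : ∀ u ∈ (hasDegFinset O N).filter (· ∈ E),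
      ∑ t : F, ψ (idealTr F h (Ideal.span {u + t • w})) = 0 := by
    intro u hu
    have hu' := mem_hasDegFinset.mp (mem_filter.mp hu).1
    obtain ⟨κ, hκ⟩ := O.one_dim hhw.1 hu'.1 hu'.2
    have hκ0 : κ ≠ 0 := by
      rintro rfl
      rw [zero_smul, sub_zero] at hκ
      exact hhw.2 hκ
    have h1 : ∀ t : F, ψ (idealTr F h (Ideal.span {u + t • w})) =
        ψ (idealTr F h (Ideal.span {u})) * ψ (t * (- (d * κ))) := by
      intro t
      have h2 := PoleFiltration.trace_quot_add hu' hh (by omega) ((O.V _).smul_mem t hw.1) hd0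
        (κ := t * κ) (by
          have := (O.V N).smul_mem t hκ
          rwa [smul_sub, smul_smul, ← mul_smul_comm] at this)
      rw [idealTr, idealTr, h2, ← AddChar.map_add_eq_mul]
      congr 1
      ring
    simp only [h1, ← mul_sum]
    rw [AddChar.sum_mulShift _ hψ, if_neg, Nat.cast_zero, mul_zero]
    exact neg_ne_zero.mpr (mul_ne_zero hd hκ0)
  have h1 : ∑ t : F, ∑ u ∈ (hasDegFinset O N).filter (· ∈ E),
      ψ (idealTr F h (Ideal.span {u + t • w})) = 0 := by
    rw [sum_comm]
    exact sum_eq_zero hinner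
  simp only [hshift, sum_const, nsmul_eq_mul, mul_eq_zero] at h1
  refine h1.resolve_left ?_
  simp

theorem lCoeff_eq_zero {O : PoleFiltration F S} {ψ : AddChar F ℂ} (hψ : ψ.IsPrimitive) {h : S}
    {d : ℕ} (hh : O.HasDeg h d) (hd : (d : F) ≠ 0) {n : ℕ} (hn : 2 * O.gap + d ≤ n) :
    lCoeff O ψ h n = 0 := by
  classical
  have h1 := lCoeff_mul (O := O) ψ h n (M := 2 * O.gap) le_rfl
  rw [sum_eq_zero, mul_zero] at h1
  · exact (mul_eq_zero.mp h1).resolve_right (card_factor_ne_zero O _)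
  · intro E hE
    obtain ⟨hE0, hEM⟩ := mem_idealsOfDeg.mp hE
    rw [sum_trace_eq_zero hψ hh hd hE0 (by omega), mul_zero]

lemma lCoeff_zero {O : PoleFiltration F S} (ψ : AddChar F ℂ) (h : S) : lCoeff O ψ h 0 = 1 := by
  have : idealsOfDeg O 0 = {⊤} := by
    ext I
    rw [mem_idealsOfDeg, mem_singleton]
    constructor
    · rintro ⟨h0, h1⟩
      by_contra h2
      exact (idealDeg_pos O h0 h2).ne' h1
    · rintro rfl
      exact ⟨top_ne_bot, idealDeg_top⟩
  rw [lCoeff, this, sum_singleton, idealTr_top, AddChar.map_zero_eq_one]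

end LSeries

end

section

open Module Finset UniqueFactorizationMonoid

section Euler

variable {F S : Type*} [Field F] [CommRing S] [IsDedekindDomain S] [Algebra F S] [Fintype F]

lemma idealDeg_le_of_dvd (O : PoleFiltration F S) {I J : Ideal S} (hJ : J ≠ ⊥) (h : I ∣ J) :
    idealDeg F I ≤ idealDeg F J := by
  obtain ⟨E, rfl⟩ := h
  have hI : I ≠ ⊥ := by rintro rfl; exact hJ (Ideal.bot_mul E)
  have hE : E ≠ ⊥ := by rintro rfl; exact hJ (Ideal.mul_bot I)
  rw [idealDeg_mul O hI hE]
  exact Nat.le_add_right _ _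

lemma idealDeg_pow (O : PoleFiltration F S) {I : Ideal S} (hI : I ≠ ⊥) (e : ℕ) :
    idealDeg F (I ^ e) = e * idealDeg F I := by
  induction e with
  | zero => rw [pow_zero, Ideal.one_eq_top, idealDeg_top, zero_mul]
  | succ e ih => rw [pow_succ, idealDeg_mul O (pow_ne_zero e hI) hI, ih]; ring

lemma idealTr_pow (O : PoleFiltration F S) {I : Ideal S} (hI : I ≠ ⊥) (h : S) (e : ℕ) :
    idealTr F h (I ^ e) = e * idealTr F h I := by
  induction e with
  | zero => rw [pow_zero, Ideal.one_eq_top, idealTr_top]; simp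
  | succ e ih => rw [pow_succ, (idealDegTr_mul O (pow_ne_zero e hI) hI h).2, ih]; push_cast; ring

open Classical in
/-- The nonzero primes of a given degree. -/
noncomputable def primesOfDeg (O : PoleFiltration F S) (d : ℕ) : Finset (Ideal S) :=
  (idealsOfDeg O d).filter Prime

lemma mem_primesOfDeg {O : PoleFiltration F S} {d : ℕ} {P : Ideal S} :
    P ∈ primesOfDeg O d ↔ Prime P ∧ idealDeg F P = d := by
  classical
  rw [primesOfDeg, mem_filter, mem_idealsOfDeg]
  exact ⟨fun h => ⟨h.2, h.1.2⟩, fun h => ⟨⟨h.1.ne_zero, h.2⟩, h.1⟩⟩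

open Classical in
lemma idealDeg_eq_sum_count (O : PoleFiltration F S) {I : Ideal S} (hI : I ≠ ⊥) :
    idealDeg F I = ∑ P ∈ (normalizedFactors I).toFinset,
      (normalizedFactors I).count P * idealDeg F P := by
  have key : ∀ s : Multiset (Ideal S), (∀ P ∈ s, P ≠ ⊥) →
      idealDeg F s.prod = (s.map (idealDeg F)).sum := by
    intro s
    induction s using Multiset.induction_on with
    | empty => intro _; rw [Multiset.prod_zero, Ideal.one_eq_top, idealDeg_top]; simp
    | cons P s ih =>
      intro hs
      rw [Multiset.prod_cons, Multiset.map_cons, Multiset.sum_cons, idealDeg_mul O, ih]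
      · exact fun Q hQ => hs Q (Multiset.mem_cons_of_mem hQ)
      · exact hs P (Multiset.mem_cons_self P s)
      · exact Multiset.prod_ne_zero fun h0 => hs _ (Multiset.mem_cons_of_mem h0) rfl
  have h1 := key (normalizedFactors I) fun P hP => (prime_of_normalized_factor P hP).ne_zero
  rw [associated_iff_eq.mp (prod_normalizedFactors hI), sum_multiset_map_count] at h1
  simpa using h1

open Classical in
lemma pow_dvd_iff_le_count {P I : Ideal S} (hP : Prime P) (hI : I ≠ ⊥) (e : ℕ) :
    P ^ e ∣ I ↔ e ≤ (normalizedFactors I).count P := by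
  rw [dvd_iff_normalizedFactors_le_normalizedFactors (pow_ne_zero e hP.ne_zero) hI,
    normalizedFactors_pow, normalizedFactors_irreducible hP.irreducible, normalize_eq,
    Multiset.nsmul_singleton, Multiset.le_count_iff_replicate_le]

open Classical in
lemma idealDeg_eq_sum (O : PoleFiltration F S) {I : Ideal S} (hI : I ≠ ⊥) :
    idealDeg F I = ∑ d ∈ Icc 1 (idealDeg F I), ∑ P ∈ primesOfDeg O d,
      ∑ e ∈ Icc 1 (idealDeg F I), if P ^ e ∣ I then d else 0 := by
  set n := idealDeg F I with hn
  have hin : ∀ d ∈ Icc 1 n, ∀ P ∈ primesOfDeg O d,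
      ∑ e ∈ Icc 1 n, (if P ^ e ∣ I then d else 0) =
        (normalizedFactors I).count P * idealDeg F P := by
    intro d hd P hP
    obtain ⟨hPp, rfl⟩ := mem_primesOfDeg.mp hP
    rw [← sum_filter, sum_const, smul_eq_mul]
    congr 1
    have : (Icc 1 n).filter (fun e => P ^ e ∣ I) = Icc 1 ((normalizedFactors I).count P) := by
      ext e
      rw [mem_filter, pow_dvd_iff_le_count hPp hI, mem_Icc, mem_Icc]
      refine ⟨fun h => ⟨h.1.1, h.2⟩, fun h => ⟨⟨h.1, ?_⟩, h.2⟩⟩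
      have h1 := idealDeg_le_of_dvd O hI ((pow_dvd_iff_le_count hPp hI e).mpr h.2)
      rw [idealDeg_pow O hPp.ne_zero] at h1
      have := (mem_Icc.mp hd).1
      nlinarith
    rw [this, Nat.card_Icc]
    rfl
  rw [sum_congr rfl fun d hd => sum_congr rfl (hin d hd), ← sum_biUnion]
  · refine (hn.trans (idealDeg_eq_sum_count O hI)).trans (sum_subset ?_ ?_)
    · intro P hP
      rw [Multiset.mem_toFinset] at hP
      have hPp := prime_of_normalized_factor P hP
      rw [mem_biUnion]
      refine ⟨idealDeg F P, mem_Icc.mpr ⟨?_, ?_⟩, mem_primesOfDeg.mpr ⟨hPp, rfl⟩⟩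
      · exact idealDeg_pos O hPp.ne_zero fun h => hPp.not_isUnit (Ideal.isUnit_iff.mpr h)
      · exact idealDeg_le_of_dvd O hI (dvd_of_mem_normalizedFactors hP)
    · intro P _ hP
      rw [Multiset.mem_toFinset] at hP
      rw [Multiset.count_eq_zero_of_notMem hP, zero_mul]
  · intro d _ d' _ hdd'
    refine disjoint_left.mpr fun P hP hP' => hdd' ?_
    rw [← (mem_primesOfDeg.mp hP).2, (mem_primesOfDeg.mp hP').2]

/-- The power sum `∑ deg P · χ(P)^e` over prime powers of total degree `i`. -/
noncomputable def primePowerSum (O : PoleFiltration F S) (ψ : AddChar F ℂ) (h : S) (i : ℕ) : ℂ :=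
  ∑ x ∈ i.divisorsAntidiagonal, ∑ P ∈ primesOfDeg O x.1, x.1 * ψ (x.2 * idealTr F h P)

open Classical in
lemma sum_dvd_eq (O : PoleFiltration F S) (ψ : AddChar F ℂ) (h : S) {P : Ideal S} (hP : Prime P)
    (e n : ℕ) :
    ∑ I ∈ idealsOfDeg O n, (if P ^ e ∣ I then ψ (idealTr F h I) else 0) =
      if idealDeg F P * e ≤ n then
        ψ (e * idealTr F h P) * lCoeff O ψ h (n - idealDeg F P * e) else 0 := by
  have hP0 := pow_ne_zero e hP.ne_zero
  rw [← sum_filter]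
  split_ifs with hle
  · rw [lCoeff, mul_sum]
    symm
    refine sum_bij (fun J _ => P ^ e * J) ?_ ?_ ?_ ?_
    · intro J hJ
      obtain ⟨hJ0, hJd⟩ := mem_idealsOfDeg.mp hJ
      rw [mem_filter, mem_idealsOfDeg, idealDeg_mul O hP0 hJ0, idealDeg_pow O hP.ne_zero]
      refine ⟨⟨mul_ne_zero hP0 hJ0, ?_⟩, dvd_mul_right _ _⟩
      rw [hJd, mul_comm e]; omega
    · exact fun J _ J' _ hJJ => mul_left_cancel₀ hP0 hJJ
    · intro I hI
      rw [mem_filter, mem_idealsOfDeg] at hI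
      obtain ⟨⟨hI0, hIn⟩, J, rfl⟩ := hI
      have hJ0 : J ≠ ⊥ := by rintro rfl; exact hI0 (Ideal.mul_bot _)
      refine ⟨J, mem_idealsOfDeg.mpr ⟨hJ0, ?_⟩, rfl⟩
      rw [idealDeg_mul O hP0 hJ0, idealDeg_pow O hP.ne_zero, mul_comm e] at hIn
      omega
    · intro J hJ
      have hJ0 := (mem_idealsOfDeg.mp hJ).1
      rw [(idealDegTr_mul O hP0 hJ0 h).2, idealTr_pow O hP.ne_zero, AddChar.map_add_eq_mul]
  · refine sum_eq_zero fun I hI => ?_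
    rw [mem_filter, mem_idealsOfDeg] at hI
    exfalso
    apply hle
    have := idealDeg_le_of_dvd O hI.1.1 hI.2
    rw [idealDeg_pow O hP.ne_zero, hI.1.2] at this
    rwa [mul_comm]

theorem mul_lCoeff (O : PoleFiltration F S) (ψ : AddChar F ℂ) (h : S) (n : ℕ) :
    n * lCoeff O ψ h n = ∑ i ∈ Icc 1 n, primePowerSum O ψ h i * lCoeff O ψ h (n - i) := by
  classical
  have h1 : (n : ℂ) * lCoeff O ψ h n = ∑ d ∈ Icc 1 n, ∑ P ∈ primesOfDeg O d, ∑ e ∈ Icc 1 n,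
      ∑ I ∈ idealsOfDeg O n, (d : ℂ) * if P ^ e ∣ I then ψ (idealTr F h I) else 0 := by
    have h2 : (n : ℂ) * lCoeff O ψ h n = ∑ I ∈ idealsOfDeg O n, ∑ d ∈ Icc 1 n,
        ∑ P ∈ primesOfDeg O d, ∑ e ∈ Icc 1 n,
          (d : ℂ) * if P ^ e ∣ I then ψ (idealTr F h I) else 0 := by
      rw [lCoeff, mul_sum]
      refine sum_congr rfl fun I hI => ?_
      obtain ⟨hI0, hIn⟩ := mem_idealsOfDeg.mp hI
      have h3 := idealDeg_eq_sum O hI0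
      rw [hIn] at h3
      conv_lhs => rw [h3]
      push_cast
      simp only [sum_mul]
      refine sum_congr rfl fun d _ => sum_congr rfl fun P _ => sum_congr rfl fun e _ => ?_
      split_ifs <;> simp
    rw [h2, sum_comm]
    refine sum_congr rfl fun d _ => ?_
    rw [sum_comm]
    refine sum_congr rfl fun P _ => ?_
    rw [sum_comm]
  rw [h1]
  have h4 : ∀ d ∈ Icc 1 n, ∑ P ∈ primesOfDeg O d, ∑ e ∈ Icc 1 n,
      ∑ I ∈ idealsOfDeg O n, (d : ℂ) * (if P ^ e ∣ I then ψ (idealTr F h I) else 0) =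
      ∑ e ∈ Icc 1 n, ∑ i ∈ Icc 1 n, if d * e = i then
        (∑ P ∈ primesOfDeg O d, (d : ℂ) * ψ (e * idealTr F h P)) * lCoeff O ψ h (n - i) else 0 := by
    intro d hd
    rw [sum_comm]
    refine sum_congr rfl fun e he => ?_
    rw [sum_ite_eq]
    have hde : d * e ∈ Icc 1 n ↔ d * e ≤ n := by
      rw [mem_Icc] at hd he ⊢
      exact ⟨fun h => h.2, fun h => ⟨Nat.mul_pos hd.1 he.1, h⟩⟩
    have h5 : ∀ P ∈ primesOfDeg O d,
        ∑ I ∈ idealsOfDeg O n, (d : ℂ) * (if P ^ e ∣ I then ψ (idealTr F h I) else 0) =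
        if d * e ≤ n then (d : ℂ) * ψ (e * idealTr F h P) * lCoeff O ψ h (n - d * e) else 0 := by
      intro P hP
      obtain ⟨hPp, rfl⟩ := mem_primesOfDeg.mp hP
      rw [← mul_sum, sum_dvd_eq O ψ h hPp]
      split_ifs
      · ring
      · simp
    rw [sum_congr rfl h5, sum_mul]
    simp only [hde]
    split_ifs
    · rfl
    · simp
  rw [sum_congr rfl h4]
  have h6 : ∀ i ∈ Icc 1 n, primePowerSum O ψ h i * lCoeff O ψ h (n - i) =
      ∑ d ∈ Icc 1 n, ∑ e ∈ Icc 1 n, if d * e = i then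
        (∑ P ∈ primesOfDeg O d, (d : ℂ) * ψ (e * idealTr F h P)) * lCoeff O ψ h (n - i) else 0 := by
    intro i hi
    rw [← sum_product', ← sum_filter, primePowerSum, sum_mul]
    refine sum_congr ?_ fun _ _ => rfl
    ext x
    rw [Nat.mem_divisorsAntidiagonal, mem_filter, mem_product, mem_Icc, mem_Icc]
    rw [mem_Icc] at hi
    constructor
    · rintro ⟨rfl, h0⟩
      have ha : 0 < x.1 := Nat.pos_of_ne_zero fun h => h0 (by simp [h])
      have hb : 0 < x.2 := Nat.pos_of_ne_zero fun h => h0 (by simp [h])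
      refine ⟨⟨⟨ha, ?_⟩, hb, ?_⟩, rfl⟩ <;> nlinarith
    · rintro ⟨_, rfl⟩
      exact ⟨rfl, by omega⟩
  rw [sum_congr rfl h6]
  conv_rhs => rw [sum_comm]
  refine sum_congr rfl fun d _ => ?_
  conv_rhs => rw [sum_comm]

end Euler

end

section

open Module Finset

lemma trace_algHom {F E K : Type*} [Field F] [Field E] [Field K] [Algebra F E] [Algebra F K]
    [FiniteDimensional F K] [FiniteDimensional F E] (σ : E →ₐ[F] K) {m : ℕ}
    (hm : finrank F E * m = finrank F K) (x : E) :
    Algebra.trace F K (σ x) = m * Algebra.trace F E x := by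
  algebraize [σ.toRingHom]
  have : FiniteDimensional E K := FiniteDimensional.right F E K
  have h1 : finrank E K = m := by
    have := finrank_mul_finrank F E K
    rw [← hm] at this
    exact Nat.eq_of_mul_eq_mul_left finrank_pos this
  have h2 : σ x = algebraMap E K x := rfl
  rw [h2, ← Algebra.trace_trace (S := E), Algebra.trace_algebraMap, h1, map_nsmul, nsmul_eq_mul]

section Points

variable {F S : Type*} [Field F] [CommRing S] [IsDedekindDomain S] [Algebra F S] [Fintype F]

lemma AlgHom.ker_prime (O : PoleFiltration F S) {K : Type*} [Field K] [Algebra F K]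
    [FiniteDimensional F K] (φ : S →ₐ[F] K) : Prime (RingHom.ker φ) := by
  refine Ideal.prime_of_isPrime ?_ (RingHom.ker_isPrime φ)
  intro h
  have hinj : Function.Injective φ := (RingHom.injective_iff_ker_eq_bot φ).mpr h
  have h1 := O.le_finrank (O.gap + finrank F K + 1)
  have h2 : finrank F (O.V (O.gap + finrank F K + 1)) ≤ finrank F K :=
    LinearMap.finrank_le_finrank_of_injective
      (f := φ.toLinearMap ∘ₗ (O.V (O.gap + finrank F K + 1)).subtype)
      (hinj.comp Subtype.val_injective)
  omega

/-- Algebra homomorphisms with a given maximal kernel are the embeddings of the residue field. -/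
noncomputable def homKerEquiv {K : Type*} [Field K] [Algebra F K] (P : Ideal S) [P.IsMaximal] :
    {φ : S →ₐ[F] K // RingHom.ker φ = P} ≃ ((S ⧸ P) →ₐ[F] K) where
  toFun φ := Ideal.Quotient.liftₐ P φ.1 fun a ha => by rwa [← φ.2] at ha
  invFun σ := ⟨σ.comp (Ideal.Quotient.mkₐ F P), by
    let := Ideal.Quotient.field P
    ext a
    rw [RingHom.mem_ker]
    change σ (Ideal.Quotient.mk P a) = 0 ↔ _
    rw [← Ideal.Quotient.eq_zero_iff_mem]
    exact map_eq_zero_iff σ (σ : (S ⧸ P) →+* K).injective⟩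
  left_inv φ := by
    apply Subtype.ext
    ext a
    rfl
  right_inv σ := by
    refine AlgHom.ext fun a => ?_
    obtain ⟨a, rfl⟩ := Ideal.Quotient.mk_surjective a
    rfl

lemma exists_mul_idealDeg (O : PoleFiltration F S) {K : Type*} [Field K] [Algebra F K]
    [FiniteDimensional F K] (φ : S →ₐ[F] K) :
    idealDeg F (RingHom.ker φ) ∣ finrank F K := by
  have hP := φ.ker_prime O
  have hPp := Ideal.isPrime_of_prime hP
  have : (RingHom.ker φ).IsMaximal := hPp.isMaximal hP.ne_zero
  let := Ideal.Quotient.field (RingHom.ker φ)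
  have := O.finiteDimensional_quot_ideal hP.ne_zero
  have : Finite K := Module.finite_of_finite F
  exact FiniteField.nonempty_algHom_iff_finrank_dvd.mp
    ⟨homKerEquiv (RingHom.ker φ) ⟨φ, rfl⟩⟩

lemma trace_apply_of_ker {K : Type*} [Field K] [Algebra F K]
    (O : PoleFiltration F S) [FiniteDimensional F K] (φ : S →ₐ[F] K) {m : ℕ}
    (hm : idealDeg F (RingHom.ker φ) * m = finrank F K) (h : S) :
    Algebra.trace F K (φ h) = m * idealTr F h (RingHom.ker φ) := by
  have hP := φ.ker_prime O
  have hPp := Ideal.isPrime_of_prime hP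
  have : (RingHom.ker φ).IsMaximal := hPp.isMaximal hP.ne_zero
  let := Ideal.Quotient.field (RingHom.ker φ)
  have := O.finiteDimensional_quot_ideal hP.ne_zero
  exact trace_algHom (homKerEquiv (RingHom.ker φ) ⟨φ, rfl⟩) hm (Ideal.Quotient.mk _ h)

lemma natCard_hom_ker (O : PoleFiltration F S) {K : Type*} [Field K] [Algebra F K]
    [FiniteDimensional F K] {P : Ideal S} (hP : Prime P) (hd : idealDeg F P ∣ finrank F K) :
    Finite {φ : S →ₐ[F] K // RingHom.ker φ = P} ∧
    Nat.card {φ : S →ₐ[F] K // RingHom.ker φ = P} = idealDeg F P := by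
  have hPp := Ideal.isPrime_of_prime hP
  have : P.IsMaximal := hPp.isMaximal hP.ne_zero
  let := Ideal.Quotient.field P
  have := O.finiteDimensional_quot_ideal hP.ne_zero
  have : Finite K := Module.finite_of_finite F
  refine ⟨Finite.of_equiv _ (homKerEquiv P).symm, ?_⟩
  rw [Nat.card_congr (homKerEquiv P)]
  exact FiniteField.natCard_algHom_of_finrank_dvd hd

lemma finite_algHom (O : PoleFiltration F S) (K : Type*) [Field K] [Algebra F K]
    [FiniteDimensional F K] : Finite (S →ₐ[F] K) := by
  classical
  have h1 : (Set.univ : Set (S →ₐ[F] K)) ⊆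
      ⋃ P ∈ ((Finset.range (finrank F K + 1)).biUnion (primesOfDeg O) : Set (Ideal S)),
        {φ | RingHom.ker φ = P ∧ idealDeg F P ∣ finrank F K} := by
    intro φ _
    simp only [Set.mem_iUnion]
    refine ⟨RingHom.ker φ, ?_, rfl, exists_mul_idealDeg O φ⟩
    rw [mem_coe, mem_biUnion]
    refine ⟨_, mem_range.mpr ?_, mem_primesOfDeg.mpr ⟨φ.ker_prime O, rfl⟩⟩
    exact Nat.lt_succ_of_le (Nat.le_of_dvd finrank_pos (exists_mul_idealDeg O φ))
  rw [← Set.finite_univ_iff]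
  refine (Set.Finite.biUnion (Finset.finite_toSet _) fun P hP => ?_).subset h1
  by_cases hd : idealDeg F P ∣ finrank F K
  · rw [mem_coe, mem_biUnion] at hP
    obtain ⟨d, _, hd'⟩ := hP
    have := (natCard_hom_ker O (K := K) (mem_primesOfDeg.mp hd').1 hd).1
    have hfin : Set.Finite {φ : S →ₐ[F] K | RingHom.ker φ = P} := this
    exact hfin.subset fun φ hφ => hφ.1
  · simp [hd]

theorem primePowerSum_eq (O : PoleFiltration F S) (ψ : AddChar F ℂ) (h : S) (K : Type*) [Field K]
    [Algebra F K] [FiniteDimensional F K] [Fintype (S →ₐ[F] K)] :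
    primePowerSum O ψ h (finrank F K) = ∑ φ : S →ₐ[F] K, ψ (Algebra.trace F K (φ h)) := by
  classical
  rw [primePowerSum, sum_sigma']
  symm
  rw [← sum_fiberwise_of_maps_to (s := univ) (t := (finrank F K).divisorsAntidiagonal.sigma
      fun x => primesOfDeg O x.1) (g := fun φ : S →ₐ[F] K => ⟨(idealDeg F (RingHom.ker φ),
      finrank F K / idealDeg F (RingHom.ker φ)), RingHom.ker φ⟩)]
  · refine sum_congr rfl ?_
    rintro ⟨⟨d, m⟩, P⟩ hx
    rw [mem_sigma, Nat.mem_divisorsAntidiagonal] at hx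
    obtain ⟨⟨hdm, -⟩, hPd⟩ := hx
    dsimp only at hdm hPd ⊢
    obtain ⟨hP, rfl⟩ := mem_primesOfDeg.mp hPd
    have hpos : 0 < idealDeg F P :=
      idealDeg_pos O hP.ne_zero fun h => hP.not_isUnit (Ideal.isUnit_iff.mpr h)
    have hf : (univ : Finset (S →ₐ[F] K)).filter (fun φ =>
        (⟨(idealDeg F (RingHom.ker φ), finrank F K / idealDeg F (RingHom.ker φ)),
          RingHom.ker φ⟩ : (_ : ℕ × ℕ) × Ideal S) = ⟨(idealDeg F P, m), P⟩) =
        univ.filter fun φ => RingHom.ker φ = P := by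
      ext φ
      rw [mem_filter, mem_filter]
      refine and_congr_right fun _ => ⟨fun h => ?_, fun h => ?_⟩
      · exact congrArg Sigma.snd h
      · rw [h, ← hdm, Nat.mul_div_cancel_left _ hpos]
    rw [hf]
    have hv : ∀ φ ∈ (univ : Finset (S →ₐ[F] K)).filter (fun φ => RingHom.ker φ = P),
        ψ (Algebra.trace F K (φ h)) = ψ (m * idealTr F h P) := by
      intro φ hφ
      obtain rfl := (mem_filter.mp hφ).2
      rw [trace_apply_of_ker O φ hdm]
    rw [sum_congr rfl hv, sum_const, nsmul_eq_mul]
    congr 2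
    rw [← (natCard_hom_ker O (K := K) hP (Dvd.intro _ hdm)).2, Nat.card_eq_fintype_card,
      Fintype.card_subtype]
  · intro φ _
    rw [mem_sigma, Nat.mem_divisorsAntidiagonal]
    exact ⟨⟨Nat.mul_div_cancel' (exists_mul_idealDeg O φ), finrank_pos.ne'⟩,
      mem_primesOfDeg.mpr ⟨φ.ker_prime O, rfl⟩⟩

end Points

end

section

open Module Finset

namespace PoleFiltration

variable {F A : Type*} [Field F] [CommRing A] [Algebra F A] {O : PoleFiltration F A}

lemma card_zeros_le {L : Type*} [Field L] [Algebra F L] {u : A} {n : ℕ} (hu : O.HasDeg u n)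
    {T : Finset (A →ₐ[F] L)} (hT : ∀ φ ∈ T, φ u = 0) : T.card ≤ n := by
  have := finiteDimensional_quot hu
  have hz : ∀ φ : T, ∀ a ∈ Ideal.span {u}, φ.1 a = 0 := by
    intro φ a ha
    obtain ⟨b, rfl⟩ := Ideal.mem_span_singleton'.mp ha
    rw [map_mul, hT φ.1 φ.2, mul_zero]
  let Φ : T → ((A ⧸ Ideal.span {u}) →ₐ[F] L) := fun φ => Ideal.Quotient.liftₐ _ φ.1 (hz φ)
  have hΦ : Function.Injective Φ := by
    intro φ φ' h
    apply Subtype.ext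
    ext a
    exact DFunLike.congr_fun h (Ideal.Quotient.mk _ a)
  have hli := (linearIndependent_toLinearMap F (A ⧸ Ideal.span {u}) L).comp Φ hΦ
  have h1 := hli.fintype_card_le_finrank
  rw [Fintype.card_coe, Module.finrank_linearMap_self, finrank_quot hu] at h1
  exact h1

lemma sum_ne_zero_of_hasDeg {ι : Type*} {X : Finset ι} (hX : X.Nonempty) {v : ι → A} {n : ι → ℕ}
    (hv : ∀ s ∈ X, O.HasDeg (v s) (n s)) (hn : Set.InjOn n X) : ∑ s ∈ X, v s ≠ 0 := by
  classical
  obtain ⟨m, hm, hmax⟩ := X.exists_max_image n hX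
  rw [← add_sum_erase _ _ hm]
  refine HasDeg.ne_zero (O := O) (m := n m) ((hv m hm).add (Submodule.sum_mem _ fun s hs => ?_))
  obtain ⟨hsm, hsX⟩ := mem_erase.mp hs
  have h1 := hmax s hsX
  have h2 : n s ≠ n m := fun h => hsm (hn hsX hm h)
  exact O.mono (by omega) (hv s hsX).1

open Classical in
lemma card_filter_degs (O : PoleFiltration F A) (M : ℕ) :
    M ≤ ((range M).filter (· ∈ O.degs)).card + O.gap := by
  have h1 := finrank_inf_eq_card (O := O) ⊤ M
  rw [inf_top_eq] at h1
  have h2 : ((range M).filter (· ∈ O.degs)).card = finrank F (O.V M) := by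
    rw [h1]
    congr 1
    ext s
    rw [mem_filter, mem_filter]
    simp [degs]
  rw [h2]
  exact O.le_finrank M

/-- Stepanov's method on a filtered algebra. -/
theorem stepanov [Nontrivial A] {L : Type*} [Field L] [Algebra F L] {q r : ℕ}
    (τ : L →ₐ[F] L) (hτ : ∀ x, τ x = x ^ q) {T : Finset (A →ₐ[F] L)}
    (hW : ∀ m n, ∃ W : Submodule F (T → L), FiniteDimensional F W ∧ finrank F W ≤ r * (m + n) ∧
      ∀ a ∈ O.V m, ∀ b ∈ O.V n, (fun φ : T => φ.1 a * φ.1 b ^ (q * q)) ∈ W)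
    {c : ℕ} (hc : c = O.gap + r * O.gap + r ^ 2 + 1) (hq : (O.gap + r) * (c + 1) < q) :
    T.card ≤ q * (r * q + c) := by
  classical
  set M := r * q + c with hM
  set X := (range M).filter (· ∈ O.degs) with hX
  have hXd : ∀ s : X, O.HasDeg (O.elt s) s := fun s => elt_hasDeg (mem_filter.mp s.2).2
  have hXM : ∀ s : X, (s : ℕ) < M := fun s => mem_range.mp (mem_filter.mp s.2).1
  have hq0 : 0 < q := by omega
  obtain ⟨W, hWf, hWr, hW⟩ := hW (q * (q - 1) + 1) M
  let Θ : (X → O.V q) →ₗ[F] (T → L) := LinearMap.pi fun φ => ∑ s : X,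
    LinearMap.mulRight F (φ.1 (O.elt s) ^ (q * q)) ∘ₗ τ.toLinearMap ∘ₗ φ.1.toLinearMap ∘ₗ
      (O.V q).subtype ∘ₗ LinearMap.proj s
  have hΘ : ∀ f φ, Θ f φ = ∑ s : X, τ (φ.1 (f s)) * φ.1 (O.elt s) ^ (q * q) := by
    intro f φ
    simp [Θ]
  have hΘW : ∀ f, Θ f ∈ W := by
    intro f
    have : Θ f = ∑ s : X, fun φ : T => φ.1 ((f s : A) ^ q) * φ.1 (O.elt s) ^ (q * q) := by
      ext φ
      rw [hΘ, Finset.sum_apply]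
      exact sum_congr rfl fun s _ => by rw [hτ, map_pow]
    rw [this]
    refine Submodule.sum_mem _ fun s _ => hW _ ?_ _ (O.mono (hXM s) (hXd s).1)
    by_cases hfs : (f s : A) = 0
    · rw [hfs, zero_pow hq0.ne']; exact zero_mem _
    · obtain ⟨d, hd⟩ := exists_hasDeg (O := O) hfs
      have hdq := hd.le_of_mem (f s).2
      refine O.mono ?_ (hd.pow q).1
      have : d * q ≤ (q - 1) * q := Nat.mul_le_mul_right q (by omega)
      rw [mul_comm q (q - 1)]
      omega
  have hfin : finrank F W < finrank F (X → O.V q) := by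
    rw [Module.finrank_pi_fintype, sum_const, card_univ, Fintype.card_coe, smul_eq_mul]
    refine hWr.trans_lt ?_
    have h1 : M ≤ X.card + O.gap := by convert card_filter_degs O M
    have h2 := O.le_finrank q
    have hgq : O.gap ≤ q := by nlinarith
    have hgM : O.gap ≤ M := by rw [hM, hc]; nlinarith
    have h3 : (M - O.gap) * (q - O.gap) ≤ X.card * finrank F (O.V q) :=
      Nat.mul_le_mul (by omega) (by omega)
    refine lt_of_lt_of_le ?_ h3
    zify [hgq, hgM, Nat.one_le_iff_ne_zero.mpr hq0.ne'] at hq hc hM ⊢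
    rw [hM]
    have hc0 : (0 : ℤ) ≤ O.gap := Int.natCast_nonneg _
    have hr0 : (0 : ℤ) ≤ r := Int.natCast_nonneg _
    have hcc : (0 : ℤ) ≤ c := Int.natCast_nonneg _
    have hqq : (0 : ℤ) ≤ q := Int.natCast_nonneg _
    have h5 : (c : ℤ) - O.gap - r * O.gap = r ^ 2 + 1 := by rw [hc]; ring
    have h6 : (r * q + c - O.gap : ℤ) * (q - O.gap) - r * (q * (q - 1) + 1 + (r * q + c)) =
      q * ((c - O.gap - r * O.gap) - r ^ 2 + r) - O.gap * (c - O.gap) - r * (1 + c) := by ring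
    have h7 : (0 : ℤ) < q * ((c - O.gap - r * O.gap) - r ^ 2 + r) - O.gap * (c - O.gap) -
        r * (1 + c) := by
      rw [h5]
      nlinarith [mul_nonneg hqq hr0, mul_nonneg hc0 hc0]
    linarith
  have hker := LinearMap.ker_ne_bot_of_finrank_lt (f := Θ.codRestrict W hΘW) hfin
  obtain ⟨f, hf, hf0⟩ := Submodule.exists_mem_ne_zero_of_ne_bot hker
  have hf1 : Θ f = 0 := congrArg Subtype.val (LinearMap.mem_ker.mp hf)
  set Ψ := ∑ s : X, (f s : A) * O.elt s ^ q with hΨ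
  have hzero : ∀ φ ∈ T, φ Ψ = 0 := by
    intro φ hφ
    have h1 : τ (φ Ψ) = 0 := by
      have h2 := congrFun hf1 ⟨φ, hφ⟩
      rw [hΘ] at h2
      rw [hΨ, map_sum, map_sum]
      refine (sum_congr rfl fun s _ => ?_).trans h2
      rw [map_mul, map_mul, map_pow, map_pow, hτ (φ (O.elt s)), ← pow_mul]
    exact (map_eq_zero τ).mp h1
  have hmem : Ψ ∈ O.V (q * M) := by
    refine Submodule.sum_mem _ fun s _ => ?_
    have h1 := O.mul_mem ((hXd s).pow q).1 (f s).2
    rw [mul_comm (f s : A)]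
    refine O.mono ?_ h1
    have := hXM s
    nlinarith
  have hne : Ψ ≠ 0 := by
    have hYne : (univ.filter fun s : X => (f s : A) ≠ 0).Nonempty := by
      by_contra hcon
      rw [not_nonempty_iff_eq_empty, filter_eq_empty_iff] at hcon
      apply hf0
      ext s
      simpa using hcon (mem_univ s)
    have hex : ∀ s : X, ∃ d, (f s : A) ≠ 0 → O.HasDeg (f s : A) d ∧ d < q := by
      intro s
      by_cases hfs : (f s : A) = 0
      · exact ⟨0, fun h => absurd hfs h⟩
      · obtain ⟨d, hd⟩ := exists_hasDeg (O := O) hfs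
        exact ⟨d, fun _ => ⟨hd, hd.le_of_mem (f s).2⟩⟩
    choose d hd using hex
    have h1 : Ψ = ∑ s ∈ univ.filter fun s : X => (f s : A) ≠ 0, (f s : A) * O.elt s ^ q := by
      rw [hΨ, sum_filter_of_ne]
      intro s _ hs
      exact left_ne_zero_of_mul hs
    rw [h1]
    refine sum_ne_zero_of_hasDeg (O := O) hYne (n := fun s => d s + s * q) ?_ ?_
    · intro s hs
      exact (hd s (mem_filter.mp hs).2).1.mul ((hXd s).pow q)
    · intro s hs s' hs' h
      have h2 := (hd s (mem_filter.mp hs).2).2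
      have h3 := (hd s' (mem_filter.mp hs').2).2
      have h4 : ((d s + s * q) / q : ℕ) = (d s' + s' * q) / q := congrArg (· / q) h
      rw [Nat.add_mul_div_right _ _ hq0, Nat.add_mul_div_right _ _ hq0, Nat.div_eq_of_lt h2,
        Nat.div_eq_of_lt h3, zero_add, zero_add] at h4
      exact Subtype.ext h4
  obtain ⟨n, hn⟩ := exists_hasDeg (O := O) hne
  exact (card_zeros_le hn hzero).trans (hn.le_of_mem hmem).le

end PoleFiltration

end

section

open Module Finset Polynomial

namespace PoleFiltration

section ArtinSchreier

variable {p : ℕ} [Fact p.Prime] {S : Type} [CommRing S] [IsDomain S] [Algebra (ZMod p) S]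

/-- The Artin–Schreier polynomial `Z ^ p - Z - h`. -/
noncomputable def artinSchreier (p : ℕ) (h : S) : S[X] := X ^ p - (X + C h)

lemma artinSchreier_monic (h : S) : (artinSchreier p h).Monic := by
  have hp := (Fact.out : p.Prime).one_lt
  refine monic_X_pow_sub ?_
  rw [degree_X_add_C]
  exact_mod_cast hp

lemma artinSchreier_natDegree (h : S) : (artinSchreier p h).natDegree = p := by
  have hp := (Fact.out : p.Prime).one_lt
  rw [artinSchreier, natDegree_sub_eq_left_of_natDegree_lt, natDegree_X_pow]
  rw [natDegree_X_pow, natDegree_X_add_C]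
  exact hp

lemma eval₂_artinSchreier {B : Type*} [CommRing B] (f : S →+* B) (x : B) (h : S) :
    (artinSchreier p h).eval₂ f x = x ^ p - (x + f h) := by
  simp [artinSchreier, eval₂_sub]

lemma artinSchreier_root_pow (h : S) : AdjoinRoot.root (artinSchreier p h) ^ p =
    AdjoinRoot.root (artinSchreier p h) + AdjoinRoot.of (artinSchreier p h) h := by
  have := AdjoinRoot.eval₂_root (artinSchreier p h)
  rw [eval₂_artinSchreier] at this
  exact sub_eq_zero.mp this

lemma exists_artinSchreier_tower (O : PoleFiltration (ZMod p) S) {h : S} {d : ℕ}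
    (hh : O.HasDeg h d) (hd : ¬ p ∣ d) :
    ∃ O' : PoleFiltration (ZMod p) (AdjoinRoot (artinSchreier p h)),
      ∀ t : ZMod p, ∃ σ : AdjoinRoot (artinSchreier p h) →ₐ[ZMod p]
        AdjoinRoot (artinSchreier p h),
        (∀ s, σ (AdjoinRoot.of _ s) = AdjoinRoot.of _ s) ∧
        σ (AdjoinRoot.root _) = AdjoinRoot.root _ + algebraMap _ _ t ∧
        ∀ n, ∀ u ∈ O'.V n, σ u ∈ O'.V n := by
  have hp := (Fact.out : p.Prime).one_lt
  set A := AdjoinRoot (artinSchreier p h) with hA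
  let pb : PowerBasis S A := AdjoinRoot.powerBasis' (artinSchreier_monic h)
  have hdim : pb.dim = p := by
    rw [AdjoinRoot.powerBasis'_dim, artinSchreier_natDegree]
  have hgen : pb.gen = AdjoinRoot.root _ := AdjoinRoot.powerBasis'_gen _
  have hd0 : 0 < d := Nat.pos_of_ne_zero fun h0 => hd (h0 ▸ dvd_zero p)
  have hcop : Nat.Coprime d pb.dim := by
    rw [hdim]; exact (((Fact.out : p.Prime).coprime_iff_not_dvd).mpr hd).symm
  have hroot := artinSchreier_root_pow (p := p) h
  let r : Fin pb.dim → ZMod p := fun i => if (i : ℕ) = 1 then -1 else 0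
  have hr : pb.gen ^ pb.dim = algebraMap S A h - ∑ i, r i • pb.gen ^ (i : ℕ) := by
    have h1 : ∑ i, r i • pb.gen ^ (i : ℕ) = - pb.gen := by
      rw [sum_eq_single (⟨1, by omega⟩ : Fin pb.dim)]
      · simp [r]
      · intro i _ hi
        have : (i : ℕ) ≠ 1 := fun h => hi (Fin.ext h)
        simp [r, this]
      · simp
    rw [h1, hdim, hgen, hroot, sub_neg_eq_add, add_comm]; rfl
  let O' := tower O pb d (by omega) hcop hd0 hh hr
  have : Nontrivial A := by
    refine AdjoinRoot.nontrivial _ ?_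
    rw [degree_eq_natDegree (artinSchreier_monic h).ne_zero, artinSchreier_natDegree]
    exact_mod_cast (Fact.out : p.Prime).ne_zero
  have hz : O'.HasDeg pb.gen d := tower_hasDeg_gen (by omega) hcop hd0 hh hr
  refine ⟨O', fun t => ?_⟩
  have hpt : (algebraMap (ZMod p) A t) ^ p = algebraMap (ZMod p) A t := by
    rw [← map_pow, ZMod.pow_card]
  have : CharP A p := charP_of_injective_algebraMap (algebraMap (ZMod p) A).injective p
  let σ : A →ₐ[ZMod p] A := AdjoinRoot.liftAlgHom _ (IsScalarTower.toAlgHom (ZMod p) S A)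
    (AdjoinRoot.root _ + algebraMap (ZMod p) A t) (by
      refine (eval₂_artinSchreier _ _ h).trans ?_
      rw [add_pow_char, hpt, hroot]
      exact sub_eq_zero.mpr (add_right_comm _ _ _))
  have hσ : ∀ s, σ (AdjoinRoot.of _ s) = AdjoinRoot.of _ s := by
    intro s
    apply AdjoinRoot.liftAlgHom_of
  have hσr : σ (AdjoinRoot.root _) = AdjoinRoot.root _ + algebraMap _ _ t := by
    apply AdjoinRoot.liftAlgHom_root
  refine ⟨σ, hσ, hσr, fun n u hu => ?_⟩
  have hz' : O'.HasDeg (pb.gen + algebraMap _ _ t) d := by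
    refine hz.add (O'.mono hd0 ?_)
    rw [Algebra.algebraMap_eq_smul_one]
    exact Submodule.smul_mem _ _ O'.one_mem
  rw [eq_sum_smul_pow (pb := pb) u, map_sum]
  refine Submodule.sum_mem _ fun b _ => ?_
  rcases exists_smul_pow_of_mem hu b with h0 | ⟨e, he, hlt⟩
  · rw [h0, zero_smul, map_zero]; exact zero_mem _
  · have h1 : σ (pb.basis.repr u b • pb.gen ^ (b : ℕ)) =
        pb.basis.repr u b • (pb.gen + algebraMap _ _ t) ^ (b : ℕ) := by
      rw [Algebra.smul_def, Algebra.smul_def, map_mul, map_pow, hgen, hσr, AdjoinRoot.algebraMap_eq,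
        hσ]
    rw [h1]
    refine O'.mono ?_ (smul_mem_towerV he (hz'.pow b).1)
    have := mul_comm d b
    omega

lemma pow_prime_pow_eq {L : Type*} [CommRing L] [CharP L p] {z w : L} (hz : z ^ p = z + w) (n : ℕ) :
    z ^ p ^ n = z + ∑ i ∈ range n, w ^ p ^ i := by
  induction n with
  | zero => simp
  | succ n ih =>
    rw [pow_succ, pow_mul, ih, add_pow_char, hz, sum_pow_char, sum_range_succ', add_assoc]
    congr 1
    rw [add_comm, pow_zero, pow_one]
    congr 1
    exact sum_congr rfl fun i _ => by rw [← pow_mul, ← pow_succ]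

open Classical in
/-- Stepanov's upper bound for the number of points over a field of square order at which the trace
of `h` takes a given value. -/
theorem card_trace_eq_le (O : PoleFiltration (ZMod p) S) {h : S} {d : ℕ}
    (hh : O.HasDeg h d) (hd : ¬ p ∣ d) :
    ∃ c q₁ : ℕ, ∀ (K : Type) [Field K] [Algebra (ZMod p) K] [FiniteDimensional (ZMod p) K]
      [Fintype (S →ₐ[ZMod p] K)] (e : ℕ), finrank (ZMod p) K = 2 * e → q₁ < p ^ e →
      ∀ t : ZMod p, p * (univ.filter fun φ : S →ₐ[ZMod p] K =>
        Algebra.trace (ZMod p) K (φ h) = t).card ≤ p ^ e * (p ^ e + c) := by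
  obtain ⟨O', hO'⟩ := exists_artinSchreier_tower O hh hd
  refine ⟨O'.gap + 1 * O'.gap + 1 ^ 2 + 1, (O'.gap + 1) * (O'.gap + 1 * O'.gap + 1 ^ 2 + 1 + 1), ?_⟩
  intro K _ _ _ _ e he hq t
  obtain ⟨σ, hσ, hσr, hσV⟩ := hO' t
  have hp := (Fact.out : p.Prime).one_lt
  have : Finite K := Module.finite_of_finite (ZMod p)
  have := Fintype.ofFinite K
  have hK : Fintype.card K = p ^ e * p ^ e := by
    rw [Module.card_eq_pow_finrank (K := ZMod p), he, ZMod.card, two_mul, pow_add]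
  let L := AlgebraicClosure K
  have : CharP L p := charP_of_injective_algebraMap (algebraMap (ZMod p) L).injective p
  let τ : L →ₐ[ZMod p] L := FiniteField.frobeniusAlgHom (ZMod p) L ^ e
  have hτ : ∀ x, τ x = x ^ p ^ e := by
    intro x
    rw [AlgHom.coe_pow, FiniteField.coe_frobeniusAlgHom, pow_iterate, ZMod.card]
  let ι : K →ₐ[ZMod p] L := IsScalarTower.toAlgHom (ZMod p) K L
  have hroot : ∀ x : K, ∃ z : L, z ^ p = z + ι x := by
    intro x
    obtain ⟨z, hz⟩ := IsAlgClosed.exists_root (artinSchreier p (ι x)) (by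
      rw [degree_eq_natDegree (artinSchreier_monic _).ne_zero, artinSchreier_natDegree]
      exact_mod_cast (Fact.out : p.Prime).ne_zero)
    refine ⟨z, ?_⟩
    rw [IsRoot, eval, eval₂_artinSchreier] at hz
    exact sub_eq_zero.mp hz
  choose z hz using hroot
  have hzi : ∀ (x : K) (i : ZMod p), (z x + algebraMap (ZMod p) L i) ^ p =
      z x + algebraMap (ZMod p) L i + ι x := by
    intro x i
    rw [add_pow_char, hz, ← map_pow, ZMod.pow_card, add_right_comm]
  let A := AdjoinRoot (artinSchreier p h)
  let Φ : (S →ₐ[ZMod p] K) × ZMod p → (A →ₐ[ZMod p] L) := fun x =>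
    AdjoinRoot.liftAlgHom _ (ι.comp x.1) (z (x.1 h) + algebraMap (ZMod p) L x.2) (by
      refine (eval₂_artinSchreier _ _ h).trans ?_
      rw [hzi]
      exact sub_self _)
  have hΦS : ∀ x s, Φ x (AdjoinRoot.of _ s) = ι (x.1 s) := fun x s => by apply AdjoinRoot.liftAlgHom_of
  have hΦr : ∀ x, Φ x (AdjoinRoot.root _) = z (x.1 h) + algebraMap (ZMod p) L x.2 :=
    fun x => by apply AdjoinRoot.liftAlgHom_root
  have hΦ : Function.Injective Φ := by
    intro x y hxy
    have h1 : x.1 = y.1 := by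
      ext s
      apply ι.injective
      exact (hΦS x s).symm.trans ((congrArg (fun f => f (AdjoinRoot.of _ s)) hxy).trans (hΦS y s))
    have h2 : x.2 = y.2 := by
      have h3 := hΦr x
      rw [hxy, hΦr, h1] at h3
      exact ((algebraMap (ZMod p) L).injective (add_left_cancel h3)).symm
    exact Prod.ext h1 h2
  set T := ((univ.filter fun φ : S →ₐ[ZMod p] K => Algebra.trace (ZMod p) K (φ h) = t) ×ˢ
    (univ : Finset (ZMod p))).image Φ with hT
  have hTc : T.card = p * (univ.filter fun φ : S →ₐ[ZMod p] K =>
      Algebra.trace (ZMod p) K (φ h) = t).card := by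
    rw [hT, card_image_of_injective _ hΦ, card_product, card_univ, ZMod.card, mul_comm]
  rw [← hTc]
  have hTσ : ∀ φ ∈ T, ∀ b, φ b ^ (p ^ e * p ^ e) = φ (σ b) := by
    intro φ hφ b
    obtain ⟨x, hx, rfl⟩ := mem_image.mp hφ
    have hxt := (mem_filter.mp (mem_product.mp hx).1).2
    have h1 : (τ.comp τ).comp (Φ x) = (Φ x).comp σ := by
      apply AlgHom.coe_ringHom_injective
      refine AdjoinRoot.ringHom_ext ?_ ?_
      · ext s
        change τ (τ (Φ x (AdjoinRoot.of _ s))) = Φ x (σ (AdjoinRoot.of _ s))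
        rw [hσ, hΦS, hτ, hτ, ← pow_mul, ← map_pow, ← hK, FiniteField.pow_card]
      · change τ (τ (Φ x (AdjoinRoot.root _))) = Φ x (σ (AdjoinRoot.root _))
        rw [hσr, map_add, AlgHom.commutes, hΦr, hτ, hτ, ← pow_mul, ← pow_add, ← two_mul,
          pow_prime_pow_eq (hzi _ _)]
        congr 1
        rw [← hxt]
        have := FiniteField.algebraMap_trace_eq_sum_pow (ZMod p) K (x.1 h)
        rw [Nat.card_eq_fintype_card, ZMod.card, he] at this
        rw [IsScalarTower.algebraMap_apply (ZMod p) K L, this]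
        simp [ι]
    have h2 := DFunLike.congr_fun h1 b
    simp only [AlgHom.comp_apply, hτ] at h2
    rw [← h2, ← pow_mul]
  have : Nontrivial A := AdjoinRoot.nontrivial _ (by
    rw [degree_eq_natDegree (artinSchreier_monic _).ne_zero, artinSchreier_natDegree]
    exact_mod_cast (Fact.out : p.Prime).ne_zero)
  refine (stepanov (O := O') (q := p ^ e) (r := 1) τ hτ (fun m n => ?_) rfl hq).trans_eq (by rw [one_mul])
  let ev : A →ₗ[ZMod p] (T → L) := LinearMap.pi fun φ => φ.1.toLinearMap
  have hfin := finiteDimensional_V (O := O') (m + n)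
  refine ⟨(O'.V (m + n)).map ev, inferInstance, ?_, fun a ha b hb => ?_⟩
  · rw [one_mul]
    exact (Submodule.finrank_map_le _ _).trans (finrank_le _)
  · refine ⟨a * σ b, ?_, ?_⟩
    · cases m with
      | zero =>
        rw [O'.V_zero, Submodule.mem_bot] at ha
        rw [ha, zero_mul]; exact zero_mem _
      | succ m => exact O'.mono (by omega) (O'.mul_mem ha (hσV n b hb))
    · ext φ
      rw [hTσ _ φ.2]
      simp [ev]

end ArtinSchreier

end PoleFiltration

end

section

open Module Finset Polynomial

section Curve

variable {F : Type} [Field F]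

/-- The polynomial `g(Y) - f(X)`, as a polynomial in `Y` over `F[X]`. -/
noncomputable def curvePoly (f g : F[X]) : F[X][X] := g.map C - C f

lemma curvePoly_monic (f : F[X]) {g : F[X]} (hg : g.Monic) (hk : 0 < g.natDegree) :
    (curvePoly f g).Monic := by
  refine (hg.map C).sub_of_left ?_
  rw [degree_map]
  exact degree_C_le.trans_lt (natDegree_pos_iff_degree_pos.mp hk)

lemma curvePoly_natDegree (f g : F[X]) : (curvePoly f g).natDegree = g.natDegree := by
  rw [curvePoly, natDegree_sub_C, natDegree_map]

lemma eval₂_curvePoly (f g : F[X]) {B : Type*} [CommRing B] [Algebra F B] (i : F[X] →ₐ[F] B)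
    (y : B) : (curvePoly f g).eval₂ (i : F[X] →+* B) y = aeval y g - i f := by
  rw [curvePoly, eval₂_sub, eval₂_C, eval₂_map, aeval_def]
  congr 2
  ext r
  exact i.commutes r

/-- The coordinate ring of the curve `g(Y) = f(X)`. -/
abbrev CurveRing (f g : F[X]) : Type := AdjoinRoot (curvePoly f g)

namespace CurveRing

variable {f g : F[X]}

/-- The coordinate function `X`. -/
noncomputable def x (f g : F[X]) : CurveRing f g := algebraMap F[X] (CurveRing f g) X

/-- The coordinate function `Y`. -/
noncomputable def y (f g : F[X]) : CurveRing f g := AdjoinRoot.root (curvePoly f g)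

lemma algebraMap_eq_aeval (s : F[X]) :
    algebraMap F[X] (CurveRing f g) s = aeval (x f g) s := by
  have : (IsScalarTower.toAlgHom F F[X] (CurveRing f g)) = aeval (x f g) := by
    ext; simp [x]
  exact DFunLike.congr_fun this s

lemma aeval_y : aeval (y f g) g = aeval (x f g) f := by
  have h := AdjoinRoot.eval₂_root (curvePoly f g)
  have h' := (eval₂_curvePoly f g (IsScalarTower.toAlgHom F F[X] (CurveRing f g)) (y f g))
  rw [← algebraMap_eq_aeval]
  exact sub_eq_zero.mp (h'.symm.trans h)

section Lift

variable {B : Type*} [CommRing B] [Algebra F B] {a b : B}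

/-- The homomorphism attached to a point of the curve. -/
noncomputable def lift (h : aeval b g = aeval a f) : CurveRing f g →ₐ[F] B :=
  AdjoinRoot.liftAlgHom _ (aeval a) b
    ((eval₂_curvePoly f g (aeval a) b).trans (sub_eq_zero.mpr h))

lemma lift_x (h : aeval b g = aeval a f) : lift h (x f g) = a := by
  have : lift h (AdjoinRoot.of (curvePoly f g) X) = aeval a (X : F[X]) := by apply AdjoinRoot.liftAlgHom_of
  rw [aeval_X] at this
  exact this

lemma lift_y (h : aeval b g = aeval a f) : lift h (y f g) = b := by
  apply AdjoinRoot.liftAlgHom_root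

lemma algHom_point (φ : CurveRing f g →ₐ[F] B) : aeval (φ (y f g)) g = aeval (φ (x f g)) f := by
  rw [aeval_algHom_apply, aeval_algHom_apply, aeval_y]

lemma algHom_ext {φ φ' : CurveRing f g →ₐ[F] B} (hx : φ (x f g) = φ' (x f g))
    (hy : φ (y f g) = φ' (y f g)) : φ = φ' := by
  apply AlgHom.coe_ringHom_injective
  refine AdjoinRoot.ringHom_ext ?_ hy
  ext1
  · ext r
    exact (φ.commutes r).trans (φ'.commutes r).symm
  · exact hx

end Lift

open PoleFiltration in
theorem exists_poleFiltration (hg : g.Monic) (hk : 2 ≤ g.natDegree) (hj : 0 < f.natDegree)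
    (hjk : Nat.Coprime f.natDegree g.natDegree) :
    ∃ O : PoleFiltration F (CurveRing f g), O.gap = f.natDegree * g.natDegree ∧
      O.HasDeg (x f g) g.natDegree ∧ O.HasDeg (y f g) f.natDegree ∧
      ∀ n, ∀ u ∈ O.V n, ∃ s : ℕ → F[X],
        u = ∑ b ∈ range g.natDegree, aeval (x f g) (s b) * y f g ^ b ∧
        ∀ b < g.natDegree, ∀ i ≤ b, aeval (x f g) (s b) * y f g ^ i ∈ O.V n := by
  let pb : PowerBasis F[X] (CurveRing f g) :=
    AdjoinRoot.powerBasis' (curvePoly_monic f hg (by omega))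
  have hdim : pb.dim = g.natDegree := by
    rw [AdjoinRoot.powerBasis'_dim, curvePoly_natDegree]
  have hgen : pb.gen = y f g := AdjoinRoot.powerBasis'_gen _
  have hcop : Nat.Coprime f.natDegree pb.dim := by rwa [hdim]
  have hf0 : f ≠ 0 := by rintro rfl; simp at hj
  have hfd : (polynomial F).HasDeg f f.natDegree := polynomial_hasDeg hf0
  have hr : pb.gen ^ pb.dim = algebraMap F[X] (CurveRing f g) f -
      ∑ i : Fin pb.dim, g.coeff i • pb.gen ^ (i : ℕ) := by
    have h := aeval_y (f := f) (g := g)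
    rw [aeval_eq_sum_range, sum_range_succ, hg.coeff_natDegree, one_smul] at h
    rw [algebraMap_eq_aeval, ← h, hgen, Fin.sum_univ_eq_sum_range
      (fun i => g.coeff i • y f g ^ i), hdim, add_sub_cancel_left]
  have hk0 : 0 < pb.dim := by omega
  have hk1 : 1 < pb.dim := by omega
  let O := tower (polynomial F) pb f.natDegree hk0 hcop hj hfd hr
  have hx : O.HasDeg (x f g) g.natDegree := by
    have := tower_hasDeg_algebraMap hk0 hcop hj hfd hr
      (polynomial_hasDeg (F := F) X_ne_zero)
    have h2 : pb.dim * (X : F[X]).natDegree = g.natDegree := by rw [natDegree_X, mul_one, hdim]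
    exact h2 ▸ this
  have hy : O.HasDeg (y f g) f.natDegree := by
    rw [← hgen]; exact tower_hasDeg_gen hk1 hcop hj hfd hr
  refine ⟨O, ?_, hx, hy, fun n u hu => ?_⟩
  · change f.natDegree * pb.dim + pb.dim * 0 = _
    rw [hdim, mul_zero, add_zero]
  · have : Nontrivial (CurveRing f g) := ⟨⟨_, _, hy.ne_zero⟩⟩
    refine ⟨fun b => if hb : b < pb.dim then pb.basis.repr u ⟨b, hb⟩ else 0, ?_, ?_⟩
    · rw [← hdim, ← Fin.sum_univ_eq_sum_range (fun b => aeval (x f g)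
        (if hb : b < pb.dim then pb.basis.repr u ⟨b, hb⟩ else 0) * y f g ^ b)]
      conv_lhs => rw [eq_sum_smul_pow (pb := pb) u]
      refine sum_congr rfl fun b _ => ?_
      rw [dif_pos b.2, Algebra.smul_def, algebraMap_eq_aeval, hgen]
    · intro b hb i hi
      rw [← hdim] at hb
      simp only [dif_pos hb]
      have h1 : aeval (x f g) (pb.basis.repr u ⟨b, hb⟩) * y f g ^ b ∈ O.V n := by
        rw [← algebraMap_eq_aeval, ← Algebra.smul_def, ← hgen]
        rcases exists_smul_pow_of_mem hu ⟨b, hb⟩ with h0 | ⟨d, hd, h⟩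
        · rw [h0, zero_smul]; exact zero_mem _
        · exact smul_pow_mem hd ⟨b, hb⟩ h
      by_contra hcon
      refine O.mul_notMem hcon (n := 0) (v := y f g ^ (b - i)) ?_ ?_
      · exact notMem_zero (hy.pow _).ne_zero
      · rwa [mul_assoc, ← pow_add, Nat.add_sub_cancel' hi]

end CurveRing

end Curve

end

section

open Module Finset Polynomial

/-- Two distinct points in a fibre of a monic polynomial: the divided difference vanishes. -/
lemma pow_eq_neg_sum_of_aeval_eq {F L : Type*} [Field F] [Field L] [Algebra F L] {g : F[X]}
    (hg : g.Monic) (hk : 0 < g.natDegree) {y y' : L} (hne : y' ≠ y) (h : aeval y' g = aeval y g) :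
    y' ^ (g.natDegree - 1) = - ∑ i ∈ range (g.natDegree - 1),
      (∑ l ∈ Icc (i + 1) g.natDegree, y ^ (l - (i + 1)) * algebraMap F L (g.coeff l)) * y' ^ i := by
  set P := g.map (algebraMap F L) with hP
  have hPn : P.natDegree = g.natDegree := natDegree_map _
  have hPm : P.Monic := hg.map _
  have h1 : P /ₘ (X - C y) * (X - C y) + C (P.eval y) = P := by
    rw [mul_comm, ← modByMonic_X_sub_C_eq_C_eval, add_comm]
    exact modByMonic_add_div P (X - C y)
  have h2 : (P /ₘ (X - C y)).eval y' = 0 := by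
    have h3 := congrArg (eval y') h1
    rw [eval_add, eval_mul, eval_sub, eval_X, eval_C, eval_C, hP, eval_map_algebraMap, eval_map_algebraMap, h,
      add_eq_right] at h3
    exact (mul_eq_zero.mp h3).resolve_right (sub_ne_zero.mpr hne)
  have h3 : (P /ₘ (X - C y)).natDegree = g.natDegree - 1 := by
    rw [natDegree_divByMonic _ (monic_X_sub_C y), natDegree_X_sub_C, hPn]
  have h4 : (P /ₘ (X - C y)).coeff (g.natDegree - 1) = 1 := by
    rw [coeff_divByMonic_X_sub_C, Nat.sub_add_cancel hk, hPn, Icc_self, sum_singleton, Nat.sub_self,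
      pow_zero, one_mul, ← hPn, hPm.coeff_natDegree]
  rw [eval_eq_sum_range, h3, sum_range_succ, h4, one_mul, add_comm] at h2
  rw [eq_neg_of_add_eq_zero_left h2]
  congr 1
  refine sum_congr rfl fun i _ => ?_
  rw [coeff_divByMonic_X_sub_C, hPn]
  simp only [hP, coeff_map]

namespace PoleFiltration

/-- Homomorphisms out of `A` extend to an overring whose conductor they do not annihilate. -/
lemma exists_extend_algHom {F A S K : Type*} [Field F] [CommRing A] [CommRing S] [Algebra F A]
    [Algebra F S] [Algebra A S] [IsScalarTower F A S] [Field K] [Algebra F K]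
    (hinj : Function.Injective (algebraMap A S)) {c : A}
    (hS : ∀ s : S, ∃ a, algebraMap A S a = algebraMap A S c * s) (φ : A →ₐ[F] K) (hφ : φ c ≠ 0) :
    ∃ φ' : S →ₐ[F] K, ∀ a, φ' (algebraMap A S a) = φ a := by
  choose a ha using hS
  have hmap : ∀ b, a (algebraMap A S b) = c * b := fun b => hinj (by rw [ha, map_mul])
  have hval : ∀ b, φ (a (algebraMap A S b)) / φ c = φ b := fun b => by
    rw [hmap, map_mul, mul_div_cancel_left₀ _ hφ]
  refine ⟨{ toFun := fun s => φ (a s) / φ c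
            map_one' := ?_
            map_mul' := fun s t => ?_
            map_zero' := ?_
            map_add' := fun s t => ?_
            commutes' := fun r => ?_ }, hval⟩
  · rw [← map_one (algebraMap A S), hval, map_one]
  · have h1 : c * a (s * t) = a s * a t := by
      apply hinj
      rw [map_mul, map_mul, ha, ha, ha]
      ring
    have h2 := congrArg φ h1
    rw [map_mul, map_mul] at h2
    field_simp
    rw [mul_comm, h2]
  · rw [← map_zero (algebraMap A S), hval, map_zero]
  · have h1 : a (s + t) = a s + a t := by
      apply hinj
      rw [map_add, ha, ha, ha]
      ring
    rw [h1, map_add, add_div]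
  · rw [IsScalarTower.algebraMap_apply F A S, hval, φ.commutes]

end PoleFiltration

namespace CurveRing

variable {p : ℕ} [Fact p.Prime] {f g : (ZMod p)[X]}

lemma aeval_pow_pow {L : Type*} [Field L] [Algebra (ZMod p) L] (x : L) (n : ℕ) (s : (ZMod p)[X]) :
    aeval x s ^ p ^ n = aeval (x ^ p ^ n) s := by
  let τ : L →ₐ[ZMod p] L := FiniteField.frobeniusAlgHom (ZMod p) L ^ n
  have hτ : ∀ x, τ x = x ^ p ^ n := by
    intro x
    rw [AlgHom.coe_pow, FiniteField.coe_frobeniusAlgHom, pow_iterate, ZMod.card]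
  rw [← hτ, ← hτ, aeval_algHom_apply]

open PoleFiltration in
/-- Stepanov's bound for the points with rational abscissa and irrational ordinate. -/
theorem card_irrational_le (hg : g.Monic) (hk : 2 ≤ g.natDegree) (hj : 0 < f.natDegree)
    (hjk : Nat.Coprime f.natDegree g.natDegree) :
    ∃ c q₁ : ℕ, ∀ (L : Type) [Field L] [Algebra (ZMod p) L] (e : ℕ), q₁ < p ^ e →
      ∀ T : Finset (CurveRing f g →ₐ[ZMod p] L),
        (∀ φ ∈ T, φ (x f g) ^ (p ^ e * p ^ e) = φ (x f g) ∧
          φ (y f g) ^ (p ^ e * p ^ e) ≠ φ (y f g)) →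
        T.card ≤ p ^ e * ((g.natDegree - 1) * p ^ e + c) := by
  obtain ⟨O, -, hx, hy, hO⟩ := exists_poleFiltration hg hk hj hjk
  set k := g.natDegree with hkdef
  refine ⟨O.gap + (k - 1) * O.gap + (k - 1) ^ 2 + 1,
    (O.gap + (k - 1)) * (O.gap + (k - 1) * O.gap + (k - 1) ^ 2 + 1 + 1), ?_⟩
  intro L _ _ e hq T hT
  let τ : L →ₐ[ZMod p] L := FiniteField.frobeniusAlgHom (ZMod p) L ^ e
  have hτ : ∀ x, τ x = x ^ p ^ e := by
    intro x
    rw [AlgHom.coe_pow, FiniteField.coe_frobeniusAlgHom, pow_iterate, ZMod.card]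
  have : Nontrivial (CurveRing f g) := ⟨⟨_, _, hy.ne_zero⟩⟩
  refine stepanov (O := O) (q := p ^ e) (r := k - 1) τ hτ (fun m n => ?_) rfl hq
  let Λ : (Fin (k - 1) → O.V (m + n)) →ₗ[ZMod p] (T → L) := LinearMap.pi fun φ => ∑ i : Fin (k - 1),
    LinearMap.mulRight (ZMod p) (φ.1 (y f g) ^ (p ^ e * p ^ e * i)) ∘ₗ φ.1.toLinearMap ∘ₗ
      (O.V (m + n)).subtype ∘ₗ LinearMap.proj i
  have hΛ : ∀ u φ, Λ u φ = ∑ i : Fin (k - 1), φ.1 (u i) * φ.1 (y f g) ^ (p ^ e * p ^ e * i) := by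
    intro u φ
    simp [Λ]
  refine ⟨LinearMap.range Λ, inferInstance, ?_, fun a ha b hb => ?_⟩
  · refine (LinearMap.finrank_range_le Λ).trans ?_
    rw [Module.finrank_pi_fintype, sum_const, card_univ, Fintype.card_fin, smul_eq_mul]
    exact Nat.mul_le_mul_left _ (finrank_le _)
  · have hmul : ∀ v ∈ O.V n, a * v ∈ O.V (m + n) := by
      intro v hv
      cases m with
      | zero =>
        rw [O.V_zero, Submodule.mem_bot] at ha
        rw [ha, zero_mul]; exact zero_mem _
      | succ m => exact O.mono (by omega) (O.mul_mem ha hv)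
    have hsingle : ∀ i < k - 1, ∀ v ∈ O.V n, (fun φ : T => φ.1 (a * v) *
        φ.1 (y f g) ^ (p ^ e * p ^ e * i)) ∈ LinearMap.range Λ := by
      intro i hi v hv
      refine ⟨Pi.single ⟨i, hi⟩ ⟨a * v, hmul v hv⟩, ?_⟩
      ext φ
      rw [hΛ, sum_eq_single (⟨i, hi⟩ : Fin (k - 1))]
      · simp
      · intro i' _ hi'
        rw [Pi.single_eq_of_ne hi']
        simp
      · simp
    obtain ⟨s, hs, hsV⟩ := hO n b hb
    have hsum : (fun φ : T => φ.1 a * φ.1 b ^ (p ^ e * p ^ e)) = ∑ i ∈ range k, fun φ : T =>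
        φ.1 (a * aeval (x f g) (s i)) * φ.1 (y f g) ^ (p ^ e * p ^ e * i) := by
      ext φ
      rw [Finset.sum_apply, ← pow_add]
      have h1 : φ.1 b ^ p ^ (e + e) = ∑ i ∈ range k, φ.1 (aeval (x f g) (s i)) *
          φ.1 (y f g) ^ (p ^ (e + e) * i) := by
        have : CharP L p := charP_of_injective_algebraMap (algebraMap (ZMod p) L).injective p
        rw [hs, map_sum, sum_pow_char_pow]
        refine sum_congr rfl fun i _ => ?_
        rw [map_mul, map_pow, mul_pow, ← pow_mul, mul_comm i, ← aeval_algHom_apply,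
          aeval_pow_pow, pow_add, (hT φ.1 φ.2).1]
      rw [h1, mul_sum]
      exact sum_congr rfl fun i _ => by rw [map_mul, mul_assoc]
    obtain ⟨k', hk'⟩ : ∃ k', k' = k - 1 := ⟨_, rfl⟩
    have hkk : k = k' + 1 := by omega
    have hsplit : ∀ u : ℕ → T → L, ∑ i ∈ range k, u i = ∑ i ∈ range (k - 1), u i + u (k - 1) := by
      intro u
      rw [← hk', hkk, sum_range_succ]
    rw [hsum, hsplit]
    refine add_mem (Submodule.sum_mem _ fun i hi => ?_) ?_
    · have hi' := mem_range.mp hi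
      have := hsV i (by omega) 0 (Nat.zero_le _)
      rw [pow_zero, mul_one] at this
      exact hsingle i hi' _ this
    · have htop : (fun φ : T => φ.1 (a * aeval (x f g) (s (k - 1))) *
          φ.1 (y f g) ^ (p ^ e * p ^ e * (k - 1))) = - ∑ i ∈ range (k - 1),
          ∑ l ∈ Icc (i + 1) k, g.coeff l • fun φ : T =>
            φ.1 (a * (aeval (x f g) (s (k - 1)) * y f g ^ (l - (i + 1)))) *
              φ.1 (y f g) ^ (p ^ e * p ^ e * i) := by
        ext φ
        have hfib : aeval (φ.1 (y f g) ^ (p ^ e * p ^ e)) g = aeval (φ.1 (y f g)) g := by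
          rw [algHom_point, ← pow_add, ← aeval_pow_pow, algHom_point, aeval_pow_pow, pow_add,
            (hT φ.1 φ.2).1]
        have h1 := pow_eq_neg_sum_of_aeval_eq hg (by omega) (hT φ.1 φ.2).2 hfib
        rw [← hkdef] at h1
        rw [pow_mul]
        rw [h1, mul_neg, Pi.neg_apply, Finset.sum_apply, mul_sum]
        congr 1
        refine sum_congr rfl fun i _ => ?_
        rw [Finset.sum_apply, ← mul_assoc, mul_sum, sum_mul]
        refine sum_congr rfl fun l _ => ?_
        rw [Pi.smul_apply, Algebra.smul_def, map_mul, map_mul, map_mul, map_pow, ← pow_mul]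
        ring
      rw [htop]
      refine neg_mem (Submodule.sum_mem _ fun i hi => Submodule.sum_mem _ fun l hl => ?_)
      refine Submodule.smul_mem _ _ (hsingle i (mem_range.mp hi) _ (hsV _ (by omega) _ ?_))
      have := (mem_Icc.mp hl).2
      omega

end CurveRing

end

section

open Module Finset Polynomial

lemma exists_algebraMap_eq_of_pow_card {K L : Type*} [Field K] [Fintype K] [Field L] [Algebra K L]
    {y : L} (hy : y ^ Fintype.card K = y) : ∃ a, algebraMap K L a = y := by
  classical
  by_contra! hcon
  have hq := Fintype.one_lt_card (α := K)
  have h0 : (X ^ Fintype.card K - X : L[X]) ≠ 0 := FiniteField.X_pow_card_sub_X_ne_zero L hq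
  have hsub : (insert y (univ.image (algebraMap K L))).val ⊆ (X ^ Fintype.card K - X : L[X]).roots := by
    intro b hb
    rw [mem_roots h0, IsRoot.def, eval_sub, eval_pow, eval_X, sub_eq_zero]
    rcases mem_insert.mp hb with rfl | hb
    · exact hy
    · obtain ⟨a, -, rfl⟩ := mem_image.mp hb
      rw [← map_pow, FiniteField.pow_card]
  have h1 := card_le_degree_of_subset_roots hsub
  rw [FiniteField.X_pow_card_sub_X_natDegree_eq L hq, card_insert_of_notMem (by simpa using hcon),
    card_image_of_injective _ (algebraMap K L).injective, card_univ] at h1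
  omega

lemma card_fibre_of_derivative_ne_zero {F L : Type*} [Field F] [Field L] [IsAlgClosed L]
    [DecidableEq L] [Algebra F L] {g : F[X]} (hk : 0 < g.natDegree) (v : L)
    (h : ∀ b : L, aeval b g = v → aeval b (derivative g) ≠ 0) :
    (g.map (algebraMap F L) - C v).roots.toFinset.card = g.natDegree := by
  have hn : (g.map (algebraMap F L) - C v).natDegree = g.natDegree := by
    rw [natDegree_sub_C, natDegree_map]
  have h0 : g.map (algebraMap F L) - C v ≠ 0 := by
    intro h0
    rw [h0, natDegree_zero] at hn
    omega
  rw [Multiset.toFinset_card_of_nodup, IsAlgClosed.card_roots_eq_natDegree, hn]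
  refine Multiset.nodup_iff_count_le_one.mpr fun b => ?_
  rw [count_roots]
  by_contra! hcon
  obtain ⟨h1, h2⟩ := (one_lt_rootMultiplicity_iff_isRoot h0).mp hcon
  rw [IsRoot.def, eval_sub, eval_C, eval_map_algebraMap, sub_eq_zero] at h1
  rw [derivative_sub, derivative_C, sub_zero, derivative_map, IsRoot.def, eval_map_algebraMap] at h2
  exact h b h1 h2

namespace CurveRing

lemma exists_finset_algHom {F K L : Type} [Field F] [Field K] [Field L] [Algebra F L] [Algebra F K]
    {f g : F[X]} (ι : K →ₐ[F] L)
    (Z : Finset (K × L)) (hZ : ∀ z ∈ Z, aeval z.2 g = aeval (ι z.1) f) :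
    ∃ T : Finset (CurveRing f g →ₐ[F] L), T.card = Z.card ∧
      ∀ φ ∈ T, ∃ z ∈ Z, φ (x f g) = ι z.1 ∧ φ (y f g) = z.2 := by
  classical
  refine ⟨Z.attach.image fun z => lift (hZ z.1 z.2), ?_, ?_⟩
  · rw [card_image_of_injective, card_attach]
    intro z z' h
    apply Subtype.ext
    refine Prod.ext ?_ ?_
    · apply ι.injective
      have := DFunLike.congr_fun h (x f g)
      rwa [lift_x, lift_x] at this
    · have := DFunLike.congr_fun h (y f g)
      rwa [lift_y, lift_y] at this
  · intro φ hφ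
    obtain ⟨z, -, rfl⟩ := mem_image.mp hφ
    exact ⟨z.1, z.2, lift_x _, lift_y _⟩

variable {p : ℕ} [Fact p.Prime] {f g : (ZMod p)[X]}

open PoleFiltration in
/-- Lower bound for the number of points of the normalized curve over a field of square order. -/
theorem le_card_algHom (hg : g.Monic) (hk : 2 ≤ g.natDegree) (hj : 0 < f.natDegree)
    (hjk : Nat.Coprime f.natDegree g.natDegree) (hder : derivative g ≠ 0)
    {S : Type} [CommRing S] [Algebra (ZMod p) S] [Algebra (CurveRing f g) S]
    [IsScalarTower (ZMod p) (CurveRing f g) S]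
    (hinj : Function.Injective (algebraMap (CurveRing f g) S))
    (hS : ∀ s : S, ∃ a, algebraMap (CurveRing f g) S a =
      algebraMap (CurveRing f g) S (aeval (y f g) (derivative g)) * s) :
    ∃ c q₁ : ℕ, ∀ (K : Type) [Field K] [Algebra (ZMod p) K] [FiniteDimensional (ZMod p) K]
      [Fintype (S →ₐ[ZMod p] K)] (e : ℕ), finrank (ZMod p) K = 2 * e → q₁ < p ^ e →
      p ^ e * p ^ e ≤ Fintype.card (S →ₐ[ZMod p] K) + c * p ^ e := by
  classical
  obtain ⟨c, q₁, hc⟩ := card_irrational_le hg hk hj hjk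
  obtain ⟨O, -, hx, hy, -⟩ := exists_poleFiltration hg hk hj hjk
  have : Nontrivial (CurveRing f g) := ⟨⟨_, _, hy.ne_zero⟩⟩
  set k := g.natDegree with hkdef
  obtain ⟨d, hd⟩ := exists_hasDeg (O := O) (hy.aeval hj hder).ne_zero
  refine ⟨c + d + k * d, q₁, ?_⟩
  intro K _ _ _ _ e he hq
  have : Finite K := Module.finite_of_finite (ZMod p)
  have := Fintype.ofFinite K
  have hK : Fintype.card K = p ^ e * p ^ e := by
    rw [Module.card_eq_pow_finrank (K := ZMod p), he, ZMod.card, two_mul, pow_add]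
  let L := AlgebraicClosure K
  let ι : K →ₐ[ZMod p] L := IsScalarTower.toAlgHom (ZMod p) K L
  have hιQ : ∀ a : K, ι a ^ (p ^ e * p ^ e) = ι a := by
    intro a
    rw [← map_pow, ← hK, FiniteField.pow_card]
  let P : K → L[X] := fun a => g.map (algebraMap (ZMod p) L) - C (aeval (ι a) f)
  have hmem : ∀ a b, b ∈ (P a).roots.toFinset ↔ aeval b g = aeval (ι a) f := by
    intro a b
    have h0 : P a ≠ 0 := by
      intro h0
      have hn : (P a).natDegree = k := by
        simp only [P]
        rw [natDegree_sub_C, natDegree_map]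
      rw [h0, natDegree_zero] at hn
      omega
    rw [Multiset.mem_toFinset, mem_roots h0, IsRoot.def, eval_sub, eval_C, eval_map_algebraMap,
      sub_eq_zero]
  let Z : Finset (K × L) := univ.biUnion fun a => (P a).roots.toFinset.image fun b => (a, b)
  have hZ : ∀ z, z ∈ Z ↔ aeval z.2 g = aeval (ι z.1) f := by
    rintro ⟨a, b⟩
    simp only [Z, mem_biUnion, mem_univ, true_and, mem_image, Prod.mk.injEq]
    rw [← hmem]
    constructor
    · rintro ⟨a', b', h, rfl, rfl⟩
      exact h
    · intro h
      exact ⟨a, b, h, rfl, rfl⟩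
  have hramified : ∀ Y ⊆ Z, (∀ z ∈ Y, aeval z.2 (derivative g) = 0) → Y.card ≤ d := by
    intro Y hYZ hY
    obtain ⟨T, hT, hTY⟩ := exists_finset_algHom ι Y fun z hz => (hZ z).mp (hYZ hz)
    rw [← hT]
    refine card_zeros_le hd fun φ hφ => ?_
    obtain ⟨z, hz, -, hzy⟩ := hTY φ hφ
    rw [← aeval_algHom_apply, hzy, hY z hz]
  have hZcard : k * (p ^ e * p ^ e) ≤ Z.card + k * d := by
    let G : Finset K := univ.filter fun a => ∀ b : L, aeval b g = aeval (ι a) f →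
      aeval b (derivative g) ≠ 0
    have hbad : (univ.filter fun a => ¬ ∀ b : L, aeval b g = aeval (ι a) f →
        aeval b (derivative g) ≠ 0).card ≤ d := by
      have hex : ∀ a : K, ∃ b : L, (¬ ∀ b : L, aeval b g = aeval (ι a) f →
        aeval b (derivative g) ≠ 0) → aeval b g = aeval (ι a) f ∧ aeval b (derivative g) = 0 := by
        intro a
        by_cases h : ∀ b : L, aeval b g = aeval (ι a) f → aeval b (derivative g) ≠ 0
        · exact ⟨0, fun h' => absurd h h'⟩
        · push Not at h
          obtain ⟨b, hb⟩ := h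
          exact ⟨b, fun _ => hb⟩
      choose b hb using hex
      rw [← card_image_of_injective (f := fun a => (a, b a)) _ fun a a' h => congrArg Prod.fst h]
      refine hramified _ ?_ ?_
      · intro z hz
        obtain ⟨a, ha, rfl⟩ := mem_image.mp hz
        exact (hZ _).mpr (hb a (mem_filter.mp ha).2).1
      · intro z hz
        obtain ⟨a, ha, rfl⟩ := mem_image.mp hz
        exact (hb a (mem_filter.mp ha).2).2
    have hG : p ^ e * p ^ e ≤ G.card + d := by
      have h1 := card_filter_add_card_filter_not (s := (univ : Finset K))
        (fun a => ∀ b : L, aeval b g = aeval (ι a) f → aeval b (derivative g) ≠ 0)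
      rw [card_univ, hK] at h1
      rw [← h1]
      exact Nat.add_le_add_left hbad _
    have hGZ : G.card * k ≤ Z.card := by
      rw [card_biUnion]
      · calc G.card * k = ∑ a ∈ G, ((P a).roots.toFinset.image fun b => (a, b)).card := by
              rw [← smul_eq_mul, ← sum_const]
              refine sum_congr rfl fun a ha => ?_
              rw [card_image_of_injective _ fun b b' h => congrArg Prod.snd h]
              exact (card_fibre_of_derivative_ne_zero (by omega) _ (mem_filter.mp ha).2).symm
          _ ≤ _ := sum_le_sum_of_subset (subset_univ _)
      · intro a _ a' _ haa'
        refine Finset.disjoint_left.mpr fun z hz hz' => haa' ?_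
        obtain ⟨b, -, rfl⟩ := mem_image.mp hz
        obtain ⟨b', -, h⟩ := mem_image.mp hz'
        exact (congrArg Prod.fst h).symm
    nlinarith
  have hirr : (Z.filter fun z => ¬ z.2 ^ (p ^ e * p ^ e) = z.2).card ≤
      p ^ e * ((k - 1) * p ^ e + c) := by
    obtain ⟨T, hT, hTY⟩ := exists_finset_algHom ι (Z.filter fun z => ¬ z.2 ^ (p ^ e * p ^ e) = z.2)
      fun z hz => (hZ z).mp (mem_filter.mp hz).1
    rw [← hT]
    refine hc L e hq T fun φ hφ => ?_
    obtain ⟨z, hz, hzx, hzy⟩ := hTY φ hφ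
    rw [hzx, hzy]
    exact ⟨hιQ _, (mem_filter.mp hz).2⟩
  have hrat : (Z.filter fun z => z.2 ^ (p ^ e * p ^ e) = z.2).card ≤
      Fintype.card (S →ₐ[ZMod p] K) + d := by
    rw [← card_filter_add_card_filter_not (s := Z.filter fun z => z.2 ^ (p ^ e * p ^ e) = z.2)
      (fun z => aeval z.2 (derivative g) ≠ 0)]
    refine Nat.add_le_add ?_ (hramified _ ?_ fun z hz => ?_)
    · rw [← card_univ]
      have hex : ∀ z ∈ (Z.filter fun z => z.2 ^ (p ^ e * p ^ e) = z.2).filter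
          (fun z => aeval z.2 (derivative g) ≠ 0), ∃ φ : S →ₐ[ZMod p] K,
          φ (algebraMap _ S (x f g)) = z.1 ∧ ι (φ (algebraMap _ S (y f g))) = z.2 := by
        intro z hz
        obtain ⟨hz1, hz2⟩ := mem_filter.mp hz
        obtain ⟨hz1, hz3⟩ := mem_filter.mp hz1
        rw [← hK] at hz3
        obtain ⟨b, hb⟩ := exists_algebraMap_eq_of_pow_card hz3
        have hb' : ι b = z.2 := hb
        have hpt : aeval b g = aeval z.1 f := by
          apply ι.injective
          have := (hZ z).mp hz1
          rw [← hb', aeval_algHom_apply, aeval_algHom_apply] at this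
          exact this
        obtain ⟨φ, hφ⟩ := exists_extend_algHom hinj hS (lift hpt) (by
          rw [← aeval_algHom_apply, lift_y]
          intro h0
          apply hz2
          rw [← hb', aeval_algHom_apply, h0, map_zero])
        exact ⟨φ, by rw [hφ, lift_x], by rw [hφ, lift_y, hb']⟩
      choose Φ hΦ using hex
      rw [← card_attach]
      refine card_le_card_of_injOn (fun z => Φ z.1 z.2) (fun _ _ => mem_univ _) ?_
      intro z _ z' _ h
      have h : Φ z.1 z.2 = Φ z'.1 z'.2 := h
      refine Subtype.ext (Prod.ext ?_ ?_)
      · rw [← (hΦ z.1 z.2).1, ← (hΦ z'.1 z'.2).1, h]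
      · rw [← (hΦ z.1 z.2).2, ← (hΦ z'.1 z'.2).2, h]
    · exact (filter_subset _ _).trans (filter_subset _ _)
    · simpa using (mem_filter.mp hz).2
  have htot := card_filter_add_card_filter_not (s := Z) (fun z => z.2 ^ (p ^ e * p ^ e) = z.2)
  have hpe : 1 ≤ p ^ e := Nat.one_le_pow _ _ (Fact.out : p.Prime).pos
  obtain ⟨k', hk'⟩ : ∃ k', k = k' + 1 := ⟨k - 1, by omega⟩
  rw [hk', Nat.add_sub_cancel] at hirr
  rw [hk'] at hZcard ⊢
  nlinarith [Nat.zero_le d, Nat.zero_le k', Nat.mul_le_mul_left d hpe, Nat.mul_le_mul_left (k' * d) hpe]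

end CurveRing

end

section

open Module Finset Polynomial

variable {p : ℕ} [Fact p.Prime]

/-- A character sum over a nearly equidistributed family. -/
lemma norm_sum_addChar_le {Φ : Type*} [Fintype Φ] (τ : Φ → ZMod p) {ψ : AddChar (ZMod p) ℂ}
    (hψ : ψ ≠ 1) {B : ℝ} (hB : ∀ t, p * ((univ.filter fun φ => τ φ = t).card : ℝ) ≤ B) :
    ‖∑ φ, ψ (τ φ)‖ ≤ B - Fintype.card Φ := by
  have hp : (0 : ℝ) < p := by exact_mod_cast (Fact.out : p.Prime).pos
  have hsum : ∑ t, ψ t = 0 := AddChar.sum_eq_zero_of_ne_one hψ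
  have h1 : ∑ φ, ψ (τ φ) =
      ∑ t, (((univ.filter fun φ => τ φ = t).card : ℝ) - B / p : ℝ) * ψ t := by
    rw [← sum_fiberwise univ τ fun φ => ψ (τ φ)]
    simp only [Complex.ofReal_sub, sub_mul, sum_sub_distrib, ← mul_sum, hsum, mul_zero, sub_zero]
    refine sum_congr rfl fun t _ => ?_
    rw [sum_congr rfl fun φ hφ => by rw [(mem_filter.mp hφ).2], sum_const, nsmul_eq_mul]
    push_cast
    rfl
  have h2 : ∀ t, ‖((((univ.filter fun φ => τ φ = t).card : ℝ) - B / p : ℝ) : ℂ) * ψ t‖ =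
      B / p - (univ.filter fun φ => τ φ = t).card := by
    intro t
    rw [norm_mul, AddChar.norm_apply, mul_one, Complex.norm_real, Real.norm_eq_abs,
      abs_of_nonpos, neg_sub]
    rw [sub_nonpos, le_div_iff₀ hp, mul_comm]
    exact hB t
  have h3 : ∑ t, ((univ.filter fun φ => τ φ = t).card : ℝ) = Fintype.card Φ := by
    rw [← Nat.cast_sum, ← card_eq_sum_card_fiberwise (fun _ _ => mem_coe.mpr (mem_univ _)),
      card_univ]
  rw [h1]
  refine (norm_sum_le _ _).trans_eq ?_
  rw [sum_congr rfl fun t _ => h2 t, sum_sub_distrib, h3, sum_const, card_univ, ZMod.card,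
    nsmul_eq_mul, mul_div_cancel₀ _ hp.ne']

lemma card_le_of_forall_card_fibre_le {Φ : Type*} [Fintype Φ] (τ : Φ → ZMod p) {B : ℕ}
    (hB : ∀ t, p * (univ.filter fun φ => τ φ = t).card ≤ B) : Fintype.card Φ ≤ B := by
  have hp := (Fact.out : p.Prime).pos
  refine le_of_mul_le_mul_left (a := p) ?_ hp
  calc p * Fintype.card Φ = ∑ t, p * (univ.filter fun φ => τ φ = t).card := by
        rw [← mul_sum, ← card_eq_sum_card_fiberwise (fun _ _ => mem_coe.mpr (mem_univ _)),
          card_univ]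
    _ ≤ ∑ _t : ZMod p, B := sum_le_sum fun t _ => hB t
    _ = p * B := by simp [ZMod.card]

namespace PoleFiltration

variable {S : Type} [CommRing S] [IsDedekindDomain S] [Algebra (ZMod p) S]

/-- Square root cancellation, with an unspecified constant, over large fields of square order. -/
theorem norm_primePowerSum_le (O : PoleFiltration (ZMod p) S) {x : S} {k : ℕ}
    (hx : O.HasDeg x k) (hk : ¬ p ∣ k)
    (hS : ∃ c q₁ : ℕ, ∀ (K : Type) [Field K] [Algebra (ZMod p) K] [FiniteDimensional (ZMod p) K]
      [Fintype (S →ₐ[ZMod p] K)] (e : ℕ), finrank (ZMod p) K = 2 * e → q₁ < p ^ e →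
      p ^ e * p ^ e ≤ Fintype.card (S →ₐ[ZMod p] K) + c * p ^ e) :
    (∃ (C : ℝ) (e₀ : ℕ), ∀ e ≥ e₀, ∀ ψ,
      ‖primePowerSum O ψ 0 (2 * e) - (p : ℂ) ^ (2 * e)‖ ≤ C * (p : ℝ) ^ e) ∧
    ∀ (h : S) (d : ℕ), O.HasDeg h d → ¬ p ∣ d → ∃ (C : ℝ) (e₀ : ℕ), ∀ e ≥ e₀, ∀ ψ, ψ ≠ 1 →
      ‖primePowerSum O ψ h (2 * e)‖ ≤ C * (p : ℝ) ^ e := by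
  classical
  obtain ⟨c, q, hc⟩ := hS
  have key : ∀ (h : S) (d : ℕ), O.HasDeg h d → ¬ p ∣ d → ∃ (C e₀ : ℕ), ∀ e ≥ e₀, 0 < e ∧
      ∃ (_ : Fintype (S →ₐ[ZMod p] GaloisField p (2 * e))),
      (∀ t, p * (univ.filter fun φ : S →ₐ[ZMod p] GaloisField p (2 * e) =>
        Algebra.trace (ZMod p) _ (φ h) = t).card ≤ p ^ e * (p ^ e + C)) ∧
      p ^ e * p ^ e ≤ Fintype.card (S →ₐ[ZMod p] GaloisField p (2 * e)) + c * p ^ e := by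
    intro h d hh hd
    obtain ⟨C, q₁, hC⟩ := card_trace_eq_le O hh hd
    refine ⟨C, q + q₁ + 1, fun e he => ⟨by omega, ?_⟩⟩
    have := finite_algHom O (GaloisField p (2 * e))
    have hfin := Fintype.ofFinite (S →ₐ[ZMod p] GaloisField p (2 * e))
    have hpe : e < p ^ e := Nat.lt_pow_self (Fact.out : p.Prime).one_lt
    refine ⟨hfin, fun t => ?_, ?_⟩
    · convert hC (GaloisField p (2 * e)) e (GaloisField.finrank p (by omega)) (by omega) t
    · exact hc _ e (GaloisField.finrank p (by omega)) (by omega)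
  constructor
  · obtain ⟨C, e₀, hC⟩ := key x k hx hk
    refine ⟨c + C, e₀, fun e he ψ => ?_⟩
    obtain ⟨he0, hfin, h1, h2⟩ := hC e he
    have h3 := card_le_of_forall_card_fibre_le _ h1
    have h4 := primePowerSum_eq O ψ 0 (GaloisField p (2 * e))
    rw [GaloisField.finrank p (by omega)] at h4
    rw [h4]
    simp only [map_zero, AddChar.map_zero_eq_one, sum_const, card_univ, nsmul_eq_mul, mul_one]
    have h2' : (p : ℝ) ^ e * (p : ℝ) ^ e ≤
        Fintype.card (S →ₐ[ZMod p] GaloisField p (2 * e)) + c * (p : ℝ) ^ e := by exact_mod_cast h2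
    have h3' : (Fintype.card (S →ₐ[ZMod p] GaloisField p (2 * e)) : ℝ) ≤
        (p : ℝ) ^ e * ((p : ℝ) ^ e + C) := by exact_mod_cast h3
    have h5 : ((Fintype.card (S →ₐ[ZMod p] GaloisField p (2 * e)) : ℂ) - (p : ℂ) ^ (2 * e)) =
        (((Fintype.card (S →ₐ[ZMod p] GaloisField p (2 * e)) : ℝ) - (p : ℝ) ^ e * (p : ℝ) ^ e : ℝ) : ℂ) := by
      push_cast
      ring
    rw [h5, Complex.norm_real, Real.norm_eq_abs, abs_le]
    have h6 : (0 : ℝ) ≤ (p : ℝ) ^ e := by positivity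
    have h7 : (0 : ℝ) ≤ C := by positivity
    have h8 : (0 : ℝ) ≤ c := by positivity
    constructor <;> nlinarith
  · intro h d hh hd
    obtain ⟨C, e₀, hC⟩ := key h d hh hd
    refine ⟨c + C, e₀, fun e he ψ hψ => ?_⟩
    obtain ⟨he0, hfin, h1, h2⟩ := hC e he
    have h4 := primePowerSum_eq O ψ h (GaloisField p (2 * e))
    rw [GaloisField.finrank p (by omega)] at h4
    rw [h4]
    have h2' : (p : ℝ) ^ e * (p : ℝ) ^ e ≤
        Fintype.card (S →ₐ[ZMod p] GaloisField p (2 * e)) + c * (p : ℝ) ^ e := by exact_mod_cast h2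
    have h3 := norm_sum_addChar_le (fun φ : S →ₐ[ZMod p] GaloisField p (2 * e) =>
      Algebra.trace (ZMod p) _ (φ h)) hψ (B := (p : ℝ) ^ e * ((p : ℝ) ^ e + C))
      fun t => by exact_mod_cast h1 t
    linarith

end PoleFiltration

end

section

open Module Finset Polynomial

lemma norm_le_of_norm_sum_pow_le {ι : Type*} [Fintype ι] (α : ι → ℂ) {q : ℝ} (hq : 0 < q)
    {C : ℝ} {e₀ : ℕ} (hC : ∀ e ≥ e₀, ‖∑ i, α i ^ e‖ ≤ C * q ^ e) (i : ι) : ‖α i‖ ≤ q := by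
  classical
  by_contra! hlt
  let T := (univ.image α).erase (α i)
  let Q : ℂ[X] := ∏ b ∈ T, (X - Polynomial.C b)
  have hQ : ∀ a, eval a Q = ∏ b ∈ T, (a - b) := fun a => by simp [Q, eval_prod]
  have hQi : eval (α i) Q ≠ 0 := by
    rw [hQ, prod_ne_zero_iff]
    intro b hb h
    exact (mem_erase.mp hb).1 (sub_eq_zero.mp h).symm
  have hQj : ∀ a, α a ≠ α i → eval (α a) Q = 0 := by
    intro a ha
    rw [hQ]
    exact prod_eq_zero (mem_erase.mpr ⟨ha, mem_image_of_mem _ (mem_univ _)⟩) (sub_self _)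
  let m := (univ.filter fun a => α a = α i).card
  have hm : (m : ℂ) ≠ 0 := by
    have : 0 < m := card_pos.mpr ⟨i, by simp⟩
    exact_mod_cast this.ne'
  have hshift : ∀ e, ∑ n ∈ range (Q.natDegree + 1), Q.coeff n * ∑ a, α a ^ (e + n) =
      m * eval (α i) Q * α i ^ e := by
    intro e
    calc _ = ∑ a, eval (α a) Q * α a ^ e := by
          simp only [mul_sum]
          rw [sum_comm]
          refine sum_congr rfl fun a _ => ?_
          rw [eval_eq_sum_range, sum_mul]
          refine sum_congr rfl fun n _ => ?_
          ring
      _ = ∑ a ∈ univ.filter (fun a => α a = α i), eval (α a) Q * α a ^ e := by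
          rw [sum_filter]
          refine sum_congr rfl fun a _ => ?_
          split_ifs with h
          · rfl
          · rw [hQj a h, zero_mul]
      _ = ∑ a ∈ univ.filter (fun a => α a = α i), eval (α i) Q * α i ^ e :=
          sum_congr rfl fun a ha => by rw [(mem_filter.mp ha).2]
      _ = _ := by rw [sum_const, nsmul_eq_mul, mul_assoc]
  let B := ∑ n ∈ range (Q.natDegree + 1), ‖Q.coeff n‖ * (C * q ^ n)
  have hB : ∀ e ≥ e₀, ‖(m : ℂ) * eval (α i) Q‖ * ‖α i‖ ^ e ≤ B * q ^ e := by
    intro e he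
    rw [← norm_pow, ← norm_mul, ← hshift, sum_mul]
    refine (norm_sum_le _ _).trans (sum_le_sum fun n _ => ?_)
    rw [norm_mul, mul_assoc]
    refine mul_le_mul_of_nonneg_left ((hC _ (by omega)).trans_eq ?_) (norm_nonneg _)
    ring
  have hA : 0 < ‖(m : ℂ) * eval (α i) Q‖ := norm_pos_iff.mpr (mul_ne_zero hm hQi)
  have hr : 1 < ‖α i‖ / q := (one_lt_div hq).mpr hlt
  obtain ⟨n, hn⟩ := pow_unbounded_of_one_lt (B / ‖(m : ℂ) * eval (α i) Q‖) hr
  have hn' : B / ‖(m : ℂ) * eval (α i) Q‖ < (‖α i‖ / q) ^ (n + e₀) :=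
    hn.trans_le (pow_le_pow_right₀ hr.le (by omega))
  rw [div_pow, div_lt_div_iff₀ hA (by positivity)] at hn'
  have := hB (n + e₀) (by omega)
  linarith

/-- If `∑ l n X ^ n` is a polynomial whose logarithmic derivative has coefficients `s n`, then growth
of `s` along even indices controls `s 1`. -/
lemma norm_le_of_newton {l s : ℕ → ℂ} {D : ℕ} (h0 : l 0 = 1) (hD : ∀ n > D, l n = 0)
    (hs : ∀ n : ℕ, n * l n = ∑ i ∈ Icc 1 n, s i * l (n - i)) {q : ℝ} (hq : 0 < q)
    {C : ℝ} {e₀ : ℕ} (hC : ∀ e ≥ e₀, ‖s (2 * e)‖ ≤ C * q ^ e) : ‖s 1‖ ≤ D * √q := by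
  classical
  let R : ℂ[X] := ∑ n ∈ range D, Polynomial.C (l (D - n)) * X ^ n
  have hR : R.degree < D := by
    refine mem_degreeLT.mp (Submodule.sum_mem _ fun n hn => mem_degreeLT.mpr ?_)
    refine (degree_C_mul_X_pow_le _ _).trans_lt ?_
    exact_mod_cast mem_range.mp hn
  let P : ℂ[X] := X ^ D + R
  have hP : P.Monic := monic_X_pow_add hR
  have hPdeg : P.natDegree = D := natDegree_eq_of_degree_eq_some (by
    rw [degree_add_eq_left_of_degree_lt (by rwa [degree_X_pow]), degree_X_pow])
  have hPcoeff : ∀ n ≤ D, P.coeff n = l (D - n) := by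
    intro n hn
    simp only [P, R, coeff_add, coeff_X_pow, finsetSum_coeff, coeff_C_mul]
    rcases hn.lt_or_eq with h | rfl
    · rw [if_neg h.ne, zero_add, sum_eq_single n]
      · simp
      · intro b _ hb
        rw [if_neg hb.symm, mul_zero]
      · intro h'
        exact absurd (mem_range.mpr h) h'
    · rw [if_pos rfl, Nat.sub_self, h0, sum_eq_zero, add_zero]
      intro b hb
      rw [if_neg (mem_range.mp hb).ne', mul_zero]
  have hcard : Multiset.card P.roots = P.natDegree :=
    (splits_iff_card_roots.mp (IsAlgClosed.splits P))
  let ω : P.roots.ToType → ℂ := fun x => x.1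
  have hω : (univ : Finset P.roots.ToType).val.map ω = P.roots := Multiset.map_univ_coe _
  have hωD : Fintype.card P.roots.ToType = D := by
    rw [Multiset.card_coe, hcard, hPdeg]
  let E : ℕ → ℂ := fun n => (-1) ^ n * MvPolynomial.aeval ω (MvPolynomial.esymm P.roots.ToType ℂ n)
  have hE : ∀ n, E n = l n := by
    intro n
    simp only [E]
    rw [MvPolynomial.aeval_esymm_eq_multiset_esymm, hω]
    rcases le_or_gt n D with h | h
    · have := Polynomial.coeff_eq_esymm_roots_of_card hcard (k := D - n) (by omega)
      rw [hPcoeff _ (by omega), hP.leadingCoeff, one_mul, hPdeg, Nat.sub_sub_self h] at this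
      exact this.symm
    · rw [hD n h, Multiset.esymm, Multiset.powersetCard_eq_empty _ (by omega)]
      simp
  have hnewton : ∀ n : ℕ, n * l n = ∑ i ∈ Icc 1 n, (-∑ a, ω a ^ i) * l (n - i) := by
    intro n
    have h := congrArg (MvPolynomial.aeval ω) (MvPolynomial.mul_esymm_eq_sum P.roots.ToType ℂ n)
    simp only [map_mul, map_natCast, map_pow, map_neg, map_one, map_sum] at h
    have h2 : (n : ℂ) * l n = (-1) ^ n * (n * MvPolynomial.aeval ω
        (MvPolynomial.esymm P.roots.ToType ℂ n)) := by
      rw [← hE]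
      ring
    rw [h2, h, ← mul_assoc, ← pow_add, mul_sum]
    refine sum_nbij' (fun a => a.2) (fun i => (n - i, i)) ?_ ?_ ?_ ?_ ?_
    · rintro ⟨a, b⟩ hab
      simp only [mem_filter, HasAntidiagonal.mem_antidiagonal, mem_Icc] at hab ⊢
      omega
    · intro i hi
      simp only [mem_filter, HasAntidiagonal.mem_antidiagonal, mem_Icc] at hi ⊢
      omega
    · rintro ⟨a, b⟩ hab
      simp only [mem_filter, HasAntidiagonal.mem_antidiagonal] at hab
      simp only [Prod.mk.injEq, and_true]
      omega
    · intro i _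
      rfl
    · rintro ⟨a, b⟩ hab
      simp only [mem_filter, HasAntidiagonal.mem_antidiagonal] at hab
      have hb : n - b = a := by omega
      have hodd : (-1 : ℂ) ^ (n + (n + 1)) = -1 := Odd.neg_one_pow ⟨n, by ring⟩
      simp only [hb, hodd, ← hE a, E, MvPolynomial.psum, map_sum, map_pow, MvPolynomial.aeval_X]
      ring
  have hpow : ∀ n, 1 ≤ n → s n = -∑ a, ω a ^ n := by
    intro n
    induction n using Nat.strong_induction_on with
    | _ n ih =>
      intro hn
      have h1 := (hs n).symm.trans (hnewton n)
      obtain ⟨m, rfl⟩ : ∃ m, n = m + 1 := ⟨n - 1, by omega⟩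
      rw [sum_Icc_succ_top hn, sum_Icc_succ_top hn, Nat.sub_self, h0, mul_one, mul_one] at h1
      rw [sum_congr rfl fun i hi => by
        rw [ih i (by have := (mem_Icc.mp hi).2; omega) (mem_Icc.mp hi).1]] at h1
      exact add_left_cancel h1
  have hbound : ∀ a, ‖ω a‖ ≤ √q := by
    intro a
    refine Real.le_sqrt_of_sq_le ?_
    rw [← norm_pow]
    refine norm_le_of_norm_sum_pow_le (fun a => ω a ^ 2) hq (C := C) (e₀ := e₀ + 1) ?_ a
    intro e he
    have := hC e (by omega)
    rw [hpow _ (by omega), norm_neg] at this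
    simpa only [pow_mul] using this
  rw [hpow 1 le_rfl, norm_neg]
  simp only [pow_one]
  refine (norm_sum_le _ _).trans ((sum_le_sum fun a _ => hbound a).trans_eq ?_)
  rw [sum_const, card_univ, hωD, nsmul_eq_mul]

/-- The variant of `norm_le_of_newton` for a power series with one extra pole at `1 / c`. -/
lemma norm_sub_le_of_newton {l s : ℕ → ℂ} {D : ℕ} {c : ℂ} (h0 : l 0 = 1)
    (hD : ∀ n ≥ D, l (n + 1) = c * l n)
    (hs : ∀ n : ℕ, n * l n = ∑ i ∈ Icc 1 n, s i * l (n - i)) {q : ℝ} (hq : 0 < q)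
    {C : ℝ} {e₀ : ℕ} (hC : ∀ e ≥ e₀, ‖s (2 * e) - c ^ (2 * e)‖ ≤ C * q ^ e) :
    ‖s 1 - c‖ ≤ D * √q := by
  let l' : ℕ → ℂ := fun n => l n - if n = 0 then 0 else c * l (n - 1)
  have hsplit : ∀ (t : ℕ → ℂ) (n : ℕ), ∑ i ∈ range (n + 1), t i * l' (n - i) =
      ∑ i ∈ range (n + 1), t i * l (n - i) - c * ∑ i ∈ range n, t i * l (n - 1 - i) := by
    intro t n
    rw [sum_range_succ, sum_range_succ _ n, mul_sum, add_sub_right_comm, ← sum_sub_distrib]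
    congr 1
    · refine sum_congr rfl fun i hi => ?_
      have : n - i ≠ 0 := by have := mem_range.mp hi; omega
      simp only [l', if_neg this]
      rw [Nat.sub_right_comm]
      ring
    · simp [l']
  have hrange : ∀ (t u : ℕ → ℂ) (n : ℕ), ∑ i ∈ Icc 1 n, t i * u (n - i) =
      ∑ i ∈ range n, t (i + 1) * u (n - 1 - i) := by
    intro t u n
    refine sum_nbij' (fun i => i - 1) (fun i => i + 1) ?_ ?_ ?_ ?_ ?_
    · intro i hi
      simp only [mem_Icc, mem_range] at hi ⊢
      omega
    · intro i hi
      simp only [mem_Icc, mem_range] at hi ⊢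
      omega
    · intro i hi
      simp only [mem_Icc] at hi
      omega
    · intro i hi
      omega
    · intro i hi
      simp only [mem_Icc] at hi
      rw [Nat.sub_add_cancel hi.1, Nat.sub_sub, Nat.add_sub_cancel' hi.1]
  have := norm_le_of_newton (l := l') (s := fun n => s n - c ^ n) (D := D) (by simp [l', h0])
    (by
      intro n hn
      obtain ⟨m, rfl⟩ : ∃ m, n = m + 1 := ⟨n - 1, by omega⟩
      simp only [l', Nat.add_sub_cancel, if_neg (Nat.succ_ne_zero m)]
      rw [hD m (by omega), sub_self])
    (by
      intro n
      rw [hrange]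
      rcases n with _ | n
      · simp
      have h1 := hs (n + 1)
      have h2 := hs n
      rw [hrange, Nat.add_sub_cancel] at h1
      rw [hrange] at h2
      have h3 : ∑ i ∈ range (n + 1), c ^ (i + 1) * l (n - i) =
          c * ∑ i ∈ range n, c ^ (i + 1) * l (n - 1 - i) + c * l n := by
        rw [sum_range_succ', mul_sum]
        congr 1
        · refine sum_congr rfl fun i _ => ?_
          rw [Nat.sub_sub, add_comm 1 i]
          ring
        · simp
      rw [Nat.add_sub_cancel]
      simp only [sub_mul, sum_sub_distrib]
      rw [hsplit fun i => s (i + 1), hsplit fun i => c ^ (i + 1), h3, ← h1, ← h2]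
      simp only [l', if_neg (Nat.succ_ne_zero n), Nat.add_sub_cancel]
      push_cast
      ring) hq hC
  simpa using this

end

section

open Module Finset Polynomial

lemma minpoly_root_of_monic {R : Type*} [CommRing R] {P : R[X]} (hP : P.Monic) :
    minpoly R (AdjoinRoot.root P) = P := by
  refine (minpoly.unique' R _ hP ?_ fun q hq => ?_).symm
  · rw [AdjoinRoot.aeval_eq, AdjoinRoot.mk_self]
  · rw [AdjoinRoot.aeval_eq, Ne, AdjoinRoot.mk_eq_zero]
    exact or_iff_not_imp_left.mpr fun hq0 => hP.not_dvd_of_degree_lt hq0 hq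

namespace PoleFiltration

variable {p : ℕ} [Fact p.Prime] {S : Type} [CommRing S] [IsDedekindDomain S] [Algebra (ZMod p) S]

lemma primePowerSum_one (O : PoleFiltration (ZMod p) S) (ψ : AddChar (ZMod p) ℂ) (h : S)
    [Fintype (S →ₐ[ZMod p] ZMod p)] :
    primePowerSum O ψ h 1 = ∑ φ : S →ₐ[ZMod p] ZMod p, ψ (φ h) := by
  have := primePowerSum_eq O ψ h (ZMod p)
  rw [finrank_self] at this
  simpa only [Algebra.trace_self_apply] using this

/-- The Riemann hypothesis for the `L`-functions of degree-one points of the curve, in the weak form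
of a bound for sums over rational points. -/
theorem norm_sum_algHom_le (O : PoleFiltration (ZMod p) S) {x : S} {k : ℕ}
    (hx : O.HasDeg x k) (hk : ¬ p ∣ k)
    (hS : ∃ c q₁ : ℕ, ∀ (K : Type) [Field K] [Algebra (ZMod p) K] [FiniteDimensional (ZMod p) K]
      [Fintype (S →ₐ[ZMod p] K)] (e : ℕ), finrank (ZMod p) K = 2 * e → q₁ < p ^ e →
      p ^ e * p ^ e ≤ Fintype.card (S →ₐ[ZMod p] K) + c * p ^ e)
    [Fintype (S →ₐ[ZMod p] ZMod p)] :
    |(Fintype.card (S →ₐ[ZMod p] ZMod p) : ℝ) - p| ≤ 2 * O.gap * √p ∧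
    ∀ (h : S) (d : ℕ), O.HasDeg h d → ¬ p ∣ d → ∀ ψ : AddChar (ZMod p) ℂ, ψ ≠ 1 →
      ‖∑ φ : S →ₐ[ZMod p] ZMod p, ψ (φ h)‖ ≤ (2 * O.gap + d) * √p := by
  have hp : (0 : ℝ) < p := by exact_mod_cast (Fact.out : p.Prime).pos
  obtain ⟨⟨C, e₀, h1⟩, h2⟩ := norm_primePowerSum_le O hx hk hS
  constructor
  · have h := norm_sub_le_of_newton (lCoeff_zero (O := O) 1 0) (D := 2 * O.gap) (c := p)
      (fun n hn => by rw [lCoeff_zero_succ _ hn, ZMod.card]) (mul_lCoeff O 1 0) hp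
      (fun e he => h1 e he 1)
    rw [primePowerSum_one] at h
    simp only [map_zero, AddChar.map_zero_eq_one, sum_const, card_univ, nsmul_eq_mul, mul_one] at h
    rw [← Complex.ofReal_natCast, ← Complex.ofReal_natCast, ← Complex.ofReal_sub,
      Complex.norm_real, Real.norm_eq_abs] at h
    exact_mod_cast h
  · intro h d hh hd ψ hψ
    obtain ⟨C, e₀, h3⟩ := h2 h d hh hd
    have hd' : (d : ZMod p) ≠ 0 := by rwa [Ne, ZMod.natCast_eq_zero_iff]
    have h := norm_le_of_newton (lCoeff_zero (O := O) ψ h) (D := 2 * O.gap + d)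
      (fun n hn => lCoeff_eq_zero (AddChar.IsPrimitive.of_ne_one hψ) hh hd' hn.le)
      (mul_lCoeff O ψ h) hp (fun e he => h3 e he ψ hψ)
    rw [primePowerSum_one] at h
    exact_mod_cast h

end PoleFiltration

namespace CurveRing

variable {p : ℕ} [Fact p.Prime] {f g : (ZMod p)[X]}

open PoleFiltration in
/-- A complete family of data on the normalization of the curve `f(X) = g(Y)`. -/
theorem exists_normalization (hg : g.Monic) (hk : 2 ≤ g.natDegree) (hj : 0 < f.natDegree)
    (hjk : Nat.Coprime f.natDegree g.natDegree) (hder : derivative g ≠ 0) :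
    ∃ (S : Type) (_ : CommRing S) (_ : Algebra (ZMod p) S) (_ : Algebra (CurveRing f g) S)
      (_ : IsScalarTower (ZMod p) (CurveRing f g) S) (_ : IsDedekindDomain S)
      (O : PoleFiltration (ZMod p) S), Function.Injective (algebraMap (CurveRing f g) S) ∧
      (∀ s : S, ∃ a, algebraMap (CurveRing f g) S a =
        algebraMap (CurveRing f g) S (aeval (y f g) (derivative g)) * s) ∧
      O.gap = f.natDegree * g.natDegree ∧
      O.HasDeg (algebraMap (CurveRing f g) S (x f g)) g.natDegree ∧
      O.HasDeg (algebraMap (CurveRing f g) S (y f g)) f.natDegree := by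
  obtain ⟨O, hgap, hx, hy, -⟩ := exists_poleFiltration hg hk hj hjk
  have : Nontrivial (CurveRing f g) := ⟨⟨_, _, hy.ne_zero⟩⟩
  have hdom : IsDomain (CurveRing f g) := O.isDomain
  let pb : PowerBasis (ZMod p)[X] (CurveRing f g) :=
    AdjoinRoot.powerBasis' (curvePoly_monic f hg (by omega))
  have hdim : pb.dim = g.natDegree := by
    rw [AdjoinRoot.powerBasis'_dim, curvePoly_natDegree]
  have hgen : pb.gen = y f g := AdjoinRoot.powerBasis'_gen _
  have hfaith : FaithfulSMul (ZMod p)[X] (CurveRing f g) := by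
    rw [faithfulSMul_iff_algebraMap_injective]
    exact AdjoinRoot.of.injective_of_degree_ne_zero (by
      rw [degree_eq_natDegree (curvePoly_monic f hg (by omega)).ne_zero, curvePoly_natDegree]
      exact_mod_cast (by omega : g.natDegree ≠ 0))
  have hmin : minpoly (ZMod p)[X] pb.gen = curvePoly f g := by
    rw [hgen]
    exact minpoly_root_of_monic (curvePoly_monic f hg (by omega))
  have hc : aeval pb.gen (derivative (minpoly (ZMod p)[X] pb.gen)) =
      aeval (y f g) (derivative g) := by
    have hd : derivative (curvePoly f g) = (derivative g).map C := by
      simp [curvePoly, derivative_map]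
    rw [hmin, hgen, hd]
    exact aeval_map_algebraMap _ _ _
  have hcdeg := hy.aeval hj hder
  obtain ⟨S, _, _, _, _, _, hinj, hS⟩ := exists_dedekind_overring (F := ZMod p) pb
    (by rw [hc]; exact hcdeg.ne_zero)
  rw [hc] at hS
  exact ⟨S, _, _, _, inferInstance, inferInstance, overring O _ _ hinj hcdeg hS, hinj, hS, hgap,
    overring_hasDeg hinj hcdeg hS hx, overring_hasDeg hinj hcdeg hS hy⟩

end CurveRing

end

section

open Module Finset Polynomial

namespace CurveRing

variable {p : ℕ} [Fact p.Prime] {f g : (ZMod p)[X]}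

open PoleFiltration in
/-- Affine points and places of degree one are the same up to the ramification locus. -/
lemma norm_sum_points_sub_le (hg : g.Monic) (hk : 2 ≤ g.natDegree) (hj : 0 < f.natDegree)
    (hjk : Nat.Coprime f.natDegree g.natDegree) (hder : derivative g ≠ 0)
    {S : Type} [CommRing S] [IsDomain S] [Algebra (ZMod p) S] [Algebra (CurveRing f g) S]
    [IsScalarTower (ZMod p) (CurveRing f g) S] (O : PoleFiltration (ZMod p) S)
    (hinj : Function.Injective (algebraMap (CurveRing f g) S))
    (hS : ∀ s : S, ∃ a, algebraMap (CurveRing f g) S a =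
      algebraMap (CurveRing f g) S (aeval (y f g) (derivative g)) * s)
    (hy : O.HasDeg (algebraMap (CurveRing f g) S (y f g)) f.natDegree)
    [Fintype (S →ₐ[ZMod p] ZMod p)] (w : ZMod p × ZMod p → ℂ) (hw : ∀ z, ‖w z‖ ≤ 1) :
    ‖∑ z with eval z.2 g = eval z.1 f, w z - ∑ φ : S →ₐ[ZMod p] ZMod p,
      w (φ (algebraMap _ S (x f g)), φ (algebraMap _ S (y f g)))‖ ≤
      2 * (f.natDegree * g.natDegree) := by
  classical
  obtain ⟨O', -, -, hy', -⟩ := exists_poleFiltration hg hk hj hjk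
  have : Nontrivial (CurveRing f g) := ⟨⟨_, _, hy'.ne_zero⟩⟩
  have hdeg : (derivative g).natDegree ≤ g.natDegree := (natDegree_derivative_le g).trans (by omega)
  have hbound : ((f.natDegree * (derivative g).natDegree : ℕ) : ℝ) ≤
      f.natDegree * g.natDegree := by exact_mod_cast Nat.mul_le_mul_left _ hdeg
  let Z : Finset (ZMod p × ZMod p) := univ.filter fun z => eval z.2 g = eval z.1 f
  let pt : (S →ₐ[ZMod p] ZMod p) → ZMod p × ZMod p := fun φ =>
    (φ (algebraMap _ S (x f g)), φ (algebraMap _ S (y f g)))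
  have hptZ : ∀ φ, eval (pt φ).2 g = eval (pt φ).1 f := by
    intro φ
    have := algHom_point (φ.comp (IsScalarTower.toAlgHom (ZMod p) (CurveRing f g) S))
    simpa [coe_aeval_eq_eval] using this
  have hc : ∀ φ : S →ₐ[ZMod p] ZMod p,
      φ (algebraMap _ S (aeval (y f g) (derivative g))) = eval (pt φ).2 (derivative g) := by
    intro φ
    rw [← aeval_algebraMap_apply, ← aeval_algHom_apply, coe_aeval_eq_eval]
  have hZ : (Z.filter fun z => ¬ eval z.2 (derivative g) ≠ 0).card ≤
      f.natDegree * (derivative g).natDegree := by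
    obtain ⟨T, hT, hTY⟩ := exists_finset_algHom (AlgHom.id (ZMod p) (ZMod p))
      (Z.filter fun z => ¬ eval z.2 (derivative g) ≠ 0) fun z hz => by
        have := (mem_filter.mp (mem_filter.mp hz).1).2
        simpa [coe_aeval_eq_eval] using this
    rw [← hT]
    refine card_zeros_le (hy'.aeval hj hder) fun φ hφ => ?_
    obtain ⟨z, hz, -, hzy⟩ := hTY φ hφ
    rw [← aeval_algHom_apply, hzy, coe_aeval_eq_eval]
    exact not_not.mp (mem_filter.mp hz).2
  have hH : (univ.filter fun φ => ¬ eval (pt φ).2 (derivative g) ≠ 0).card ≤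
      f.natDegree * (derivative g).natDegree := by
    refine card_zeros_le (hy.aeval hj hder) fun φ hφ => ?_
    rw [aeval_algebraMap_apply, hc]
    exact not_not.mp (mem_filter.mp hφ).2
  have hgood : ∑ φ with eval (pt φ).2 (derivative g) ≠ 0, w (pt φ) =
      ∑ z ∈ Z with eval z.2 (derivative g) ≠ 0, w z := by
    refine sum_bij (fun φ _ => pt φ) ?_ ?_ ?_ fun _ _ => rfl
    · intro φ hφ
      exact mem_filter.mpr ⟨mem_filter.mpr ⟨mem_univ _, hptZ φ⟩, (mem_filter.mp hφ).2⟩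
    · intro φ hφ φ' _ h
      have hA : φ.comp (IsScalarTower.toAlgHom (ZMod p) (CurveRing f g) S) =
          φ'.comp (IsScalarTower.toAlgHom (ZMod p) (CurveRing f g) S) :=
        algHom_ext (congrArg Prod.fst h) (congrArg Prod.snd h)
      have hA' : ∀ a, φ (algebraMap _ S a) = φ' (algebraMap _ S a) := fun a =>
        DFunLike.congr_fun hA a
      ext s
      obtain ⟨a, ha⟩ := hS s
      have h1 := hA' a
      rw [ha, map_mul, map_mul, ← hA'] at h1
      refine mul_left_cancel₀ ?_ h1
      rw [hc]
      exact (mem_filter.mp hφ).2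
    · intro z hz
      obtain ⟨hz1, hz2⟩ := mem_filter.mp hz
      have hz3 : aeval z.2 g = aeval z.1 f := by
        simpa [coe_aeval_eq_eval] using (mem_filter.mp hz1).2
      obtain ⟨φ, hφ⟩ := exists_extend_algHom hinj hS (lift hz3) (by
        rw [← aeval_algHom_apply, lift_y, coe_aeval_eq_eval]
        exact hz2)
      have hpt : pt φ = z := Prod.ext (by simp only [pt]; rw [hφ, lift_x])
        (by simp only [pt]; rw [hφ, lift_y])
      exact ⟨φ, mem_filter.mpr ⟨mem_univ _, by rw [hpt]; exact hz2⟩, hpt⟩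
  have hsplit : ∑ z ∈ Z, w z - ∑ φ, w (pt φ) =
      ∑ z ∈ Z with ¬ eval z.2 (derivative g) ≠ 0, w z -
        ∑ φ with ¬ eval (pt φ).2 (derivative g) ≠ 0, w (pt φ) := by
    rw [← sum_filter_add_sum_filter_not Z (fun z => eval z.2 (derivative g) ≠ 0) w,
      ← sum_filter_add_sum_filter_not univ (fun φ => eval (pt φ).2 (derivative g) ≠ 0)
        (fun φ => w (pt φ)), hgood]
    ring
  have hcard : ∀ {ι : Type} (T : Finset ι) (u : ι → ℂ), (∀ i, ‖u i‖ ≤ 1) →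
      T.card ≤ f.natDegree * (derivative g).natDegree →
      ‖∑ i ∈ T, u i‖ ≤ f.natDegree * g.natDegree := by
    intro ι T u hu hT
    refine (norm_sum_le_of_le _ fun i _ => hu i).trans ?_
    rw [sum_const, nsmul_eq_mul, mul_one]
    exact le_trans (by exact_mod_cast hT) hbound
  change ‖∑ z ∈ Z, w z - ∑ φ, w (pt φ)‖ ≤ _
  rw [hsplit]
  refine (norm_sub_le _ _).trans ?_
  rw [two_mul]
  exact add_le_add (hcard _ _ hw hZ) (hcard _ _ (fun _ => hw _) hH)

open PoleFiltration in
/-- Bounds for the number of points and for the linear exponential sums on `f(X) = g(Y)`. -/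
theorem norm_sum_points_le (hg : g.Monic) (hk : 2 ≤ g.natDegree) (hkj : g.natDegree < f.natDegree)
    (hjk : Nat.Coprime f.natDegree g.natDegree) (hfp : f.natDegree < p) :
    |((univ.filter fun z : ZMod p × ZMod p => eval z.2 g = eval z.1 f).card : ℝ) - p| ≤
      4 * f.natDegree ^ 2 * √p ∧
    ∀ ψ : AddChar (ZMod p) ℂ, ψ ≠ 1 → ∀ a b : ZMod p, (a ≠ 0 ∨ b ≠ 0) →
      ‖∑ z : ZMod p × ZMod p with eval z.2 g = eval z.1 f, ψ (a * z.1 + b * z.2)‖ ≤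
        4 * f.natDegree ^ 2 * √p := by
  have hder : derivative g ≠ 0 := by
    intro h0
    obtain ⟨k, hk'⟩ : ∃ k, g.natDegree = k + 1 := ⟨g.natDegree - 1, by omega⟩
    have h1 := coeff_derivative g k
    rw [h0, coeff_zero, ← hk', hg.coeff_natDegree, one_mul] at h1
    have h2 : ((g.natDegree : ℕ) : ZMod p) = 0 := by
      rw [hk']
      push_cast
      exact h1.symm
    rw [ZMod.natCast_eq_zero_iff] at h2
    have := Nat.le_of_dvd (by omega) h2
    omega
  have hj : 0 < f.natDegree := by omega
  obtain ⟨S, _, _, _, _, _, O, hinj, hS, hgap, hx, hy⟩ := exists_normalization hg hk hj hjk hder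
  have hndvd : ∀ n, 0 < n → n ≤ f.natDegree → ¬ p ∣ n := fun n hn hnj hpn => by
    have := Nat.le_of_dvd hn hpn
    omega
  have := finite_algHom O (ZMod p)
  have := Fintype.ofFinite (S →ₐ[ZMod p] ZMod p)
  obtain ⟨h1, h2⟩ := norm_sum_algHom_le O hx (hndvd _ (by omega) hkj.le)
    (le_card_algHom hg hk hj hjk hder hinj hS)
  rw [hgap] at h1 h2
  have hcmp := norm_sum_points_sub_le hg hk hj hjk hder O hinj hS hy
  have hsqrt : 1 ≤ √(p : ℝ) := by
    rw [Real.one_le_sqrt]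
    exact_mod_cast (Fact.out : p.Prime).one_le
  have hkj' : (g.natDegree : ℝ) + 1 ≤ f.natDegree := by exact_mod_cast hkj
  have hj' : (1 : ℝ) ≤ f.natDegree := by exact_mod_cast hj
  have hprod : (f.natDegree : ℝ) * g.natDegree ≤ f.natDegree * (f.natDegree - 1) :=
    mul_le_mul_of_nonneg_left (by linarith) (by linarith)
  have hfin : ∀ d : ℝ, d ≤ f.natDegree → (2 * (f.natDegree * g.natDegree : ℕ) + d) * √p +
      2 * (f.natDegree * g.natDegree) ≤ 4 * f.natDegree ^ 2 * √p := by
    intro d hd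
    push_cast
    nlinarith [mul_nonneg (by positivity : (0 : ℝ) ≤ f.natDegree * g.natDegree)
      (sub_nonneg.mpr hsqrt)]
  constructor
  · have h3 := hcmp (fun _ => 1) (fun _ => by simp)
    simp only [sum_const, card_univ, nsmul_eq_mul, mul_one] at h3
    rw [← Complex.ofReal_natCast, ← Complex.ofReal_natCast, ← Complex.ofReal_sub,
      Complex.norm_real, Real.norm_eq_abs] at h3
    refine (abs_sub_le _ _ _).trans ((add_le_add h3 h1).trans ?_)
    have := hfin 0 (by linarith)
    linarith
  · intro ψ hψ a b hab
    obtain ⟨d, hd, hd0, hh⟩ : ∃ d, d ≤ f.natDegree ∧ 0 < d ∧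
        O.HasDeg (a • algebraMap _ S (x f g) + b • algebraMap _ S (y f g)) d := by
      by_cases hb : b = 0
      · refine ⟨g.natDegree, hkj.le, by omega, ?_⟩
        rw [hb, zero_smul, add_zero]
        exact hx.smul (hab.resolve_right (not_not.mpr hb))
      · refine ⟨f.natDegree, le_rfl, by omega, ?_⟩
        rw [add_comm]
        exact (hy.smul hb).add (Submodule.smul_mem _ _ (O.mono hkj hx.1))
    have h3 := hcmp (fun z => ψ (a * z.1 + b * z.2)) (fun _ => (AddChar.norm_apply _ _).le)
    have h4 := h2 _ d hh (hndvd d hd0 hd) ψ hψ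
    simp only [map_add, map_smul, smul_eq_mul] at h4 h3
    have h5 := norm_sub_norm_le (∑ z : ZMod p × ZMod p with eval z.2 g = eval z.1 f,
      ψ (a * z.1 + b * z.2)) (∑ φ : S →ₐ[ZMod p] ZMod p,
        ψ (a * φ (algebraMap _ S (x f g)) + b * φ (algebraMap _ S (y f g))))
    have := hfin d (by exact_mod_cast hd)
    linarith

end CurveRing

end

section

open Module Finset Polynomial

section CompleteSums

variable {p : ℕ} [Fact p.Prime]

lemma two_mul_mul_one_sub_le_sin {x : ℝ} (h0 : 0 ≤ x) (h1 : x ≤ 1) :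
    2 * (x * (1 - x)) ≤ Real.sin (Real.pi * x) := by
  have key : ∀ y : ℝ, 0 ≤ y → y ≤ 1 / 2 → 2 * (y * (1 - y)) ≤ Real.sin (Real.pi * y) := by
    intro y hy0 hy1
    have h := Real.mul_le_sin (x := Real.pi * y) (by positivity) (by nlinarith [Real.pi_pos])
    have : 2 / Real.pi * (Real.pi * y) = 2 * y := by field_simp
    nlinarith
  rcases le_total x (1 / 2) with h | h
  · exact key x h0 h
  · have := key (1 - x) (by linarith) (by linarith)
    rw [show Real.pi * (1 - x) = Real.pi - Real.pi * x by ring, Real.sin_pi_sub] at this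
    linarith

lemma two_div_norm_stdAddChar_sub_one_le {t : ℕ} (ht : 0 < t) (htp : t < p) :
    2 / ‖ZMod.stdAddChar (N := p) (t : ZMod p) - 1‖ ≤
      p / 2 * ((t : ℝ)⁻¹ + ((p - t : ℕ) : ℝ)⁻¹) := by
  have hp : (0 : ℝ) < p := by exact_mod_cast ht.trans htp
  have ht' : (0 : ℝ) < t := by exact_mod_cast ht
  have htp' : (t : ℝ) < p := by exact_mod_cast htp
  have h1 : ‖ZMod.stdAddChar (N := p) (t : ZMod p) - 1‖ = 2 * |Real.sin (Real.pi * (t / p))| := by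
    have := ZMod.stdAddChar_coe (N := p) (t : ℤ)
    rw [Int.cast_natCast] at this
    rw [this]
    have h := Complex.norm_exp_I_mul_ofReal_sub_one (2 * Real.pi * (t / p))
    rw [Real.norm_eq_abs, abs_mul, abs_two] at h
    rw [show 2 * Real.pi * (t / p) / 2 = Real.pi * (t / p) by ring] at h
    rw [← h]
    congr 3
    push_cast
    ring
  have h2 := two_mul_mul_one_sub_le_sin (x := t / p) (by positivity)
    ((div_le_one hp).mpr htp'.le)
  have h3 : (0 : ℝ) < t / p * (1 - t / p) :=
    mul_pos (by positivity) (sub_pos.mpr ((div_lt_one hp).mpr htp'))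
  rw [h1, abs_of_nonneg (by linarith)]
  calc 2 / (2 * Real.sin (Real.pi * (t / p))) ≤ 2 / (2 * (2 * (t / p * (1 - t / p)))) := by
        gcongr
    _ = _ := by
        rw [Nat.cast_sub htp.le]
        have : (p : ℝ) - t ≠ 0 := by linarith
        field_simp
        ring

lemma sum_ne_zero_eq_sum_range (G : ZMod p → ℝ) :
    ∑ a with a ≠ 0, G a = ∑ i ∈ range (p - 1), G ((i + 1 : ℕ) : ZMod p) := by
  have hp := (Fact.out : p.Prime).pos
  symm
  refine sum_bij (fun i _ => ((i + 1 : ℕ) : ZMod p)) ?_ ?_ ?_ fun _ _ => rfl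
  · intro i hi
    rw [mem_range] at hi
    rw [mem_filter, Ne, ZMod.natCast_eq_zero_iff]
    exact ⟨mem_univ _, Nat.not_dvd_of_pos_of_lt (by omega) (by omega)⟩
  · intro i hi i' hi' h
    rw [mem_range] at hi hi'
    rw [ZMod.natCast_eq_natCast_iff', Nat.mod_eq_of_lt (by omega), Nat.mod_eq_of_lt (by omega)] at h
    omega
  · intro a ha
    have h0 : a.val ≠ 0 := by
      rw [Ne, ZMod.val_eq_zero]
      exact (mem_filter.mp ha).2
    have := ZMod.val_lt a
    refine ⟨a.val - 1, mem_range.mpr (by omega), ?_⟩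
    rw [Nat.sub_add_cancel (by omega), ZMod.natCast_zmod_val]

lemma sum_two_div_norm_stdAddChar_le :
    ∑ a : ZMod p with a ≠ 0, 2 / ‖ZMod.stdAddChar (N := p) a - 1‖ ≤ p * (1 + Real.log p) := by
  have hp := (Fact.out : p.Prime).two_le
  have hharm : ∑ i ∈ range (p - 1), ((i + 1 : ℕ) : ℝ)⁻¹ ≤ 1 + Real.log p := by
    have h := harmonic_le_one_add_log (p - 1)
    rw [harmonic] at h
    push_cast at h ⊢
    refine h.trans ?_
    gcongr
    · exact_mod_cast (by omega : 0 < p - 1)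
    · exact Nat.sub_le _ _
  have hrefl : ∑ i ∈ range (p - 1), ((p - (i + 1) : ℕ) : ℝ)⁻¹ =
      ∑ i ∈ range (p - 1), ((i + 1 : ℕ) : ℝ)⁻¹ := by
    rw [← sum_range_reflect]
    refine sum_congr rfl fun i hi => ?_
    rw [mem_range] at hi
    congr 2
    omega
  rw [sum_ne_zero_eq_sum_range]
  calc _ ≤ ∑ i ∈ range (p - 1),
        (p : ℝ) / 2 * (((i + 1 : ℕ) : ℝ)⁻¹ + ((p - (i + 1) : ℕ) : ℝ)⁻¹) := by
        refine sum_le_sum fun i hi => ?_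
        rw [mem_range] at hi
        exact two_div_norm_stdAddChar_sub_one_le (by omega) (by omega)
    _ = p * ∑ i ∈ range (p - 1), ((i + 1 : ℕ) : ℝ)⁻¹ := by
        rw [← mul_sum, sum_add_distrib, hrefl]
        ring
    _ ≤ _ := by gcongr

lemma exists_apImage_eq (s r : ZMod p) (m : ℕ) :
    ∃ m' ≤ p, apImage p s r m = apImage p s r m' := by
  rcases le_total m p with h | h
  · exact ⟨m, h, rfl⟩
  · refine ⟨p, le_rfl, Subset.antisymm ?_ (image_subset_image (range_subset_range.mpr h))⟩
    intro x hx
    obtain ⟨i, -, rfl⟩ := mem_image.mp hx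
    refine mem_image.mpr ⟨i % p, mem_range.mpr (Nat.mod_lt _ (Fact.out : p.Prime).pos), ?_⟩
    rw [ZMod.natCast_mod]

/-- The Fourier transform of an arithmetic progression has small `L¹` norm. -/
lemma sum_norm_sum_apImage_le (s : ZMod p) {r : ZMod p} (hr : r ≠ 0) (m : ℕ) :
    ∑ a : ZMod p, ‖∑ u ∈ apImage p s r m, ZMod.stdAddChar (N := p) (a * u)‖ ≤
      p * (2 + Real.log p) := by
  have hp := (Fact.out : p.Prime).pos
  obtain ⟨n, hn, hmn⟩ := exists_apImage_eq s r m
  rw [hmn]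
  set ψ := ZMod.stdAddChar (N := p)
  have hsum : ∀ a, ∑ u ∈ apImage p s r n, ψ (a * u) =
      ψ (a * s) * ∑ i ∈ range n, ψ (a * r) ^ i := by
    intro a
    rw [apImage, sum_image, mul_sum]
    · refine sum_congr rfl fun i _ => ?_
      rw [← AddChar.map_nsmul_eq_pow, ← AddChar.map_add_eq_mul, nsmul_eq_mul]
      congr 1
      ring
    · intro i hi i' hi' h
      rw [mem_coe, mem_range] at hi hi'
      have h' := mul_right_cancel₀ hr (add_left_cancel h)
      rw [ZMod.natCast_eq_natCast_iff', Nat.mod_eq_of_lt (by omega),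
        Nat.mod_eq_of_lt (by omega)] at h'
      exact h'
  have hnorm : ∀ a, ‖ψ a‖ = 1 := fun a => AddChar.norm_apply ψ a
  have hzero : ‖∑ u ∈ apImage p s r n, ψ (0 * u)‖ ≤ p := by
    simp only [zero_mul, AddChar.map_zero_eq_one, sum_const, nsmul_eq_mul, mul_one,
      Complex.norm_natCast]
    have := card_le_univ (apImage p s r n)
    rw [ZMod.card] at this
    exact_mod_cast this
  have hne : ∀ a, a ≠ 0 → ‖∑ u ∈ apImage p s r n, ψ (a * u)‖ ≤ 2 / ‖ψ (a * r) - 1‖ := by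
    intro a ha
    have h1 : ψ (a * r) ≠ 1 := by
      intro h
      refine mul_ne_zero ha hr (ZMod.injective_stdAddChar ?_)
      rw [AddChar.map_zero_eq_one]
      exact h
    rw [hsum, norm_mul, hnorm, one_mul, geom_sum_eq h1, norm_div]
    gcongr
    refine (norm_sub_le _ _).trans_eq ?_
    rw [norm_pow, hnorm, one_pow, norm_one]
    norm_num
  rw [← sum_filter_add_sum_filter_not univ (fun a : ZMod p => a ≠ 0)]
  have h1 : ∑ a : ZMod p with a ≠ 0, ‖∑ u ∈ apImage p s r n, ψ (a * u)‖ ≤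
      p * (1 + Real.log p) := by
    refine le_trans (sum_le_sum fun a ha => hne a (mem_filter.mp ha).2) (le_trans (le_of_eq ?_)
      sum_two_div_norm_stdAddChar_le)
    refine sum_bij (fun a _ => a * r) ?_ ?_ ?_ fun _ _ => rfl
    · intro a ha
      exact mem_filter.mpr ⟨mem_univ _, mul_ne_zero (mem_filter.mp ha).2 hr⟩
    · intro a _ b _ h
      exact mul_right_cancel₀ hr h
    · intro b hb
      exact ⟨b / r, mem_filter.mpr ⟨mem_univ _, div_ne_zero (mem_filter.mp hb).2 hr⟩,
        div_mul_cancel₀ b hr⟩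
  have h2 : (univ.filter fun a : ZMod p => ¬ a ≠ 0) = {0} := by
    ext a
    simp
  rw [h2, sum_singleton]
  linarith

/-- Completion: counting points of `Z` in a box by means of linear exponential sums over `Z`. -/
lemma card_filter_mem_le {ψ : AddChar (ZMod p) ℂ} (hψ : ψ.IsPrimitive)
    (Z : Finset (ZMod p × ZMod p)) (I : Finset (ZMod p)) {B W : ℝ}
    (hB : ∀ a b, (a ≠ 0 ∨ b ≠ 0) → ‖∑ z ∈ Z, ψ (a * z.1 + b * z.2)‖ ≤ B)
    (hB0 : 0 ≤ B) (hW : ∑ a, ‖∑ u ∈ I, ψ (a * u)‖ ≤ W) :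
    (p : ℝ) ^ 2 * ((Z.filter fun z => z.1 ∈ I ∧ z.2 ∈ I).card : ℝ) ≤
      (I.card : ℝ) ^ 2 * Z.card + W ^ 2 * B := by
  have horth : ∀ x, ∑ u ∈ I, ∑ a, ψ (a * (u - x)) = if x ∈ I then (p : ℂ) else 0 := by
    intro x
    simp only [AddChar.sum_mulShift _ hψ, sub_eq_zero, ZMod.card]
    push_cast
    exact sum_ite_eq' I x fun _ => (p : ℂ)
  let H : ZMod p → ℂ := fun a => ∑ u ∈ I, ψ (a * u)
  let T : ZMod p → ZMod p → ℂ := fun a b => ∑ z ∈ Z, ψ (-a * z.1 + -b * z.2)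
  have hH : ∀ x, ∑ a, H a * ψ (-a * x) = if x ∈ I then (p : ℂ) else 0 := by
    intro x
    rw [← horth, sum_comm]
    refine sum_congr rfl fun a _ => ?_
    simp only [H, sum_mul]
    refine sum_congr rfl fun u _ => ?_
    rw [← AddChar.map_add_eq_mul]
    congr 1
    ring
  have hmain : (p : ℂ) ^ 2 * ((Z.filter fun z => z.1 ∈ I ∧ z.2 ∈ I).card : ℂ) =
      ∑ c : ZMod p × ZMod p, H c.1 * H c.2 * T c.1 c.2 := by
    calc _ = ∑ z ∈ Z, (∑ a, H a * ψ (-a * z.1)) * ∑ b, H b * ψ (-b * z.2) := by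
          rw [card_eq_sum_ones, sum_filter]
          push_cast
          rw [mul_sum]
          refine sum_congr rfl fun z _ => ?_
          rw [hH, hH]
          by_cases h1 : z.1 ∈ I <;> by_cases h2 : z.2 ∈ I <;> simp [h1, h2, sq]
      _ = _ := by
          simp only [sum_mul_sum]
          rw [sum_comm, Fintype.sum_prod_type]
          refine sum_congr rfl fun a _ => ?_
          rw [sum_comm]
          refine sum_congr rfl fun b _ => ?_
          simp only [T, mul_sum]
          refine sum_congr rfl fun z _ => ?_
          rw [AddChar.map_add_eq_mul]
          ring
  have hH0 : H 0 = I.card := by simp [H]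
  have hT0 : T 0 0 = Z.card := by simp [T]
  rw [← add_sum_erase univ _ (mem_univ ((0, 0) : ZMod p × ZMod p)), hH0, hT0] at hmain
  have hrest : ‖∑ c ∈ univ.erase ((0, 0) : ZMod p × ZMod p), H c.1 * H c.2 * T c.1 c.2‖ ≤
      W ^ 2 * B := by
    calc _ ≤ ∑ c ∈ univ.erase ((0, 0) : ZMod p × ZMod p), ‖H c.1‖ * ‖H c.2‖ * B := by
          refine norm_sum_le_of_le _ fun c hc => ?_
          rw [norm_mul, norm_mul]
          refine mul_le_mul_of_nonneg_left (hB _ _ ?_) (by positivity)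
          have := (mem_erase.mp hc).1
          rw [neg_ne_zero, neg_ne_zero]
          by_contra! h
          exact this (Prod.ext h.1 h.2)
      _ ≤ ∑ c : ZMod p × ZMod p, ‖H c.1‖ * ‖H c.2‖ * B :=
          sum_le_sum_of_subset_of_nonneg (subset_univ _) fun _ _ _ => by positivity
      _ = (∑ a, ‖H a‖) ^ 2 * B := by
          rw [sq, sum_mul_sum, sum_mul, Fintype.sum_prod_type]
          simp only [sum_mul]
      _ ≤ _ := by
          gcongr
  have h := congrArg Norm.norm hmain
  have h2 := norm_add_le ((I.card : ℂ) * I.card * Z.card)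
    (∑ c ∈ univ.erase ((0, 0) : ZMod p × ZMod p), H c.1 * H c.2 * T c.1 c.2)
  rw [← h] at h2
  simp only [norm_mul, norm_pow, Complex.norm_natCast] at h2
  linarith [sq (I.card : ℝ)]

end CompleteSums

end

section

open Module Finset Polynomial

lemma Pfact_monic (p j : ℕ) : (Pfact p j).Monic :=
  monic_prod_of_monic _ _ fun _ _ => monic_X_add_C _

lemma Pfact_natDegree (p j : ℕ) [Fact p.Prime] : (Pfact p j).natDegree = j := by
  rw [Pfact, natDegree_prod_of_monic _ _ fun i _ => monic_X_add_C _,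
    sum_congr rfl fun i _ => natDegree_X_add_C _]
  simp

lemma card_inter_image_le {F : Type*} [Field F] [Fintype F] [DecidableEq F] (f g : F[X])
    (I : Finset F) :
    ((I.image fun x => eval x f) ∩ (I.image fun x => eval x g)).card ≤
      (((univ : Finset (F × F)).filter fun z => eval z.2 g = eval z.1 f).filter
        fun z => z.1 ∈ I ∧ z.2 ∈ I).card := by
  refine (card_le_card ?_).trans (card_image_le (f := fun z : F × F => eval z.1 f))
  intro v hv
  obtain ⟨h1, h2⟩ := mem_inter.mp hv
  obtain ⟨a, ha, rfl⟩ := mem_image.mp h1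
  obtain ⟨b, hb, hab⟩ := mem_image.mp h2
  exact mem_image.mpr ⟨(a, b), by simp [ha, hb, hab], rfl⟩

/-- **Equation (2).** For a large enough prime `p`, odd primes `k < j < p − 2`, and `I` (the
image of) a finite arithmetic progression,
`|P_j(I) ∩ P_k(I)| ≤ |I|²/p + C·j²·√p·(log p)²`. -/
theorem card_inter_image_Pfact_ap :
    ∃ C : ℝ, C > 0 ∧ ∃ p₀ : ℕ, ∀ p : ℕ, p.Prime → p > p₀ →
      ∀ j k : ℕ, j.Prime → k.Prime → Odd j → Odd k → k < j → j + 2 < p →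
      ∀ (s r : ZMod p) (m : ℕ), r ≠ 0 → 1 ≤ m →
        ((((apImage p s r m).image (fun x => Polynomial.eval x (Pfact p j))) ∩
            ((apImage p s r m).image (fun x => Polynomial.eval x (Pfact p k)))).card : ℝ) ≤
          ((apImage p s r m).card : ℝ) ^ 2 / (p : ℝ) +
            C * (j : ℝ) ^ 2 * Real.sqrt p * (Real.log p) ^ 2 := by
  refine ⟨40, by norm_num, 3, fun p hp hp3 j k hj hk _ _ hkj hjp s r m hr _ => ?_⟩
  have : Fact p.Prime := ⟨hp⟩
  have hp0 : (0 : ℝ) < p := by exact_mod_cast hp.pos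
  have hdj := Pfact_natDegree p j
  have hdk := Pfact_natDegree p k
  obtain ⟨h1, h2⟩ := CurveRing.norm_sum_points_le (f := Pfact p j) (g := Pfact p k)
    (Pfact_monic p k) (by rw [hdk]; exact hk.two_le) (by rwa [hdj, hdk])
    (by rw [hdj, hdk]; exact (Nat.coprime_primes hj hk).mpr hkj.ne') (by omega)
  rw [hdj] at h1 h2
  have hψ := ZMod.isPrimitive_stdAddChar p
  have hψ1 : ZMod.stdAddChar (N := p) ≠ 1 := by
    intro h
    have := hψ one_ne_zero
    rw [h] at this
    exact this (by ext; simp)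
  set I := apImage p s r m
  set B : ℝ := 4 * j ^ 2 * √p
  have hB : 0 ≤ B := by positivity
  have h3 := card_filter_mem_le hψ _ I (h2 _ hψ1) hB (sum_norm_sum_apImage_le s hr m)
  have h4 : (((I.image fun x => eval x (Pfact p j)) ∩ (I.image fun x => eval x (Pfact p k))).card
      : ℝ) ≤ _ := Nat.cast_le.mpr (card_inter_image_le (Pfact p j) (Pfact p k) I)
  refine h4.trans (le_of_mul_le_mul_left (h3.trans ?_) (pow_pos hp0 2))
  have hlog : 1 ≤ Real.log p := by
    rw [Real.le_log_iff_exp_le hp0]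
    have : (3 : ℝ) ≤ p := by exact_mod_cast hp3.le
    linarith [Real.exp_one_lt_d9]
  have hI : (I.card : ℝ) ≤ p := by
    have := card_le_univ I
    rw [ZMod.card] at this
    exact_mod_cast this
  have h5 := (abs_le.mp h1).2
  have h6 : (I.card : ℝ) ^ 2 * ((univ.filter fun z : ZMod p × ZMod p =>
      eval z.2 (Pfact p k) = eval z.1 (Pfact p j)).card : ℝ) ≤ (I.card : ℝ) ^ 2 * p + p ^ 2 * B := by
    refine (mul_le_mul_of_nonneg_left (by linarith : _ ≤ p + B) (by positivity)).trans ?_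
    rw [mul_add]
    gcongr
  have h7 : (p : ℝ) ^ 2 * ((I.card : ℝ) ^ 2 / p + 40 * j ^ 2 * √p * Real.log p ^ 2) =
      (I.card : ℝ) ^ 2 * p + p ^ 2 * B * (10 * Real.log p ^ 2) := by
    simp only [B]
    field_simp
    ring
  have h8 : 1 + (2 + Real.log p) ^ 2 ≤ 10 * Real.log p ^ 2 := by nlinarith
  rw [h7]
  have h9 := mul_le_mul_of_nonneg_left h8 (by positivity : 0 ≤ (p : ℝ) ^ 2 * B)
  nlinarith

end
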